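/- Let B be an open ball of ℝ^d centered at the origin and let h ∈ C(B). Then h is Δ_k-harmonic in B in the distributional sense if and only if h is of class C² on B and Δ_k h(x) = 0 for every x ∈ B with ⟨α,x⟩ ≠ 0 for all α ∈ R. -/

import Mathlib

open MeasureTheory Real Filter
open scoped RealInnerProductSpace ENNReal Topology

noncomputable section

abbrev E (d : ℕ) := EuclideanSpace ℝ (Fin d)

/-- The reflection σ_α in the hyperplane orthogonal to α. -/
def dunklReflect {d : ℕ} (α x : E d) : E d := x - ((2 * ⟪α, x⟫) / ‖α‖ ^ 2) • α

/-- The Euclidean Laplacian, as the trace of the second derivative. -/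
def lap {d : ℕ} (u : E d → ℝ) (x : E d) : ℝ :=
  ∑ i : Fin d, iteratedFDeriv ℝ 2 u x ![EuclideanSpace.single i 1, EuclideanSpace.single i 1]

/-- The Dunkl Laplacian Δ_k associated with the root system `R` and multiplicity `k`. -/
def dunklLap {d : ℕ} (R : Finset (E d)) (k : E d → ℝ) (u : E d → ℝ) (x : E d) : ℝ :=
  lap u x + ∑ α ∈ R, k α * (⟪gradient u x, α⟫ / ⟪α, x⟫ -
    (‖α‖ ^ 2 / 2) * ((u x - u (dunklReflect α x)) / ⟪α, x⟫ ^ 2))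

/-- The weight function w_k. -/
def wk {d : ℕ} (R : Finset (E d)) (k : E d → ℝ) (x : E d) : ℝ :=
  ∏ α ∈ R, |⟪x, α⟫| ^ (k α)

/-- `h` is Δ_k-harmonic on `D` in the distributional sense. -/
def IsDunklHarmonic {d : ℕ} (R : Finset (E d)) (k : E d → ℝ) (D : Set (E d))
    (h : E d → ℝ) : Prop :=
  ∀ ψ : E d → ℝ, ContDiff ℝ (⊤ : ℕ∞) ψ → HasCompactSupport ψ → tsupport ψ ⊆ D →
    ∫ x in D, h x * dunklLap R k ψ x * wk R k x = 0

namespace Dunkl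

variable {d : ℕ}

/-! ### Reflections -/

lemma dunklReflect_eq_reflection (α x : E d) :
    dunklReflect α x = (ℝ ∙ α)ᗮ.reflection x := by
  rw [Submodule.reflection_orthogonal_apply, Submodule.reflection_singleton_apply, dunklReflect]
  simp only [RCLike.ofReal_real_eq_id, id]
  rw [neg_sub, ← Nat.cast_smul_eq_nsmul ℝ, smul_smul]
  push_cast
  rw [mul_div_assoc]

lemma norm_dunklReflect (α x : E d) : ‖dunklReflect α x‖ = ‖x‖ := by
  rw [dunklReflect_eq_reflection, LinearIsometryEquiv.norm_map]

lemma dunklReflect_dunklReflect (α x : E d) : dunklReflect α (dunklReflect α x) = x := by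
  simp only [dunklReflect_eq_reflection, Submodule.reflection_reflection]

lemma inner_dunklReflect (α x y : E d) :
    ⟪dunklReflect α x, y⟫ = ⟪x, dunklReflect α y⟫ := by
  simp only [dunklReflect, inner_sub_left, inner_sub_right, real_inner_smul_left,
    real_inner_smul_right, real_inner_comm α x]
  ring

lemma inner_self_dunklReflect {α : E d} (hα : α ≠ 0) (x : E d) :
    ⟪α, dunklReflect α x⟫ = -⟪α, x⟫ := by
  have : ‖α‖ ≠ 0 := norm_ne_zero_iff.2 hα
  simp only [dunklReflect, inner_sub_right, real_inner_smul_right, real_inner_self_eq_norm_sq]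
  field_simp
  ring

lemma continuous_dunklReflect (α : E d) : Continuous (dunklReflect α) := by
  unfold dunklReflect
  fun_prop

lemma integral_comp_dunklReflect (α : E d) (f : E d → ℝ) :
    ∫ x, f (dunklReflect α x) = ∫ x, f x := by
  simp only [dunklReflect_eq_reflection]
  exact ((ℝ ∙ α)ᗮ.reflection.measurePreserving).integral_comp
    (ℝ ∙ α)ᗮ.reflection.toHomeomorph.measurableEmbedding f

/-! ### The regularised operator -/

/-- The second derivative as a bilinear map. -/
abbrev hess (u : E d → ℝ) (x : E d) : E d →L[ℝ] E d →L[ℝ] ℝ := fderiv ℝ (fderiv ℝ u) x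

/-- The contribution of the root `α` to the Dunkl Laplacian, in Taylor remainder form; this
form makes sense on the reflection hyperplane as well. -/
def rootOp (α : E d) (u : E d → ℝ) (x : E d) : ℝ :=
  2 / ‖α‖ ^ 2 * ∫ t in (0:ℝ)..1,
    (1 - t) * hess u (x - (t * (2 * ⟪α, x⟫ / ‖α‖ ^ 2)) • α) α α

/-- The extension of the Dunkl Laplacian of a `C²` function across the reflection hyperplanes. -/
def regLap (R : Finset (E d)) (k : E d → ℝ) (u : E d → ℝ) (x : E d) : ℝ :=
  lap u x + ∑ α ∈ R, k α * rootOp α u x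

lemma lap_eq (u : E d → ℝ) (x : E d) :
    lap u x = ∑ i, hess u x (EuclideanSpace.single i 1) (EuclideanSpace.single i 1) := by
  simp [lap, iteratedFDeriv_two_apply]

lemma contDiff_fderiv {u : E d → ℝ} (hu : ContDiff ℝ 2 u) : ContDiff ℝ 1 (fderiv ℝ u) :=
  hu.fderiv_right (m := 1) (by norm_num)

lemma differentiable_of_contDiff_two {u : E d → ℝ} (hu : ContDiff ℝ 2 u) :
    Differentiable ℝ u := hu.differentiable (by norm_num)

lemma differentiable_fderiv {u : E d → ℝ} (hu : ContDiff ℝ 2 u) :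
    Differentiable ℝ (fderiv ℝ u) := (contDiff_fderiv hu).differentiable (by norm_num)

lemma continuous_hess {u : E d → ℝ} (hu : ContDiff ℝ 2 u) : Continuous (hess u) :=
  (contDiff_fderiv hu).continuous_fderiv (by norm_num)

lemma continuous_hess_apply {u : E d → ℝ} (hu : ContDiff ℝ 2 u) (a b : E d) :
    Continuous fun x => hess u x a b :=
  ((continuous_hess hu).clm_apply continuous_const).clm_apply continuous_const

lemma taylor_two {f f' f'' : ℝ → ℝ} (h1 : ∀ t, HasDerivAt f (f' t) t)
    (h2 : ∀ t, HasDerivAt f' (f'' t) t) (h3 : Continuous f'') :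
    f 1 = f 0 + f' 0 + ∫ t in (0:ℝ)..1, (1 - t) * f'' t := by
  have hF : ∀ t ∈ Set.uIcc (0:ℝ) 1, HasDerivAt (fun t => f t + (1 - t) * f' t)
      ((1 - t) * f'' t) t := by
    intro t _
    have := (h1 t).add ((((hasDerivAt_id t).const_sub 1)).mul (h2 t))
    refine this.congr_deriv ?_
    simp only [id]
    ring
  rw [intervalIntegral.integral_eq_sub_of_hasDerivAt hF
    (Continuous.intervalIntegrable (by fun_prop) _ _)]
  ring

lemma hasDerivAt_line {u : E d → ℝ} (hu : Differentiable ℝ u) (x v : E d) (t : ℝ) :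
    HasDerivAt (fun t : ℝ => u (x + t • v)) (fderiv ℝ u (x + t • v) v) t := by
  have h1 : HasDerivAt (fun t : ℝ => x + t • v) v t := by
    simpa using ((hasDerivAt_id t).smul_const v).const_add x
  exact (hu (x + t • v)).hasFDerivAt.comp_hasDerivAt t h1

lemma hasDerivAt_line_fderiv {u : E d → ℝ} (hu : ContDiff ℝ 2 u) (x v w : E d) (t : ℝ) :
    HasDerivAt (fun t : ℝ => fderiv ℝ u (x + t • v) w) (hess u (x + t • v) v w) t := by
  have h1 : HasDerivAt (fun t : ℝ => x + t • v) v t := by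
    simpa using ((hasDerivAt_id t).smul_const v).const_add x
  have := (differentiable_fderiv hu (x + t • v)).hasFDerivAt.comp_hasDerivAt t h1
  exact this.clm_apply (hasDerivAt_const t w) |>.congr_deriv (by simp)

lemma rootOp_spec {α : E d} (hα : α ≠ 0) {u : E d → ℝ} (hu : ContDiff ℝ 2 u) (x : E d) :
    ⟪α, x⟫ * fderiv ℝ u x α - ‖α‖ ^ 2 / 2 * (u x - u (dunklReflect α x))
      = ⟪α, x⟫ ^ 2 * rootOp α u x := by
  have hn : ‖α‖ ≠ 0 := norm_ne_zero_iff.2 hα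
  set s : ℝ := 2 * ⟪α, x⟫ / ‖α‖ ^ 2 with hs
  have hT := taylor_two (hasDerivAt_line (differentiable_of_contDiff_two hu) x (-s • α))
    (hasDerivAt_line_fderiv hu x (-s • α) (-s • α))
    (by
      have := continuous_hess_apply hu (-s • α) (-s • α)
      exact this.comp (by fun_prop))
  have e1 : x + (1:ℝ) • (-s • α) = dunklReflect α x := by
    simp [dunklReflect, hs, sub_eq_add_neg]
  have e2 : ∫ t in (0:ℝ)..1, (1 - t) * hess u (x + t • (-s • α)) (-s • α) (-s • α)
      = s ^ 2 * ∫ t in (0:ℝ)..1, (1 - t) * hess u (x - (t * s) • α) α α := by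
    rw [← intervalIntegral.integral_const_mul]
    congr 1 with t
    have : x + t • (-s • α) = x - (t * s) • α := by
      rw [smul_smul, sub_eq_add_neg, ← neg_smul]; ring_nf
    rw [this]
    simp only [map_smul, FunLike.coe_smul, Pi.smul_apply, smul_eq_mul]
    ring
  rw [e1, e2] at hT
  simp only [zero_smul, add_zero, map_smul, smul_eq_mul] at hT
  rw [rootOp, ← hs, hT]
  have hx : ⟪α, x⟫ = s * ‖α‖ ^ 2 / 2 := by rw [hs]; field_simp
  rw [hx]
  field_simp
  ring

lemma inner_gradient (u : E d → ℝ) (x v : E d) : ⟪gradient u x, v⟫ = fderiv ℝ u x v := by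
  simp [gradient]

lemma dunklLap_eq_regLap {R : Finset (E d)} {k : E d → ℝ} {u : E d → ℝ} (hu : ContDiff ℝ 2 u)
    {x : E d} (hx : ∀ α ∈ R, ⟪α, x⟫ ≠ 0) : dunklLap R k u x = regLap R k u x := by
  unfold dunklLap regLap
  congr 1
  refine Finset.sum_congr rfl fun α hα => ?_
  have h0 := hx α hα
  have hα0 : α ≠ 0 := by rintro rfl; simp at h0
  have := rootOp_spec hα0 hu x
  congr 1
  rw [inner_gradient]
  field_simp
  linarith

lemma wk_eq_zero {R : Finset (E d)} {k : E d → ℝ} (hk : ∀ α ∈ R, 0 < k α) {x α : E d}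
    (hα : α ∈ R) (hx : ⟪α, x⟫ = 0) : wk R k x = 0 := by
  refine Finset.prod_eq_zero hα ?_
  rw [real_inner_comm, hx, abs_zero, Real.zero_rpow (hk α hα).ne']

lemma dunklLap_mul_wk {R : Finset (E d)} {k : E d → ℝ} (hk : ∀ α ∈ R, 0 < k α)
    {u : E d → ℝ} (hu : ContDiff ℝ 2 u) (x : E d) :
    dunklLap R k u x * wk R k x = regLap R k u x * wk R k x := by
  by_cases h : ∀ α ∈ R, ⟪α, x⟫ ≠ 0
  · rw [dunklLap_eq_regLap hu h]
  · push Not at h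
    obtain ⟨α, hα, h0⟩ := h
    rw [wk_eq_zero hk hα h0, mul_zero, mul_zero]

lemma continuous_lap {u : E d → ℝ} (hu : ContDiff ℝ 2 u) : Continuous (lap u) := by
  have : lap u = fun x => ∑ i, hess u x (EuclideanSpace.single i 1) (EuclideanSpace.single i 1) :=
    funext (lap_eq u)
  rw [this]
  exact continuous_finsetSum _ fun i _ => continuous_hess_apply hu _ _

lemma continuous_rootOp (α : E d) {u : E d → ℝ} (hu : ContDiff ℝ 2 u) :
    Continuous (rootOp α u) := by
  refine continuous_const.mul ?_
  have h := continuous_hess_apply hu α α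
  refine intervalIntegral.continuous_parametric_intervalIntegral_of_continuous' ?_ 0 1
  have h2 : Continuous (fun p : E d × ℝ => p.1 - (p.2 * (2 * ⟪α, p.1⟫ / ‖α‖ ^ 2)) • α) := by
    fun_prop
  exact (continuous_const.sub continuous_snd).mul (h.comp h2)

lemma continuous_regLap (R : Finset (E d)) (k : E d → ℝ) {u : E d → ℝ} (hu : ContDiff ℝ 2 u) :
    Continuous (regLap R k u) :=
  (continuous_lap hu).add (continuous_finsetSum _ fun α _ =>
    continuous_const.mul (continuous_rootOp α hu))

lemma continuous_wk {R : Finset (E d)} {k : E d → ℝ} (hk : ∀ α ∈ R, 0 < k α) :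
    Continuous (wk R k) :=
  continuous_finsetProd _ fun α hα =>
    Continuous.rpow_const (by fun_prop) fun _ => Or.inr (hk α hα).le

lemma wk_nonneg (R : Finset (E d)) (k : E d → ℝ) (x : E d) : 0 ≤ wk R k x :=
  Finset.prod_nonneg fun _ _ => Real.rpow_nonneg (abs_nonneg _) _

lemma wk_pos {R : Finset (E d)} {k : E d → ℝ} {x : E d} (hx : ∀ α ∈ R, ⟪α, x⟫ ≠ 0) :
    0 < wk R k x :=
  Finset.prod_pos fun α hα => Real.rpow_pos_of_pos
    (abs_pos.2 (by rw [real_inner_comm]; exact hx α hα)) _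

/-! ### Linearity -/

lemma fderiv_add_fun {u v : E d → ℝ} (hu : ContDiff ℝ 2 u) (hv : ContDiff ℝ 2 v) :
    fderiv ℝ (u + v) = fderiv ℝ u + fderiv ℝ v := by
  funext x
  exact fderiv_add (differentiable_of_contDiff_two hu x) (differentiable_of_contDiff_two hv x)

lemma hess_add {u v : E d → ℝ} (hu : ContDiff ℝ 2 u) (hv : ContDiff ℝ 2 v) (x : E d) :
    hess (u + v) x = hess u x + hess v x := by
  rw [hess, fderiv_add_fun hu hv]
  exact fderiv_add (differentiable_fderiv hu x) (differentiable_fderiv hv x)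

lemma hess_const_smul {u : E d → ℝ} (hu : ContDiff ℝ 2 u) (c : ℝ) (x : E d) :
    hess (c • u) x = c • hess u x := by
  have : fderiv ℝ (c • u) = c • fderiv ℝ u :=
    funext fun x => fderiv_const_smul (differentiable_of_contDiff_two hu x) c
  rw [hess, this]
  exact fderiv_const_smul (differentiable_fderiv hu x) c

lemma regLap_add (R : Finset (E d)) (k : E d → ℝ) {u v : E d → ℝ} (hu : ContDiff ℝ 2 u)
    (hv : ContDiff ℝ 2 v) : regLap R k (u + v) = regLap R k u + regLap R k v := by
  funext x
  have h1 : lap (u + v) x = lap u x + lap v x := by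
    simp only [lap_eq, hess_add hu hv, FunLike.coe_add, Pi.add_apply, Finset.sum_add_distrib]
  have h2 : ∀ α, rootOp α (u + v) x = rootOp α u x + rootOp α v x := by
    intro α
    have hc : Continuous fun t : ℝ => x - (t * (2 * ⟪α, x⟫ / ‖α‖ ^ 2)) • α := by fun_prop
    simp only [rootOp, hess_add hu hv, FunLike.coe_add, Pi.add_apply, mul_add]
    rw [intervalIntegral.integral_add, mul_add]
    · exact Continuous.intervalIntegrable ((continuous_const.sub continuous_id).mul
        ((continuous_hess_apply hu α α).comp hc)) _ _
    · exact Continuous.intervalIntegrable ((continuous_const.sub continuous_id).mul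
        ((continuous_hess_apply hv α α).comp hc)) _ _
  simp only [regLap, Pi.add_apply, h1, h2, mul_add, Finset.sum_add_distrib]
  ring

lemma regLap_const_smul (R : Finset (E d)) (k : E d → ℝ) {u : E d → ℝ} (hu : ContDiff ℝ 2 u)
    (c : ℝ) : regLap R k (c • u) = c • regLap R k u := by
  funext x
  simp only [regLap, Pi.smul_apply, lap_eq, rootOp, hess_const_smul hu, FunLike.coe_smul,
    smul_eq_mul, mul_left_comm _ c, intervalIntegral.integral_const_mul, ← Finset.mul_sum, mul_add]

lemma regLap_sub (R : Finset (E d)) (k : E d → ℝ) {u v : E d → ℝ} (hu : ContDiff ℝ 2 u)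
    (hv : ContDiff ℝ 2 v) : regLap R k (u - v) = regLap R k u - regLap R k v := by
  have : u - v = u + (-1 : ℝ) • v := by simp [sub_eq_add_neg]
  have h : ContDiff ℝ 2 ((-1 : ℝ) • v) := hv.const_smul (-1 : ℝ)
  rw [this, regLap_add R k hu h, regLap_const_smul R k hv]
  simp [sub_eq_add_neg]

lemma regLap_zero (R : Finset (E d)) (k : E d → ℝ) : regLap R k 0 = 0 := by
  have := regLap_const_smul R k (u := (0 : E d → ℝ)) contDiff_const 0
  simpa using this

lemma regLap_sum (R : Finset (E d)) (k : E d → ℝ) {ι : Type*} (s : Finset ι) {u : ι → E d → ℝ}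
    (hu : ∀ i, ContDiff ℝ 2 (u i)) :
    regLap R k (∑ i ∈ s, u i) = ∑ i ∈ s, regLap R k (u i) := by
  classical
  induction s using Finset.induction_on with
  | empty => simp [regLap_zero]
  | insert a s ha ih =>
    rw [Finset.sum_insert ha, Finset.sum_insert ha, regLap_add R k (hu a), ih]
    have : (∑ i ∈ s, u i) = fun x => ∑ i ∈ s, u i x := by ext; simp
    rw [this]
    exact ContDiff.sum fun i _ => hu i

/-! ### Supports -/

lemma hess_eq_zero_of_tsupport {ψ : E d → ℝ} {x : E d} (hx : x ∉ tsupport ψ) :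
    hess ψ x = 0 := by
  by_contra h
  exact hx (tsupport_fderiv_subset ℝ (tsupport_fderiv_subset ℝ (subset_tsupport _ h)))

lemma notMem_tsupport_of_lt_norm {ψ : E d → ℝ} {ρ : ℝ}
    (h : tsupport ψ ⊆ Metric.closedBall 0 ρ) {x : E d} (hx : ρ < ‖x‖) : x ∉ tsupport ψ := by
  intro hmem
  have := h hmem
  rw [mem_closedBall_zero_iff] at this
  linarith

lemma rootOp_eq_zero_of_lt_norm {α : E d} (hα : α ≠ 0) {ψ : E d → ℝ} {ρ : ℝ}
    (h : tsupport ψ ⊆ Metric.closedBall 0 ρ) (hψ : ContDiff ℝ 2 ψ) {x : E d} (hx : ρ < ‖x‖) :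
    rootOp α ψ x = 0 := by
  have hout := notMem_tsupport_of_lt_norm h hx
  by_cases h0 : ⟪α, x⟫ = 0
  · simp [rootOp, h0, hess_eq_zero_of_tsupport hout]
  · have hs := rootOp_spec hα hψ x
    have h1 : fderiv ℝ ψ x = 0 := by
      by_contra hne
      exact hout (tsupport_fderiv_subset ℝ (subset_tsupport _ hne))
    have h2 := notMem_tsupport_of_lt_norm h (x := dunklReflect α x)
      (by rwa [norm_dunklReflect])
    rw [h1, image_eq_zero_of_notMem_tsupport hout, image_eq_zero_of_notMem_tsupport h2] at hs
    simpa [h0] using hs.symm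

lemma lap_eq_zero_of_lt_norm {ψ : E d → ℝ} {ρ : ℝ}
    (h : tsupport ψ ⊆ Metric.closedBall 0 ρ) {x : E d} (hx : ρ < ‖x‖) : lap ψ x = 0 := by
  simp [lap_eq, hess_eq_zero_of_tsupport (notMem_tsupport_of_lt_norm h hx)]

lemma regLap_eq_zero_of_lt_norm {R : Finset (E d)} (hR0 : ∀ α ∈ R, α ≠ 0) (k : E d → ℝ)
    {ψ : E d → ℝ} {ρ : ℝ} (h : tsupport ψ ⊆ Metric.closedBall 0 ρ) (hψ : ContDiff ℝ 2 ψ)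
    {x : E d} (hx : ρ < ‖x‖) : regLap R k ψ x = 0 := by
  rw [regLap, lap_eq_zero_of_lt_norm h hx, zero_add]
  exact Finset.sum_eq_zero fun α hα => by
    rw [rootOp_eq_zero_of_lt_norm (hR0 α hα) h hψ hx, mul_zero]

/-! ### Symmetry of the Dunkl Laplacian -/

/-- A smooth positive regularisation of the weight. -/
def wreg (R : Finset (E d)) (k : E d → ℝ) (ε : ℝ) (x : E d) : ℝ :=
  Real.exp (∑ α ∈ R, k α / 2 * Real.log (⟪α, x⟫ ^ 2 + ε))

lemma wreg_dunklReflect {R : Finset (E d)} {k : E d → ℝ} {β : E d}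
    (hR : ∀ α ∈ R, dunklReflect β α ∈ R) (hk : ∀ α ∈ R, k (dunklReflect β α) = k α)
    (ε : ℝ) (x : E d) : wreg R k ε (dunklReflect β x) = wreg R k ε x := by
  unfold wreg
  congr 1
  refine Finset.sum_nbij' (dunklReflect β) (dunklReflect β) hR hR
    (fun α _ => dunklReflect_dunklReflect β α) (fun α _ => dunklReflect_dunklReflect β α) ?_
  intro α hα
  rw [hk α hα, inner_dunklReflect]

lemma hasFDerivAt_wreg (R : Finset (E d)) (k : E d → ℝ) {ε : ℝ} (hε : 0 < ε) (x : E d) :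
    HasFDerivAt (wreg R k ε)
      (wreg R k ε x • ∑ α ∈ R, (k α * ⟪α, x⟫ / (⟪α, x⟫ ^ 2 + ε)) • innerSL ℝ α) x := by
  refine HasFDerivAt.exp (f := fun x => ∑ α ∈ R, k α / 2 * Real.log (⟪α, x⟫ ^ 2 + ε))
    (HasFDerivAt.fun_sum fun α _ => ?_)
  have h1 : HasFDerivAt (fun x : E d => ⟪α, x⟫) (innerSL ℝ α) x := (innerSL ℝ α).hasFDerivAt
  have hpos : ⟪α, x⟫ ^ 2 + ε ≠ 0 := by positivity
  have h2 := (((h1.pow 2).add_const ε).log hpos).const_mul (k α / 2)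
  refine h2.congr_fderiv ?_
  ext v
  simp
  field_simp

lemma contDiff_wreg (R : Finset (E d)) (k : E d → ℝ) {ε : ℝ} (hε : 0 < ε) :
    ContDiff ℝ 1 (wreg R k ε) := by
  refine Real.contDiff_exp.comp (ContDiff.sum fun α _ => contDiff_const.mul ?_)
  refine ContDiff.log ?_ fun x => ?_
  · exact ((contDiff_const.inner ℝ contDiff_id).pow 2).add contDiff_const
  · positivity

lemma wreg_mono {R : Finset (E d)} {k : E d → ℝ} (hk : ∀ α ∈ R, 0 < k α) {ε ε' : ℝ}
    (hε : 0 < ε) (h : ε ≤ ε') (x : E d) : wreg R k ε x ≤ wreg R k ε' x := by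
  refine Real.exp_le_exp.2 (Finset.sum_le_sum fun α hα => ?_)
  have := hk α hα
  gcongr

lemma wreg_eq_prod (R : Finset (E d)) (k : E d → ℝ) {ε : ℝ} (hε : 0 < ε) (x : E d) :
    wreg R k ε x = ∏ α ∈ R, (⟪α, x⟫ ^ 2 + ε) ^ (k α / 2) := by
  rw [wreg, Real.exp_sum]
  refine Finset.prod_congr rfl fun α _ => ?_
  rw [Real.rpow_def_of_pos (by positivity), mul_comm]

lemma tendsto_wreg {R : Finset (E d)} {k : E d → ℝ} (hk : ∀ α ∈ R, 0 < k α) {ε : ℕ → ℝ}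
    (hε : ∀ n, 0 < ε n) (hlim : Tendsto ε atTop (𝓝 0)) (x : E d) :
    Tendsto (fun n => wreg R k (ε n) x) atTop (𝓝 (wk R k x)) := by
  simp only [wreg_eq_prod R k (hε _)]
  refine tendsto_finsetProd _ fun α hα => ?_
  have h1 : |⟪x, α⟫| ^ k α = (⟪α, x⟫ ^ 2 + 0) ^ (k α / 2) := by
    rw [add_zero, ← sq_abs, ← Real.rpow_natCast, ← Real.rpow_mul (abs_nonneg _),
      real_inner_comm]
    congr 1
    push_cast
    ring
  rw [h1]
  exact (hlim.const_add _).rpow_const (Or.inr (by have := hk α hα; positivity))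

lemma integral_fderiv_eq_zero {f : E d → ℝ} (hf : ContDiff ℝ 1 f) (hc : HasCompactSupport f)
    (v : E d) : ∫ x, fderiv ℝ f x v = 0 := by
  have h1 : Continuous fun x => fderiv ℝ f x v :=
    (hf.continuous_fderiv (by norm_num)).clm_apply continuous_const
  have h2 : HasCompactSupport fun x => fderiv ℝ f x v := hc.fderiv_apply ℝ v
  have := integral_mul_fderiv_eq_neg_fderiv_mul_of_integrable (μ := (volume : Measure (E d)))
    (f := fun _ => (1:ℝ)) (g := f) (v := v)
    (by simp) (by simpa using h1.integrable_of_hasCompactSupport h2)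
    (by simpa using hf.continuous.integrable_of_hasCompactSupport hc)
    (fun x _ => differentiableAt_const _) (fun x _ => hf.differentiable (by norm_num) x)
  simpa using this

lemma sum_coord_smul (α : E d) : ∑ i, α i • EuclideanSpace.single i (1:ℝ) = α := by
  ext j
  simp [Finset.sum_apply, Pi.single_apply]

lemma hasCompactSupport_comp_dunklReflect {ψ : E d → ℝ} (h : HasCompactSupport ψ) (α : E d) :
    HasCompactSupport fun x => ψ (dunklReflect α x) := by
  simp only [dunklReflect_eq_reflection]
  exact h.comp_homeomorph (ℝ ∙ α)ᗮ.reflection.toHomeomorph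

lemma integral_wreg_eq_zero {R : Finset (E d)} {k : E d → ℝ} (hR0 : ∀ α ∈ R, α ≠ 0)
    (hRrefl : ∀ α ∈ R, ∀ β ∈ R, dunklReflect α β ∈ R)
    (hkinv : ∀ α ∈ R, ∀ β ∈ R, k (dunklReflect α β) = k β)
    {u ψ : E d → ℝ} (hu : ContDiff ℝ 2 u) (hψ : ContDiff ℝ 2 ψ) (hc : HasCompactSupport ψ)
    {ε : ℝ} (hε : 0 < ε) :
    ∫ x, wreg R k ε x * (u x * lap ψ x - ψ x * lap u x + ∑ α ∈ R, k α *
      (⟪α, x⟫ ^ 2 / (⟪α, x⟫ ^ 2 + ε) * (u x * rootOp α ψ x - ψ x * rootOp α u x))) = 0 := by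
  set e : Fin d → E d := fun i => EuclideanSpace.single i 1 with he
  set J : Fin d → E d → ℝ := fun i x =>
    wreg R k ε x * (u x * fderiv ℝ ψ x (e i) - ψ x * fderiv ℝ u x (e i)) with hJ
  set K : E d → E d → ℝ := fun α x => wreg R k ε x *
    ((u x * ψ (dunklReflect α x) - ψ x * u (dunklReflect α x)) / (⟪α, x⟫ ^ 2 + ε)) with hK
  have hw := contDiff_wreg R k hε
  have hu1 := contDiff_fderiv hu
  have hψ1 := contDiff_fderiv hψ
  have hJd : ∀ i, ContDiff ℝ 1 (J i) := fun i =>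
    hw.mul (((hu.of_le (by norm_num)).mul (hψ1.clm_apply contDiff_const)).sub
      ((hψ.of_le (by norm_num)).mul (hu1.clm_apply contDiff_const)))
  have hJc : ∀ i, HasCompactSupport (J i) := fun i => by
    refine HasCompactSupport.mul_left ?_
    refine HasCompactSupport.sub ?_ ?_
    · exact (hc.fderiv_apply ℝ (e i)).mul_left
    · exact hc.mul_right
  have hKc : ∀ α, HasCompactSupport (K α) := fun α => by
    refine HasCompactSupport.mul_left ?_
    simp only [div_eq_mul_inv]
    refine HasCompactSupport.mul_right (HasCompactSupport.sub ?_ ?_)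
    · exact (hasCompactSupport_comp_dunklReflect hc α).mul_left
    · exact hc.mul_right
  have hKcont : ∀ α, Continuous (K α) := fun α => by
    have h1 := continuous_dunklReflect α
    have h2 := hu.continuous
    have h3 := hψ.continuous
    refine hw.continuous.mul (Continuous.div (by fun_prop) (by fun_prop) fun x => ?_)
    positivity
  have hK0 : ∀ α ∈ R, ∫ x, K α x = 0 := fun α hα => by
    have h1 : ∀ x, K α (dunklReflect α x) = - K α x := fun x => by
      simp only [hK, dunklReflect_dunklReflect, inner_self_dunklReflect (hR0 α hα),
        wreg_dunklReflect (hRrefl α hα) (hkinv α hα)]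
      ring
    have h2 := integral_comp_dunklReflect α (K α)
    simp only [h1, integral_neg] at h2
    linarith
  have key : ∀ x, wreg R k ε x * (u x * lap ψ x - ψ x * lap u x + ∑ α ∈ R, k α *
      (⟪α, x⟫ ^ 2 / (⟪α, x⟫ ^ 2 + ε) * (u x * rootOp α ψ x - ψ x * rootOp α u x)))
      = ∑ i, fderiv ℝ (J i) x (e i) + ∑ α ∈ R, k α * (‖α‖ ^ 2 / 2) * K α x := by
    intro x
    have hder : ∀ i, fderiv ℝ (J i) x (e i) = wreg R k ε x *
        (u x * hess ψ x (e i) (e i) - ψ x * hess u x (e i) (e i)) +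
        ∑ α ∈ R, wreg R k ε x * (k α * ⟪α, x⟫ / (⟪α, x⟫ ^ 2 + ε)) *
          (u x * (α i * fderiv ℝ ψ x (e i)) - ψ x * (α i * fderiv ℝ u x (e i))) := by
      intro i
      have a1 := (differentiable_of_contDiff_two hu x).hasFDerivAt
      have a2 := (differentiable_of_contDiff_two hψ x).hasFDerivAt
      have a3 := (differentiable_fderiv hu x).hasFDerivAt.clm_apply (hasFDerivAt_const (e i) x)
      have a4 := (differentiable_fderiv hψ x).hasFDerivAt.clm_apply (hasFDerivAt_const (e i) x)
      have a5 := (hasFDerivAt_wreg R k hε x).mul ((a1.mul a4).sub (a2.mul a3))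
      have a6 : fderiv ℝ (J i) x = _ := a5.fderiv
      rw [a6]
      simp only [ContinuousLinearMap.comp_zero, zero_add, FunLike.coe_add, FunLike.coe_smul,
        FunLike.coe_sub, Pi.add_apply, Pi.smul_apply, Pi.sub_apply, smul_eq_mul,
        ContinuousLinearMap.flip_apply, FunLike.coe_sum, Finset.sum_apply, innerSL_apply_apply,
        Pi.mul_apply]
      have hin : ∀ α : E d, ⟪α, e i⟫ = α i := fun α => by
        simp [he, EuclideanSpace.inner_single_right]
      simp only [hin, Finset.mul_sum]
      congr 1
      · ring
      · exact Finset.sum_congr rfl fun α _ => by ring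
    have hsum : ∀ (L : E d →L[ℝ] ℝ) (α : E d), ∑ i, α i * L (EuclideanSpace.single i 1) = L α :=
        fun L α => by
      conv_rhs => rw [← sum_coord_smul α]
      simp
    simp only [hder, Finset.sum_add_distrib]
    rw [Finset.sum_comm]
    simp only [← Finset.mul_sum, Finset.sum_sub_distrib, hsum, ← lap_eq, he]
    rw [mul_add, add_assoc, ← Finset.sum_add_distrib, Finset.mul_sum]
    congr 1
    refine Finset.sum_congr rfl fun α hα => ?_
    have s1 := rootOp_spec (hR0 α hα) hu x
    have s2 := rootOp_spec (hR0 α hα) hψ x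
    have hpos : ⟪α, x⟫ ^ 2 + ε ≠ 0 := by positivity
    simp only [hK]
    field_simp
    linear_combination wreg R k ε x * k α * ψ x * 2 * s1 - wreg R k ε x * k α * u x * 2 * s2
  simp only [key]
  have hJi : ∀ i, Integrable fun x => fderiv ℝ (J i) x (e i) := fun i =>
    (((hJd i).continuous_fderiv (by norm_num)).clm_apply
      continuous_const).integrable_of_hasCompactSupport ((hJc i).fderiv_apply ℝ (e i))
  have hKi : ∀ α, Integrable fun x => k α * (‖α‖ ^ 2 / 2) * K α x := fun α =>
    ((hKcont α).integrable_of_hasCompactSupport (hKc α)).const_mul _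
  rw [integral_add (integrable_finsetSum _ fun i _ => hJi i)
    (integrable_finsetSum _ fun α _ => hKi α), integral_finsetSum _ fun i _ => hJi i,
    integral_finsetSum _ fun α _ => hKi α]
  simp only [integral_fderiv_eq_zero (hJd _) (hJc _), integral_const_mul]
  rw [Finset.sum_const_zero, zero_add]
  exact Finset.sum_eq_zero fun α hα => by rw [hK0 α hα, mul_zero]

/-- The Dunkl Laplacian is symmetric with respect to the weight `wk`. -/
lemma integral_regLap_symm {R : Finset (E d)} {k : E d → ℝ} (hR0 : ∀ α ∈ R, α ≠ 0)
    (hRrefl : ∀ α ∈ R, ∀ β ∈ R, dunklReflect α β ∈ R) (hkpos : ∀ α ∈ R, 0 < k α)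
    (hkinv : ∀ α ∈ R, ∀ β ∈ R, k (dunklReflect α β) = k β)
    {u ψ : E d → ℝ} (hu : ContDiff ℝ 2 u) (hψ : ContDiff ℝ 2 ψ) (hc : HasCompactSupport ψ) :
    ∫ x, u x * regLap R k ψ x * wk R k x = ∫ x, ψ x * regLap R k u x * wk R k x := by
  obtain ⟨ρ, hρ⟩ := hc.isCompact.isBounded.subset_closedBall 0
  have cu := hu.continuous
  have cψ := hψ.continuous
  have cw := continuous_wk (d := d) hkpos
  have c1 := continuous_lap hu
  have c2 := continuous_lap hψ
  have c3 := fun α => continuous_rootOp α hu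
  have c4 := fun α => continuous_rootOp α hψ
  have c5 := continuous_regLap R k hu
  have c6 := continuous_regLap R k hψ
  have hsupp : ∀ f : E d → ℝ, (∀ x, ρ < ‖x‖ → f x = 0) → HasCompactSupport f := fun f hf =>
    HasCompactSupport.intro (isCompact_closedBall 0 ρ) fun x hx => hf x (by simpa using hx)
  have hψ0 : ∀ x, ρ < ‖x‖ → ψ x = 0 := fun x hx =>
    image_eq_zero_of_notMem_tsupport (notMem_tsupport_of_lt_norm hρ hx)
  have hL0 : ∀ x, ρ < ‖x‖ → regLap R k ψ x = 0 := fun x hx =>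
    regLap_eq_zero_of_lt_norm hR0 k hρ hψ hx
  have i1 : Integrable fun x => u x * regLap R k ψ x * wk R k x :=
    Continuous.integrable_of_hasCompactSupport (by fun_prop)
      (hsupp _ fun x hx => by simp [hL0 x hx])
  have i2 : Integrable fun x => ψ x * regLap R k u x * wk R k x :=
    Continuous.integrable_of_hasCompactSupport (by fun_prop)
      (hsupp _ fun x hx => by simp [hψ0 x hx])
  rw [← sub_eq_zero, ← integral_sub i1 i2]
  set ε : ℕ → ℝ := fun n => 1 / ((n : ℝ) + 1) with hεdef
  have hε : ∀ n, 0 < ε n := fun n => by positivity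
  have hlim : Tendsto ε atTop (𝓝 0) := tendsto_one_div_add_atTop_nhds_zero_nat
  have hε1 : ∀ n, ε n ≤ 1 := fun n => by
    rw [hεdef]
    exact div_le_one_of_le₀ (by simp) (by positivity)
  set F : ℕ → E d → ℝ := fun n x => wreg R k (ε n) x * (u x * lap ψ x - ψ x * lap u x +
    ∑ α ∈ R, k α * (⟪α, x⟫ ^ 2 / (⟪α, x⟫ ^ 2 + ε n) *
      (u x * rootOp α ψ x - ψ x * rootOp α u x))) with hF
  set bound : E d → ℝ := fun x => wreg R k 1 x * (|u x * lap ψ x - ψ x * lap u x| +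
    ∑ α ∈ R, k α * |u x * rootOp α ψ x - ψ x * rootOp α u x|) with hbound
  have cwr : ∀ n, Continuous (wreg R k (ε n)) := fun n => (contDiff_wreg R k (hε n)).continuous
  have cw1 : Continuous (wreg R k 1) := (contDiff_wreg R k one_pos).continuous
  have hFc : ∀ n, Continuous (F n) := fun n => by
    refine (cwr n).mul (Continuous.add (by fun_prop) (continuous_finsetSum _ fun α _ => ?_))
    refine continuous_const.mul (Continuous.mul (Continuous.div (by fun_prop) (by fun_prop)
      fun x => ?_) (by fun_prop))
    have := hε n
    positivity
  have hbi : Integrable bound := by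
    refine Continuous.integrable_of_hasCompactSupport (by fun_prop) (hsupp _ fun x hx => ?_)
    have : ∑ α ∈ R, k α * |u x * rootOp α ψ x - ψ x * rootOp α u x| = 0 :=
      Finset.sum_eq_zero fun α hα => by
        simp [hψ0 x hx, rootOp_eq_zero_of_lt_norm (hR0 α hα) hρ hψ hx]
    simp only [hbound]
    rw [this]
    simp [hψ0 x hx, lap_eq_zero_of_lt_norm hρ hx]
  have hT := tendsto_integral_of_dominated_convergence (μ := (volume : Measure (E d)))
    (F := F) (f := fun x => u x * regLap R k ψ x * wk R k x - ψ x * regLap R k u x * wk R k x)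
    bound (fun n => (hFc n).aestronglyMeasurable) hbi ?_ ?_
  · have h0 : ∀ n, ∫ x, F n x = 0 := fun n =>
      integral_wreg_eq_zero hR0 hRrefl hkinv hu hψ hc (hε n)
    simp only [h0] at hT
    exact (tendsto_nhds_unique hT tendsto_const_nhds)
  · intro n
    refine Eventually.of_forall fun x => ?_
    have hw0 : 0 ≤ wreg R k (ε n) x := (Real.exp_pos _).le
    rw [Real.norm_eq_abs, hF, hbound, abs_mul, abs_of_nonneg hw0]
    refine mul_le_mul (wreg_mono hkpos (hε n) (hε1 n) x) ?_ (abs_nonneg _) (Real.exp_pos _).le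
    refine (abs_add_le _ _).trans (add_le_add_right ?_ _)
    refine (Finset.abs_sum_le_sum_abs _ _).trans (Finset.sum_le_sum fun α hα => ?_)
    have hk := hkpos α hα
    have hp : 0 < ⟪α, x⟫ ^ 2 + ε n := by have := hε n; positivity
    rw [abs_mul, abs_of_pos hk, abs_mul]
    gcongr
    refine mul_le_of_le_one_left (abs_nonneg _) ?_
    rw [abs_of_nonneg (by positivity), div_le_one hp]
    linarith [hε n]
  · refine Eventually.of_forall fun x => ?_
    have hwl := tendsto_wreg hkpos hε hlim x
    by_cases hx : ∀ α ∈ R, ⟪α, x⟫ ≠ 0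
    · have hr : u x * regLap R k ψ x * wk R k x - ψ x * regLap R k u x * wk R k x =
          wk R k x * (u x * lap ψ x - ψ x * lap u x + ∑ α ∈ R, k α *
            (⟪α, x⟫ ^ 2 / (⟪α, x⟫ ^ 2 + 0) * (u x * rootOp α ψ x - ψ x * rootOp α u x))) := by
        have : ∑ α ∈ R, k α *
            (⟪α, x⟫ ^ 2 / (⟪α, x⟫ ^ 2 + 0) * (u x * rootOp α ψ x - ψ x * rootOp α u x)) =
            u x * (∑ α ∈ R, k α * rootOp α ψ x) - ψ x * (∑ α ∈ R, k α * rootOp α u x) := by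
          rw [Finset.mul_sum, Finset.mul_sum, ← Finset.sum_sub_distrib]
          refine Finset.sum_congr rfl fun α hα => ?_
          have := hx α hα
          field_simp
          ring
        rw [this]
        simp only [regLap]
        ring
      rw [hr]
      refine hwl.mul (tendsto_const_nhds.add (tendsto_finsetSum _ fun α hα => ?_))
      refine (Tendsto.div tendsto_const_nhds (hlim.const_add _) ?_).mul_const _ |>.const_mul _
      have := hx α hα
      positivity
    · push Not at hx
      obtain ⟨α, hα, h0⟩ := hx
      have hw0 := wk_eq_zero hkpos hα h0
      rw [hw0] at hwl ⊢
      simp only [mul_zero, sub_zero]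
      have hT1 : Tendsto (fun n => wreg R k (ε n) x * (|u x * lap ψ x - ψ x * lap u x| +
          ∑ α ∈ R, k α * |u x * rootOp α ψ x - ψ x * rootOp α u x|)) atTop (𝓝 0) := by
        simpa using hwl.mul_const _
      refine squeeze_zero_norm (fun n => ?_) hT1
      have hw0 : 0 ≤ wreg R k (ε n) x := (Real.exp_pos _).le
      rw [Real.norm_eq_abs, hF, abs_mul, abs_of_nonneg hw0]
      refine mul_le_mul_of_nonneg_left ?_ hw0
      refine (abs_add_le _ _).trans (add_le_add_right ?_ _)
      refine (Finset.abs_sum_le_sum_abs _ _).trans (Finset.sum_le_sum fun α hα => ?_)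
      have hk := hkpos α hα
      have hp : 0 < ⟪α, x⟫ ^ 2 + ε n := by have := hε n; positivity
      rw [abs_mul, abs_of_pos hk, abs_mul]
      gcongr
      refine mul_le_of_le_one_left (abs_nonneg _) ?_
      rw [abs_of_nonneg (by positivity), div_le_one hp]
      linarith [hε n]

/-! ### Homogeneous polynomial functions -/

/-- The space of homogeneous polynomial functions of degree `n`. -/
def HP (d : ℕ) : ℕ → Submodule ℝ (E d → ℝ)
  | 0 => Submodule.span ℝ {1}
  | n + 1 => ⨆ i : Fin d, (HP d n).map (LinearMap.mulLeft ℝ (fun x : E d => x i))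

lemma const_mem_HP (c : ℝ) : (fun _ => c) ∈ HP d 0 :=
  Submodule.mem_span_singleton.2 ⟨c, by ext; simp⟩

lemma coord_mul_mem_HP {n : ℕ} {u : E d → ℝ} (hu : u ∈ HP d n) (i : Fin d) :
    (fun x => x i * u x) ∈ HP d (n + 1) :=
  Submodule.mem_iSup_of_mem (p := fun i : Fin d =>
    (HP d n).map (LinearMap.mulLeft ℝ (fun x : E d => x i))) i ⟨u, hu, rfl⟩

lemma HP_induction {motive : ℕ → (E d → ℝ) → Prop}
    (const : ∀ c : ℝ, motive 0 fun _ => c) (zero : ∀ n, motive n 0)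
    (add : ∀ n u v, u ∈ HP d n → v ∈ HP d n → motive n u → motive n v → motive n (u + v))
    (step : ∀ n i u, u ∈ HP d n → motive n u → motive (n + 1) fun x => x i * u x)
    {n : ℕ} {u : E d → ℝ} (hu : u ∈ HP d n) : motive n u := by
  induction n generalizing u with
  | zero =>
    obtain ⟨c, rfl⟩ := Submodule.mem_span_singleton.1 hu
    convert const c using 1
    ext; simp
  | succ n ih =>
    have : u ∈ HP d (n + 1) ∧ motive (n + 1) u := by
      refine Submodule.iSup_induction _ (motive := fun u => u ∈ HP d (n + 1) ∧ motive (n + 1) u)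
        hu ?_ ⟨zero_mem _, zero _⟩ ?_
      · rintro i _ ⟨v, hv, rfl⟩
        exact ⟨coord_mul_mem_HP hv i, step n i v hv (ih hv)⟩
      · rintro u v ⟨hu, hu'⟩ ⟨hv, hv'⟩
        exact ⟨add_mem hu hv, add _ _ _ hu hv hu' hv'⟩
    exact this.2

lemma contDiff_of_mem_HP {m : WithTop ℕ∞} {n : ℕ} {u : E d → ℝ} (hu : u ∈ HP d n) :
    ContDiff ℝ m u := by
  refine HP_induction (motive := fun _ u => ContDiff ℝ m u) (fun _ => contDiff_const)
    (fun _ => contDiff_const) (fun _ _ _ _ _ h h' => h.add h') (fun n i u _ h => ?_) hu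
  exact ContDiff.mul (by fun_prop) h

lemma map_smul_of_mem_HP {n : ℕ} {u : E d → ℝ} (hu : u ∈ HP d n) (t : ℝ) (x : E d) :
    u (t • x) = t ^ n * u x := by
  refine HP_induction (motive := fun n u => u (t • x) = t ^ n * u x) (fun _ => by simp)
    (fun _ => by simp) (fun _ _ _ _ _ h h' => by simp [h, h', mul_add])
    (fun n i u _ h => ?_) hu
  simp only [PiLp.smul_apply, smul_eq_mul, h]
  ring

lemma mul_mem_HP {n m : ℕ} {u v : E d → ℝ} (hu : u ∈ HP d n) (hv : v ∈ HP d m) :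
    (fun x => u x * v x) ∈ HP d (n + m) := by
  refine HP_induction (motive := fun n u => (fun x => u x * v x) ∈ HP d (n + m)) (fun c => ?_)
    (fun n => ?_) (fun _ _ _ _ _ h h' => ?_) (fun n i u _ h => ?_) hu
  · rw [zero_add]; exact Submodule.smul_mem _ c hv
  · have : (fun x => (0 : E d → ℝ) x * v x) = 0 := by ext; simp
    rw [this]
    exact zero_mem _
  · simp only [Pi.add_apply, add_mul]
    exact add_mem h h'
  · rw [Nat.succ_add]
    simpa only [mul_assoc] using coord_mul_mem_HP h i

lemma coord_mem_HP (i : Fin d) : (fun x : E d => x i) ∈ HP d 1 := by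
  simpa using coord_mul_mem_HP (const_mem_HP (d := d) 1) i

lemma clm_mem_HP (L : E d →L[ℝ] ℝ) : (fun x => L x) ∈ HP d 1 := by
  have : (fun x => L x) = ∑ i, L (EuclideanSpace.single i 1) • fun x : E d => x i := by
    ext x
    conv_lhs => rw [← sum_coord_smul x]
    simp [mul_comm]
  rw [this]
  exact sum_mem fun i _ => Submodule.smul_mem _ _ (coord_mem_HP i)

lemma norm_sq_mem_HP : (fun x : E d => ‖x‖ ^ 2) ∈ HP d 2 := by
  have : (fun x : E d => ‖x‖ ^ 2) = ∑ i, fun x : E d => x i * x i := by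
    ext x
    rw [EuclideanSpace.norm_sq_eq]
    simp [sq]
  rw [this]
  exact sum_mem fun i _ => coord_mul_mem_HP (coord_mem_HP i) i

lemma comp_dunklReflect_mem_HP (α : E d) {n : ℕ} {u : E d → ℝ} (hu : u ∈ HP d n) :
    (fun x => u (dunklReflect α x)) ∈ HP d n := by
  refine HP_induction (motive := fun n u => (fun x => u (dunklReflect α x)) ∈ HP d n)
    (fun c => const_mem_HP c) (fun n => zero_mem _) (fun _ _ _ _ _ h h' => add_mem h h')
    (fun n i u _ h => ?_) hu
  rw [add_comm n 1]
  refine mul_mem_HP (u := fun x => dunklReflect α x i) ?_ h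
  convert clm_mem_HP (EuclideanSpace.proj i - (2 / ‖α‖ ^ 2 * α i) • innerSL ℝ α) using 1
  ext x
  simp [dunklReflect]
  ring

instance finiteDimensional_HP (n : ℕ) : FiniteDimensional ℝ (HP d n) := by
  induction n with
  | zero => exact inferInstanceAs (FiniteDimensional ℝ (Submodule.span ℝ {(1 : E d → ℝ)}))
  | succ n ih =>
    exact inferInstanceAs (FiniteDimensional ℝ (⨆ i : Fin d, (HP d n).map
      (LinearMap.mulLeft ℝ (fun x : E d => x i)) : Submodule ℝ (E d → ℝ)))

lemma fderiv_coord_mul {u : E d → ℝ} (hu : Differentiable ℝ u) (i : Fin d) (x a : E d) :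
    fderiv ℝ (fun x : E d => x i * u x) x a = a i * u x + x i * fderiv ℝ u x a := by
  have h1 : HasFDerivAt (fun x : E d => x i) (EuclideanSpace.proj i : E d →L[ℝ] ℝ) x :=
    (EuclideanSpace.proj i : E d →L[ℝ] ℝ).hasFDerivAt
  have h2 : HasFDerivAt (fun x : E d => x i * u x) _ x := h1.mul (hu x).hasFDerivAt
  rw [h2.fderiv]
  simp
  ring

lemma fderiv_mem_HP_aux (a : E d) {n : ℕ} {u : E d → ℝ} (hu : u ∈ HP d n) :
    (n = 0 → (fun x => fderiv ℝ u x a) = 0) ∧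
      ∀ m, n = m + 1 → (fun x => fderiv ℝ u x a) ∈ HP d m := by
  refine HP_induction (motive := fun n u => (n = 0 → (fun x => fderiv ℝ u x a) = 0) ∧
      ∀ m, n = m + 1 → (fun x => fderiv ℝ u x a) ∈ HP d m) (fun c => ?_) (fun n => ?_)
      (fun n u v hu hv h h' => ?_) (fun n i u hu h => ?_) hu
  · refine ⟨fun _ => ?_, fun m hm => by simp at hm⟩
    ext x
    simp
  · have : (fun x => fderiv ℝ (0 : E d → ℝ) x a) = 0 := by ext x; simp
    rw [this]
    exact ⟨fun _ => rfl, fun m _ => zero_mem _⟩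
  · have : (fun x => fderiv ℝ (u + v) x a) =
        (fun x => fderiv ℝ u x a) + fun x => fderiv ℝ v x a := by
      rw [fderiv_add_fun (contDiff_of_mem_HP hu) (contDiff_of_mem_HP hv)]
      rfl
    rw [this]
    exact ⟨fun hn => by rw [h.1 hn, h'.1 hn, add_zero],
      fun m hm => add_mem (h.2 m hm) (h'.2 m hm)⟩
  · refine ⟨fun hn => by simp at hn, fun m hm => ?_⟩
    obtain rfl : n = m := by omega
    simp only [fderiv_coord_mul (differentiable_of_contDiff_two (contDiff_of_mem_HP hu))]
    refine add_mem (Submodule.smul_mem _ (a i) hu) ?_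
    cases n with
    | zero =>
      have : (fun x : E d => x i * fderiv ℝ u x a) = 0 := by
        ext x
        simp [congrFun (h.1 rfl) x]
      rw [this]
      exact zero_mem _
    | succ n => exact coord_mul_mem_HP (h.2 n rfl) i

lemma fderiv_mem_HP (a : E d) {n : ℕ} {u : E d → ℝ} (hu : u ∈ HP d (n + 1)) :
    (fun x => fderiv ℝ u x a) ∈ HP d n := (fderiv_mem_HP_aux a hu).2 n rfl

lemma fderiv_of_mem_HP_zero {u : E d → ℝ} (hu : u ∈ HP d 0) (x : E d) : fderiv ℝ u x = 0 := by
  ext a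
  exact congrFun ((fderiv_mem_HP_aux a hu).1 rfl) x

lemma hess_apply_eq {u : E d → ℝ} (hu : ContDiff ℝ 2 u) (x a b : E d) :
    hess u x a b = fderiv ℝ (fun y => fderiv ℝ u y b) x a := by
  rw [((differentiable_fderiv hu x).hasFDerivAt.clm_apply (hasFDerivAt_const b x)).fderiv]
  simp

/-- Divided differences of homogeneous polynomials are homogeneous polynomials. -/
lemma exists_sub_dunklReflect (α : E d) {n : ℕ} {u : E d → ℝ} (hu : u ∈ HP d n) :
    ∃ b : E d → ℝ, (∀ x, u x - u (dunklReflect α x) = ⟪α, x⟫ * b x) ∧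
      (n = 0 → b = 0) ∧ ∀ m, n = m + 1 → b ∈ HP d m := by
  refine HP_induction (motive := fun n u => ∃ b : E d → ℝ,
    (∀ x, u x - u (dunklReflect α x) = ⟪α, x⟫ * b x) ∧
      (n = 0 → b = 0) ∧ ∀ m, n = m + 1 → b ∈ HP d m) (fun c => ?_) (fun n => ?_)
      (fun n u v hu hv h h' => ?_) (fun n i u hu h => ?_) hu
  · exact ⟨0, by simp, fun _ => rfl, fun m hm => by simp at hm⟩
  · exact ⟨0, by simp, fun _ => rfl, fun m hm => zero_mem _⟩
  · obtain ⟨b, h1, h2, h3⟩ := h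
    obtain ⟨b', h1', h2', h3'⟩ := h'
    refine ⟨b + b', fun x => ?_, fun hn => by rw [h2 hn, h2' hn, add_zero],
      fun m hm => add_mem (h3 m hm) (h3' m hm)⟩
    simp only [Pi.add_apply, mul_add, ← h1, ← h1']
    ring
  · obtain ⟨b, h1, h2, h3⟩ := h
    refine ⟨(fun x => x i * b x) + (2 * α i / ‖α‖ ^ 2) • fun x => u (dunklReflect α x),
      fun x => ?_, fun hn => by simp at hn, fun m hm => ?_⟩
    · have e1 : dunklReflect α x i = x i - 2 * ⟪α, x⟫ / ‖α‖ ^ 2 * α i := by simp [dunklReflect]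
      simp only [Pi.add_apply, Pi.smul_apply, smul_eq_mul]
      rw [e1]
      linear_combination x i * h1 x
    · obtain rfl : n = m := by omega
      refine add_mem ?_ (Submodule.smul_mem _ _ (comp_dunklReflect_mem_HP α hu))
      cases n with
      | zero =>
        rw [h2 rfl]
        convert zero_mem (HP d 0)
        simp
      | succ n => exact coord_mul_mem_HP (h3 n rfl) i

lemma dense_inner_ne_zero {α : E d} (hα : α ≠ 0) : Dense {x : E d | ⟪α, x⟫ ≠ 0} := by
  have h1 : {x : E d | ⟪α, x⟫ ≠ 0} = ((LinearMap.ker (innerSL ℝ α : E d →L[ℝ] ℝ).toLinearMap :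
      Submodule ℝ (E d)) : Set (E d))ᶜ := by
    ext x
    simp
  rw [h1, ← interior_eq_empty_iff_dense_compl]
  by_contra hne
  have := Submodule.eq_top_of_nonempty_interior' _ (Set.nonempty_iff_ne_empty.2 hne)
  have h2 : α ∈ LinearMap.ker (innerSL ℝ α : E d →L[ℝ] ℝ).toLinearMap := by rw [this]; trivial
  simp [hα] at h2

lemma dense_regular {R : Finset (E d)} (hR0 : ∀ α ∈ R, α ≠ 0) :
    Dense {x : E d | ∀ α ∈ R, ⟪α, x⟫ ≠ 0} := by
  have : {x : E d | ∀ α ∈ R, ⟪α, x⟫ ≠ 0} = ⋂ α ∈ (R : Set (E d)), {x : E d | ⟪α, x⟫ ≠ 0} := by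
    ext x
    simp
  rw [this]
  refine dense_biInter_of_isOpen (fun α _ => ?_) R.countable_toSet
    fun α hα => dense_inner_ne_zero (hR0 α hα)
  exact isOpen_ne_fun (by fun_prop) continuous_const

lemma rootOp_coord_mul {α : E d} (hα : α ≠ 0) {u b : E d → ℝ} (hu : ContDiff ℝ 2 u)
    (hb : Continuous b) (h : ∀ x, u x - u (dunklReflect α x) = ⟪α, x⟫ * b x) (i : Fin d) :
    rootOp α (fun x => x i * u x) = fun x => x i * rootOp α u x + α i * b x := by
  have hu' : ContDiff ℝ 2 fun x : E d => x i * u x := ContDiff.mul (by fun_prop) hu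
  have hc := continuous_rootOp α hu
  refine Continuous.ext_on (dense_inner_ne_zero hα) (continuous_rootOp α hu') (by fun_prop) ?_
  intro x hx
  have hx : ⟪α, x⟫ ≠ 0 := hx
  have hn : ‖α‖ ≠ 0 := norm_ne_zero_iff.2 hα
  have s1 := rootOp_spec hα hu x
  have s2 := rootOp_spec hα hu' x
  have e1 : dunklReflect α x i = x i - 2 * ⟪α, x⟫ / ‖α‖ ^ 2 * α i := by simp [dunklReflect]
  rw [fderiv_coord_mul (differentiable_of_contDiff_two hu), e1] at s2
  refine mul_left_cancel₀ (pow_ne_zero 2 hx) ?_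
  rw [← s2]
  have h2 : ‖α‖ ^ 2 / 2 * (2 * ⟪α, x⟫ / ‖α‖ ^ 2 * α i) = ⟪α, x⟫ * α i := by field_simp
  linear_combination x i * s1 + ⟪α, x⟫ * α i * h x - u (dunklReflect α x) * h2

lemma rootOp_mem_HP_aux {α : E d} (hα : α ≠ 0) {n : ℕ} {u : E d → ℝ} (hu : u ∈ HP d n) :
    (n < 2 → rootOp α u = 0) ∧ ∀ m, n = m + 2 → rootOp α u ∈ HP d m := by
  have hzero : rootOp α (0 : E d → ℝ) = 0 := by
    have : fderiv ℝ (0 : E d → ℝ) = 0 := by ext; simp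
    ext x
    simp [rootOp, hess, this]
  refine HP_induction (motive := fun n u => (n < 2 → rootOp α u = 0) ∧
    ∀ m, n = m + 2 → rootOp α u ∈ HP d m) (fun c => ?_) (fun n => ?_)
      (fun n u v hu hv h h' => ?_) (fun n i u hu h => ?_) hu
  · refine ⟨fun _ => ?_, fun m hm => by simp at hm⟩
    have : fderiv ℝ (fun _ : E d => c) = 0 := by ext; simp
    ext x
    simp [rootOp, hess, this]
  · rw [hzero]
    exact ⟨fun _ => rfl, fun m _ => zero_mem _⟩
  · have : rootOp α (u + v) = rootOp α u + rootOp α v := by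
      have hu2 := contDiff_of_mem_HP (m := 2) hu
      have hv2 := contDiff_of_mem_HP (m := 2) hv
      have huv : ContDiff ℝ 2 (u + v) := hu2.add hv2
      have hc1 := continuous_rootOp α hu2
      have hc2 := continuous_rootOp α hv2
      refine Continuous.ext_on (dense_inner_ne_zero hα) (continuous_rootOp α huv)
        (hc1.add hc2) ?_
      intro x hx
      have hx : ⟪α, x⟫ ≠ 0 := hx
      refine mul_left_cancel₀ (pow_ne_zero 2 hx) ?_
      rw [Pi.add_apply, mul_add, ← rootOp_spec hα huv, ← rootOp_spec hα hu2,
        ← rootOp_spec hα hv2, fderiv_add_fun hu2 hv2]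
      simp only [Pi.add_apply, FunLike.coe_add]
      ring
    rw [this]
    exact ⟨fun hn => by rw [h.1 hn, h'.1 hn, add_zero],
      fun m hm => add_mem (h.2 m hm) (h'.2 m hm)⟩
  · obtain ⟨b, h1, h2, h3⟩ := exists_sub_dunklReflect α hu
    have hb : Continuous b := by
      cases n with
      | zero => rw [h2 rfl]; exact continuous_const
      | succ n => exact (contDiff_of_mem_HP (m := 0) (h3 n rfl)).continuous
    rw [rootOp_coord_mul hα (contDiff_of_mem_HP hu) hb h1 i]
    constructor
    · intro hn
      obtain rfl : n = 0 := by omega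
      ext x
      simp [h.1 (by norm_num), h2 rfl]
    · intro m hm
      obtain rfl : n = m + 1 := by omega
      refine add_mem ?_ (Submodule.smul_mem _ (α i) (h3 m rfl))
      cases m with
      | zero =>
        rw [h.1 (by norm_num)]
        convert zero_mem (HP d 0)
        simp
      | succ m => exact coord_mul_mem_HP (h.2 m rfl) i

lemma lap_mem_HP {n : ℕ} {u : E d → ℝ} (hu : u ∈ HP d (n + 2)) : lap u ∈ HP d n := by
  have : lap u = ∑ i : Fin d, fun x => hess u x (EuclideanSpace.single i 1)
      (EuclideanSpace.single i 1) := by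
    ext x
    simp [lap_eq]
  rw [this]
  refine sum_mem fun i _ => ?_
  simp only [hess_apply_eq (contDiff_of_mem_HP (m := 2) hu)]
  exact fderiv_mem_HP _ (fderiv_mem_HP _ hu)

lemma lap_eq_zero_of_mem_HP {n : ℕ} (hn : n < 2) {u : E d → ℝ} (hu : u ∈ HP d n) :
    lap u = 0 := by
  have hz : ∀ x a b, hess u x a b = 0 := by
    intro x a b
    rw [hess_apply_eq (contDiff_of_mem_HP (m := 2) hu)]
    interval_cases n
    · simp [fderiv_of_mem_HP_zero hu]
    · rw [fderiv_of_mem_HP_zero (fderiv_mem_HP b hu)]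
      rfl
  ext x
  simp [lap_eq, hz]

lemma regLap_mem_HP {R : Finset (E d)} (hR0 : ∀ α ∈ R, α ≠ 0) (k : E d → ℝ) {n : ℕ}
    {u : E d → ℝ} (hu : u ∈ HP d (n + 2)) : regLap R k u ∈ HP d n := by
  have : regLap R k u = lap u + ∑ α ∈ R, k α • rootOp α u := by
    ext x
    simp [regLap]
  rw [this]
  exact add_mem (lap_mem_HP hu) (sum_mem fun α hα =>
    Submodule.smul_mem _ _ ((rootOp_mem_HP_aux (hR0 α hα) hu).2 n rfl))

lemma regLap_eq_zero_of_mem_HP {R : Finset (E d)} (hR0 : ∀ α ∈ R, α ≠ 0) (k : E d → ℝ) {n : ℕ}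
    (hn : n < 2) {u : E d → ℝ} (hu : u ∈ HP d n) : regLap R k u = 0 := by
  ext x
  rw [regLap, lap_eq_zero_of_mem_HP hn hu, Finset.sum_eq_zero fun α hα => by
    rw [(rootOp_mem_HP_aux (hR0 α hα) hu).1 hn, Pi.zero_apply, mul_zero]]
  simp

lemma sq_mul_regLap_smul {R : Finset (E d)} (hR0 : ∀ α ∈ R, α ≠ 0) (k : E d → ℝ) {n : ℕ}
    {u : E d → ℝ} (hu : u ∈ HP d n) (t : ℝ) (x : E d) :
    t ^ 2 * regLap R k u (t • x) = t ^ n * regLap R k u x := by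
  rcases lt_or_ge n 2 with hn | hn
  · simp [regLap_eq_zero_of_mem_HP hR0 k hn hu]
  · obtain ⟨m, rfl⟩ := Nat.exists_eq_add_of_le' hn
    rw [map_smul_of_mem_HP (regLap_mem_HP hR0 k hu)]
    ring

/-- The space of polynomial functions of degree at most `N`. -/
def Pol (d N : ℕ) : Submodule ℝ (E d → ℝ) := ⨆ n ∈ Finset.range (N + 1), HP d n

lemma HP_le_Pol {n N : ℕ} (h : n ≤ N) : HP d n ≤ Pol d N :=
  le_biSup (HP d) (Finset.mem_range.2 (Nat.lt_succ_of_le h))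

instance finiteDimensional_Pol (N : ℕ) : FiniteDimensional ℝ (Pol d N) :=
  Module.Finite.iff_fg.2 (Submodule.fg_biSup _ _ fun _ _ => Module.Finite.iff_fg.1 inferInstance)

lemma exists_sum_of_mem_Pol {N : ℕ} {u : E d → ℝ} (hu : u ∈ Pol d N) :
    ∃ f : ℕ → E d → ℝ, (∀ n, f n ∈ HP d n) ∧ u = ∑ n ∈ Finset.range (N + 1), f n := by
  obtain ⟨f, hf⟩ := (Submodule.mem_iSup_finset_iff_exists_sum _ _).1 hu
  exact ⟨fun n => f n, fun n => (f n).2, hf.symm⟩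

lemma contDiff_of_mem_Pol {m : WithTop ℕ∞} {N : ℕ} {u : E d → ℝ} (hu : u ∈ Pol d N) :
    ContDiff ℝ m u := by
  obtain ⟨f, hf, rfl⟩ := exists_sum_of_mem_Pol hu
  have : (∑ n ∈ Finset.range (N + 1), f n) = fun x => ∑ n ∈ Finset.range (N + 1), f n x := by
    ext; simp
  rw [this]
  exact ContDiff.sum fun n _ => contDiff_of_mem_HP (hf n)

lemma coeff_eq_zero_of_small {N : ℕ} {c : ℕ → ℝ} {δ : ℝ} (hδ : 0 < δ)
    (h : ∀ t, 0 < t → t < δ → ∑ n ∈ Finset.range N, t ^ n * c n = 0) {n : ℕ} (hn : n < N) :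
    c n = 0 := by
  set p : Polynomial ℝ := ∑ n ∈ Finset.range N, Polynomial.monomial n (c n) with hp
  have hp0 : p = 0 := by
    refine Polynomial.eq_zero_of_infinite_isRoot p (Set.Infinite.mono ?_ (Set.Ioo_infinite hδ))
    intro t ht
    simp only [Set.mem_ofPred_eq, Polynomial.IsRoot.def, hp, Polynomial.eval_finsetSum,
      Polynomial.eval_monomial]
    rw [← h t ht.1 ht.2]
    exact Finset.sum_congr rfl fun _ _ => mul_comm _ _
  have : p.coeff n = c n := by
    simp [hp, Polynomial.coeff_monomial, hn]
  rw [← this, hp0, Polynomial.coeff_zero]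

/-! ### A Markov type inequality -/

lemma exists_polynomial_line {n : ℕ} {u : E d → ℝ} (hu : u ∈ HP d n) (a v : E d) :
    ∃ P : Polynomial ℝ, P.degree ≤ n ∧ ∀ t : ℝ, u (a + t • v) = P.eval t := by
  refine HP_induction (motive := fun n u => ∃ P : Polynomial ℝ, P.degree ≤ n ∧
    ∀ t : ℝ, u (a + t • v) = P.eval t) (fun c => ?_) (fun n => ⟨0, by simp⟩)
    (fun n u w _ _ h h' => ?_) (fun n i u _ h => ?_) hu
  · exact ⟨Polynomial.C c, by simpa using Polynomial.degree_C_le, by simp⟩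
  · obtain ⟨P, hP, hP'⟩ := h
    obtain ⟨Q, hQ, hQ'⟩ := h'
    exact ⟨P + Q, (Polynomial.degree_add_le _ _).trans (max_le hP hQ), by simp [hP', hQ']⟩
  · obtain ⟨P, hP, hP'⟩ := h
    refine ⟨(Polynomial.C (v i) * Polynomial.X + Polynomial.C (a i)) * P, ?_, fun t => ?_⟩
    · refine (Polynomial.degree_mul_le _ _).trans ?_
      push_cast
      rw [add_comm]
      exact add_le_add hP Polynomial.degree_linear_le
    · simp only [PiLp.add_apply, PiLp.smul_apply, smul_eq_mul, hP', Polynomial.eval_mul,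
        Polynomial.eval_add, Polynomial.eval_C, Polynomial.eval_X]
      ring

lemma abs_eval_derivative_one_le {P : Polynomial ℝ} {n : ℕ} (hP : P.degree ≤ n) {M : ℝ}
    (hM : ∀ x ∈ Set.Icc (-1 : ℝ) 1, |P.eval x| ≤ M) :
    |P.derivative.eval 1| ≤ n ^ 2 * M := by
  have key : ∀ Q : Polynomial ℝ, Q.degree ≤ n → (∀ x ∈ Set.Icc (-1 : ℝ) 1, |Q.eval x| ≤ 1) →
      Q.derivative.eval 1 ≤ n ^ 2 := by
    intro Q hQ hQ'
    have := Polynomial.Chebyshev.eval_iterate_derivative_le_of_forall_abs_le_one (k := 1)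
      le_rfl hQ hQ'
    simpa [Polynomial.Chebyshev.derivative_T_eval_one] using this
  have pos : ∀ K : ℝ, 0 < K → (∀ x ∈ Set.Icc (-1 : ℝ) 1, |P.eval x| ≤ K) →
      |P.derivative.eval 1| ≤ n ^ 2 * K := by
    intro K hK h
    have h1 := key (Polynomial.C K⁻¹ * P) ((Polynomial.degree_C_mul (inv_ne_zero hK.ne')).trans_le
      hP) fun x hx => by
        rw [Polynomial.eval_mul, Polynomial.eval_C, abs_mul, abs_of_pos (inv_pos.2 hK),
          inv_mul_le_iff₀ hK, mul_one]
        exact h x hx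
    have h2 := key (Polynomial.C (-K⁻¹) * P) ((Polynomial.degree_C_mul (neg_ne_zero.2
      (inv_ne_zero hK.ne'))).trans_le hP) fun x hx => by
        rw [Polynomial.eval_mul, Polynomial.eval_C, abs_mul, abs_neg, abs_of_pos (inv_pos.2 hK),
          inv_mul_le_iff₀ hK, mul_one]
        exact h x hx
    simp only [Polynomial.derivative_C_mul, Polynomial.eval_mul, Polynomial.eval_C] at h1 h2
    rw [inv_mul_le_iff₀ hK] at h1
    rw [neg_mul, ← mul_neg, inv_mul_le_iff₀ hK] at h2
    rw [abs_le]
    constructor <;> linarith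
  have hM0 : 0 ≤ M := (abs_nonneg _).trans (hM 0 (by norm_num))
  refine le_of_forall_pos_le_add fun ε hε => ?_
  have h3 := pos (M + ε / (n ^ 2 + 1)) (by positivity) fun x hx =>
    (hM x hx).trans (by linarith [show 0 < ε / ((n : ℝ) ^ 2 + 1) by positivity])
  have h4 : (n : ℝ) ^ 2 * (ε / (n ^ 2 + 1)) ≤ ε := by
    rw [mul_div_assoc', div_le_iff₀ (by positivity)]
    nlinarith
  linarith

lemma abs_fderiv_le_of_mem_HP {n : ℕ} {u : E d → ℝ} (hu : u ∈ HP d n) {ρ M : ℝ}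
    (hM : ∀ x, ‖x‖ ≤ ρ → |u x| ≤ M) {y v : E d} (hyv : ‖y‖ + 2 * ‖v‖ ≤ ρ) :
    |fderiv ℝ u y v| ≤ n ^ 2 * M := by
  obtain ⟨P, hP, hP'⟩ := exists_polynomial_line hu (y - v) v
  have h1 : HasDerivAt (fun t : ℝ => u (y - v + t • v)) (fderiv ℝ u y v) 1 := by
    have hu1 : DifferentiableAt ℝ u (y - v + (1 : ℝ) • v) :=
      differentiable_of_contDiff_two (contDiff_of_mem_HP hu) _
    have h2 : HasDerivAt (fun t : ℝ => y - v + t • v) v 1 := by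
      simpa using ((hasDerivAt_id (1 : ℝ)).smul_const v).const_add (y - v)
    have := hu1.hasFDerivAt.comp_hasDerivAt (1 : ℝ) h2
    rw [one_smul, sub_add_cancel] at this
    exact this
  simp only [hP'] at h1
  rw [h1.unique (P.hasDerivAt 1)]
  refine abs_eval_derivative_one_le hP fun t ht => ?_
  rw [← hP']
  refine hM _ ?_
  calc ‖y - v + t • v‖ = ‖y + (t - 1) • v‖ := by congr 1; module
    _ ≤ ‖y‖ + |t - 1| * ‖v‖ := (norm_add_le _ _).trans_eq (by rw [norm_smul, Real.norm_eq_abs])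
    _ ≤ ‖y‖ + 2 * ‖v‖ := by
      gcongr
      rw [abs_le]
      constructor <;> linarith [ht.1, ht.2]
    _ ≤ ρ := hyv

lemma norm_fderiv_le_of_mem_HP {n : ℕ} {u : E d → ℝ} (hu : u ∈ HP d n) {ρ τ M : ℝ}
    (hM : ∀ x, ‖x‖ ≤ ρ → |u x| ≤ M) (hτ : 0 < τ) {y : E d} (hy : ‖y‖ + 2 * τ ≤ ρ) :
    ‖fderiv ℝ u y‖ ≤ n ^ 2 * M / τ := by
  have hM0 : 0 ≤ M := (abs_nonneg _).trans (hM y (by linarith))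
  refine ContinuousLinearMap.opNorm_le_of_unit_norm (by positivity) fun v hv => ?_
  have := abs_fderiv_le_of_mem_HP hu hM (y := y) (v := τ • v) (by
    rwa [norm_smul, hv, mul_one, Real.norm_eq_abs, abs_of_pos hτ])
  rw [map_smul, smul_eq_mul, abs_mul, abs_of_pos hτ] at this
  rw [Real.norm_eq_abs, le_div_iff₀' hτ]
  exact this

/-! ### Lower bounds for the weight and an `L²`-to-sup estimate -/

lemma exists_pos_forall_le {ι : Type*} (s : Finset ι) (f : ι → ℝ) (hf : ∀ i ∈ s, 0 < f i) :
    ∃ b > 0, ∀ i ∈ s, b ≤ f i := by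
  classical
  induction s using Finset.induction_on with
  | empty => exact ⟨1, one_pos, by simp⟩
  | insert a s ha ih =>
    obtain ⟨b, hb, h⟩ := ih fun i hi => hf i (Finset.mem_insert_of_mem hi)
    refine ⟨min b (f a), lt_min hb (hf a (Finset.mem_insert_self a s)), fun i hi => ?_⟩
    rcases Finset.mem_insert.1 hi with rfl | hi
    · exact min_le_right _ _
    · exact (min_le_left _ _).trans (h i hi)

lemma exists_point_far {R : Finset (E d)} (hR0 : ∀ α ∈ R, α ≠ 0) :
    ∃ c > 0, ∀ (y : E d) (η : ℝ), 0 < η →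
      ∃ p : E d, ‖p - y‖ ≤ η ∧ ∀ α ∈ R, c * η ≤ |⟪p, α⟫| := by
  obtain ⟨v, hv⟩ := (dense_regular hR0).nonempty
  obtain ⟨b, hb, hb'⟩ := exists_pos_forall_le R (fun α => |⟪α, v⟫|) fun α hα =>
    abs_pos.2 (hv α hα)
  set s : ℝ := 1 / ((R.card + 1) * (‖v‖ + 1)) with hs
  have hs0 : 0 < s := by positivity
  refine ⟨s * b / 2, by positivity, fun y η hη => ?_⟩
  by_contra! hcon
  have hbad : ∀ j ∈ Finset.range (R.card + 1), ∃ α ∈ R,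
      |⟪y + (η * s * j) • v, α⟫| < s * b / 2 * η := by
    intro j hj
    refine hcon _ ?_
    have hj' : (j : ℝ) ≤ R.card + 1 := by
      exact_mod_cast (Finset.mem_range.1 hj).le
    rw [add_sub_cancel_left, norm_smul, Real.norm_eq_abs, abs_of_nonneg (by positivity)]
    calc η * s * j * ‖v‖ ≤ η * s * (R.card + 1) * (‖v‖ + 1) := by gcongr; linarith
      _ = η := by rw [hs]; field_simp
  choose! f hf hf' using hbad
  obtain ⟨i, hi, j, hj, hij, hfij⟩ := Finset.exists_ne_map_eq_of_card_lt_of_maps_to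
    (s := Finset.range (R.card + 1)) (t := R) (by simp) (f := f) (fun j hj => hf j hj)
  have h1 := hf' i hi
  have h2 := hf' j hj
  rw [← hfij] at h2
  have h3 := hb' _ (hf i hi)
  rw [real_inner_comm] at h3
  simp only [inner_add_left, real_inner_smul_left] at h1 h2
  have h4 : |η * s * ((i : ℝ) - j) * ⟪v, f i⟫| < s * b * η := by
    have : η * s * ((i : ℝ) - j) * ⟪v, f i⟫ =
      (⟪y, f i⟫ + η * s * i * ⟪v, f i⟫) - (⟪y, f i⟫ + η * s * j * ⟪v, f i⟫) := by ring
    rw [this]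
    refine (abs_sub _ _).trans_lt ?_
    linarith
  have h5 : (1 : ℝ) ≤ |(i : ℝ) - j| := by
    have : (1 : ℤ) ≤ |(i : ℤ) - j| := Int.one_le_abs (by omega)
    exact_mod_cast this
  rw [abs_mul, abs_mul, abs_of_pos (by positivity : 0 < η * s)] at h4
  have : η * s * 1 * b ≤ η * s * |(i : ℝ) - j| * |⟪v, f i⟫| := by gcongr
  linarith

lemma setIntegral_wk_ge {R : Finset (E d)} (hR0 : ∀ α ∈ R, α ≠ 0) {k : E d → ℝ}
    (hk : ∀ α ∈ R, 0 < k α) :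
    ∃ c > 0, ∃ A : ℕ, ∀ (y : E d) (η : ℝ), 0 < η → η ≤ 1 →
      c * η ^ A ≤ ∫ x in Metric.closedBall y η, wk R k x := by
  obtain ⟨c, hc, hp⟩ := exists_point_far hR0
  obtain ⟨a, ha, ha'⟩ := exists_pos_forall_le R (fun α => c / (4 * ‖α‖)) fun α hα => by
    have := norm_pos_iff.2 (hR0 α hα)
    positivity
  set b := min a (1 / 2) with hb
  have hb0 : 0 < b := lt_min ha (by norm_num)
  set V : ℝ := (volume (Metric.ball (0 : E d) 1)).toReal with hV
  have hV0 : 0 < V := ENNReal.toReal_pos (Metric.measure_ball_pos _ _ one_pos).ne'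
    measure_ball_lt_top.ne
  set B : ℝ := ∏ α ∈ R, (c / 4) ^ k α with hB
  have hB0 : 0 < B := Finset.prod_pos fun α _ => by positivity
  obtain ⟨A, hA⟩ := exists_nat_ge (∑ α ∈ R, k α)
  refine ⟨B * (b ^ d * V), by positivity, A + d, fun y η hη hη1 => ?_⟩
  obtain ⟨p, hpy, hpα⟩ := hp y (η / 2) (by positivity)
  have hsub : Metric.closedBall p (b * η) ⊆ Metric.closedBall y η := by
    refine Metric.closedBall_subset_closedBall' ?_
    rw [dist_eq_norm]
    have : b * η ≤ 1 / 2 * η := by gcongr; exact min_le_right _ _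
    linarith
  have hlow : ∀ x ∈ Metric.closedBall p (b * η), B * η ^ A ≤ wk R k x := by
    intro x hx
    have h1 : ∏ α ∈ R, (c / 4 * η) ^ k α ≤ wk R k x := by
      refine Finset.prod_le_prod (fun α _ => by positivity) fun α hα => ?_
      refine Real.rpow_le_rpow (by positivity) ?_ (hk α hα).le
      have hx' : ‖x - p‖ ≤ b * η := by rwa [← dist_eq_norm]
      have hα0 := norm_pos_iff.2 (hR0 α hα)
      have h2 : |⟪x - p, α⟫| ≤ c / 4 * η := by
        refine (abs_real_inner_le_norm _ _).trans ?_
        calc ‖x - p‖ * ‖α‖ ≤ (c / (4 * ‖α‖) * η) * ‖α‖ := by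
              gcongr
              refine hx'.trans ?_
              gcongr
              exact (min_le_left _ _).trans (ha' α hα)
          _ = c / 4 * η := by field_simp
      have h3 := hpα α hα
      have h4 : ⟪p, α⟫ = ⟪x, α⟫ - ⟪x - p, α⟫ := by rw [inner_sub_left]; ring
      have h5 : |⟪p, α⟫| ≤ |⟪x, α⟫| + |⟪x - p, α⟫| := by rw [h4]; exact abs_sub _ _
      linarith
    refine le_trans ?_ h1
    have h6 : ∏ α ∈ R, (c / 4 * η) ^ k α = B * η ^ (∑ α ∈ R, k α) := by
      rw [hB, Real.rpow_sum_of_pos hη, ← Finset.prod_mul_distrib]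
      exact Finset.prod_congr rfl fun α _ => Real.mul_rpow (by positivity) hη.le
    rw [h6]
    gcongr
    rw [← Real.rpow_natCast]
    exact Real.rpow_le_rpow_of_exponent_ge hη hη1 hA
  have hInt : ∀ (z : E d) (t : ℝ), IntegrableOn (wk R k) (Metric.closedBall z t) := fun z t =>
    (continuous_wk hk).continuousOn.integrableOn_compact (isCompact_closedBall z t)
  have hvol : volume.real (Metric.closedBall p (b * η)) = (b * η) ^ d * V := by
    rw [Measure.real, Measure.addHaar_closedBall _ _ (by positivity), ENNReal.toReal_mul,
      ENNReal.toReal_ofReal (by positivity)]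
    simp [hV]
  calc B * (b ^ d * V) * η ^ (A + d) = ∫ _ in Metric.closedBall p (b * η), B * η ^ A := by
        rw [setIntegral_const, hvol, smul_eq_mul]; ring
    _ ≤ ∫ x in Metric.closedBall p (b * η), wk R k x :=
        setIntegral_mono_on (integrableOn_const measure_closedBall_lt_top.ne) (hInt _ _)
          Metric.isClosed_closedBall.measurableSet hlow
    _ ≤ ∫ x in Metric.closedBall y η, wk R k x :=
        setIntegral_mono_set (hInt _ _) (Eventually.of_forall fun x => wk_nonneg _ _ _)
          hsub.eventuallyLE

lemma sq_le_setIntegral_of_mem_HP {R : Finset (E d)} (hR0 : ∀ α ∈ R, α ≠ 0) {k : E d → ℝ}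
    (hk : ∀ α ∈ R, 0 < k α) {ρ : ℝ} (hρ : 0 < ρ) :
    ∃ K : ℝ, 0 < K ∧ ∃ A : ℕ, ∀ (n : ℕ) (u : E d → ℝ), u ∈ HP d n → ∀ x, ‖x‖ ≤ ρ →
      u x ^ 2 ≤ K * (n + 1) ^ A * ∫ x in Metric.closedBall (0 : E d) ρ, u x ^ 2 * wk R k x := by
  obtain ⟨c, hc, A, hW⟩ := setIntegral_wk_ge hR0 hk
  set s : ℝ := ρ / (64 * (1 + ρ)) with hs
  have hs0 : 0 < s := by positivity
  refine ⟨16 / (c * s ^ A), by positivity, 3 * A, fun n u hu x hx => ?_⟩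
  have hcu : Continuous u := (contDiff_of_mem_HP (m := 0) hu).continuous
  obtain ⟨z, hz, hzmax⟩ := (isCompact_closedBall (0 : E d) ρ).exists_isMaxOn
    ⟨0, by simp [hρ.le]⟩ hcu.abs.continuousOn
  rw [mem_closedBall_zero_iff] at hz
  have hM : ∀ x, ‖x‖ ≤ ρ → |u x| ≤ |u z| := fun x hx => hzmax (by simpa using hx)
  set M := |u z| with hMdef
  have hM0 : 0 ≤ M := abs_nonneg _
  set δ : ℝ := 1 / (4 * (n + 1)) with hδ
  have hδ0 : 0 < δ := by positivity
  have hnδ : (n + 1) * δ = 1 / 4 := by rw [hδ]; field_simp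
  have hδ1 : δ ≤ 1 / 4 := by nlinarith [(n.cast_nonneg : (0 : ℝ) ≤ n)]
  set η : ℝ := s / (n + 1) ^ 3 with hη
  have hη0 : 0 < η := by positivity
  have hη' : (n + 1) ^ 2 * η * 16 * (1 + ρ) = δ * ρ := by
    rw [hη, hs, hδ]; field_simp; norm_num
  have hn1 : (1 : ℝ) ≤ (n + 1) ^ 2 := by nlinarith [(n.cast_nonneg : (0 : ℝ) ≤ n)]
  have hηδ : (n + 1) ^ 2 * η * 16 ≤ δ * ρ := by
    rw [← hη']
    nlinarith [show 0 < ((n : ℝ) + 1) ^ 2 * η * 16 by positivity]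
  have hη1 : η ≤ δ * ρ := by nlinarith
  have hη2 : η ≤ 1 := by
    have h1 : s ≤ 1 := by rw [hs, div_le_one (by positivity)]; linarith
    rw [hη, div_le_one (by positivity)]
    nlinarith [(n.cast_nonneg : (0 : ℝ) ≤ n), pow_nonneg (n.cast_nonneg : (0 : ℝ) ≤ n) 3,
      pow_nonneg (n.cast_nonneg : (0 : ℝ) ≤ n) 2]
  have hy0 : M / 2 ≤ |u ((1 - 2 * δ) • z)| := by
    rw [map_smul_of_mem_HP hu, abs_mul, abs_pow, abs_of_nonneg (by linarith : 0 ≤ 1 - 2 * δ)]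
    have h1 := one_add_mul_le_pow (a := -(2 * δ)) (by linarith) n
    have h2 : (1 : ℝ) / 2 ≤ (1 - 2 * δ) ^ n := by
      have : (1 - 2 * δ) = 1 + -(2 * δ) := by ring
      rw [this]
      nlinarith
    calc M / 2 = 1 / 2 * M := by ring
      _ ≤ _ := by gcongr
  have hlow : ∀ y ∈ Metric.closedBall ((1 - 2 * δ) • z) η, M / 4 ≤ |u y| := by
    intro y hy
    have hgrad : ∀ w ∈ Metric.closedBall ((1 - 2 * δ) • z) η,
        ‖fderiv ℝ u w‖ ≤ n ^ 2 * M / (δ * ρ / 2) := by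
      intro w hw
      refine norm_fderiv_le_of_mem_HP hu hM (by positivity) ?_
      have h1 : ‖w - (1 - 2 * δ) • z‖ ≤ η := by rwa [← dist_eq_norm]
      have h2 : ‖w‖ ≤ ‖w - (1 - 2 * δ) • z‖ + ‖(1 - 2 * δ) • z‖ := by
        simpa using norm_add_le (w - (1 - 2 * δ) • z) ((1 - 2 * δ) • z)
      have h3 : ‖(1 - 2 * δ) • z‖ ≤ (1 - 2 * δ) * ρ := by
        rw [norm_smul, Real.norm_eq_abs, abs_of_nonneg (by linarith)]
        gcongr
        linarith
      nlinarith
    have := (convex_closedBall _ _).norm_image_sub_le_of_norm_fderiv_le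
      (fun w _ => differentiable_of_contDiff_two (contDiff_of_mem_HP hu) w) hgrad
      (Metric.mem_closedBall_self hη0.le) hy
    have h1 : ‖y - (1 - 2 * δ) • z‖ ≤ η := by rwa [← dist_eq_norm]
    have h2 : n ^ 2 * M / (δ * ρ / 2) * ‖y - (1 - 2 * δ) • z‖ ≤ M / 8 := by
      calc n ^ 2 * M / (δ * ρ / 2) * ‖y - (1 - 2 * δ) • z‖ ≤
            (n + 1) ^ 2 * M / (δ * ρ / 2) * η := by gcongr; linarith
        _ = ((n + 1) ^ 2 * η * 16) / (δ * ρ) * (M / 8) := by field_simp; ring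
        _ ≤ 1 * (M / 8) := by
          gcongr
          rwa [div_le_one (by positivity)]
        _ = M / 8 := one_mul _
    rw [Real.norm_eq_abs] at this
    have h3 := abs_sub_abs_le_abs_sub (u ((1 - 2 * δ) • z)) (u y)
    rw [abs_sub_comm] at h3
    linarith
  have hsub : Metric.closedBall ((1 - 2 * δ) • z) η ⊆ Metric.closedBall (0 : E d) ρ := by
    refine Metric.closedBall_subset_closedBall' ?_
    rw [dist_zero_right, norm_smul, Real.norm_eq_abs, abs_of_nonneg (by linarith)]
    nlinarith
  have hcw := continuous_wk hk
  have hInt : ∀ (z : E d) (t : ℝ), IntegrableOn (fun x => u x ^ 2 * wk R k x)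
      (Metric.closedBall z t) := fun z t =>
    (Continuous.continuousOn (by fun_prop)).integrableOn_compact (isCompact_closedBall z t)
  have hmain : (M / 4) ^ 2 * (c * η ^ A) ≤
      ∫ x in Metric.closedBall (0 : E d) ρ, u x ^ 2 * wk R k x := by
    calc (M / 4) ^ 2 * (c * η ^ A) ≤
          (M / 4) ^ 2 * ∫ x in Metric.closedBall ((1 - 2 * δ) • z) η, wk R k x := by
          gcongr
          exact hW _ _ hη0 hη2
      _ = ∫ x in Metric.closedBall ((1 - 2 * δ) • z) η, (M / 4) ^ 2 * wk R k x :=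
          (integral_const_mul _ _).symm
      _ ≤ ∫ x in Metric.closedBall ((1 - 2 * δ) • z) η, u x ^ 2 * wk R k x := by
          refine setIntegral_mono_on ?_ (hInt _ _) Metric.isClosed_closedBall.measurableSet ?_
          · exact (Continuous.continuousOn (by fun_prop)).integrableOn_compact
              (isCompact_closedBall _ _)
          · intro y hy
            refine mul_le_mul_of_nonneg_right ?_ (wk_nonneg _ _ _)
            rw [← sq_abs (u y)]
            exact pow_le_pow_left₀ (by positivity) (hlow y hy) 2
      _ ≤ _ := setIntegral_mono_set (hInt _ _) (Eventually.of_forall fun x =>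
          mul_nonneg (sq_nonneg _) (wk_nonneg _ _ _)) hsub.eventuallyLE
  calc u x ^ 2 ≤ M ^ 2 := by
        rw [← sq_abs]
        exact pow_le_pow_left₀ (abs_nonneg _) (hM x hx) 2
    _ = 16 / (c * s ^ A) * (n + 1) ^ (3 * A) * ((M / 4) ^ 2 * (c * η ^ A)) := by
        rw [hη, div_pow s, ← pow_mul]; field_simp; norm_num
    _ ≤ _ := by gcongr

/-! ### Products with radial functions -/

lemma fderiv_self_of_mem_HP {n : ℕ} {u : E d → ℝ} (hu : u ∈ HP d n) (x : E d) :
    fderiv ℝ u x x = n * u x := by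
  have h1 : HasDerivAt (fun t : ℝ => u (t • x)) (fderiv ℝ u x x) 1 := by
    have hu1 : DifferentiableAt ℝ u ((1 : ℝ) • x) :=
      differentiable_of_contDiff_two (contDiff_of_mem_HP hu) _
    have h2 : HasDerivAt (fun t : ℝ => t • x) x 1 := by
      simpa using (hasDerivAt_id (1 : ℝ)).smul_const x
    have := hu1.hasFDerivAt.comp_hasDerivAt (1 : ℝ) h2
    rw [one_smul] at this
    exact this
  simp only [map_smul_of_mem_HP hu] at h1
  have h2 := (hasDerivAt_pow n (1 : ℝ)).mul_const (u x)
  rw [h1.unique h2]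
  simp

lemma hasFDerivAt_comp_norm_sq {Φ : ℝ → ℝ} (hΦ : Differentiable ℝ Φ) (x : E d) :
    HasFDerivAt (fun y : E d => Φ (‖y‖ ^ 2)) ((2 * deriv Φ (‖x‖ ^ 2)) • innerSL ℝ x) x := by
  have := (hΦ (‖x‖ ^ 2)).hasDerivAt.comp_hasFDerivAt x
    (hasStrictFDerivAt_norm_sq x).hasFDerivAt
  refine HasFDerivAt.congr_fderiv this ?_
  ext v
  simp
  ring

lemma contDiff_comp_norm_sq {n : WithTop ℕ∞} {Φ : ℝ → ℝ} (hΦ : ContDiff ℝ n Φ) :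
    ContDiff ℝ n fun y : E d => Φ (‖y‖ ^ 2) :=
  hΦ.comp (contDiff_norm_sq ℝ)

lemma fderiv_mul_comp_norm_sq {s : E d → ℝ} {Φ : ℝ → ℝ} (hs : Differentiable ℝ s)
    (hΦ : Differentiable ℝ Φ) (x a : E d) :
    fderiv ℝ (fun y => s y * Φ (‖y‖ ^ 2)) x a =
      Φ (‖x‖ ^ 2) * fderiv ℝ s x a + s x * (2 * deriv Φ (‖x‖ ^ 2) * ⟪x, a⟫) := by
  have h : HasFDerivAt (fun y => s y * Φ (‖y‖ ^ 2)) _ x :=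
    (hs x).hasFDerivAt.mul (hasFDerivAt_comp_norm_sq hΦ x)
  rw [h.fderiv]
  simp
  ring

lemma hess_mul_comp_norm_sq {s : E d → ℝ} {Φ : ℝ → ℝ} (hs : ContDiff ℝ 2 s)
    (hΦ : ContDiff ℝ 2 Φ) (x a : E d) :
    hess (fun y => s y * Φ (‖y‖ ^ 2)) x a a = Φ (‖x‖ ^ 2) * hess s x a a +
      4 * deriv Φ (‖x‖ ^ 2) * (⟪x, a⟫ * fderiv ℝ s x a) +
      s x * (4 * deriv (deriv Φ) (‖x‖ ^ 2) * ⟪x, a⟫ ^ 2 + 2 * deriv Φ (‖x‖ ^ 2) * ‖a‖ ^ 2) := by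
  have hs1 := differentiable_of_contDiff_two hs
  have hΦ1 : Differentiable ℝ Φ := hΦ.differentiable (by norm_num)
  have hΦ2 : Differentiable ℝ (deriv Φ) :=
    ((contDiff_succ_iff_deriv (n := 1)).1 hΦ).2.2.differentiable (by norm_num)
  rw [hess_apply_eq (hs.mul (contDiff_comp_norm_sq hΦ)), hess_apply_eq hs]
  simp only [fderiv_mul_comp_norm_sq hs1 hΦ1]
  have e1 := hasFDerivAt_comp_norm_sq hΦ1 x
  have e2 := hasFDerivAt_comp_norm_sq hΦ2 x
  have e3 : HasFDerivAt (fun y => fderiv ℝ s y a) (fderiv ℝ (fun y => fderiv ℝ s y a) x) x :=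
    ((differentiable_fderiv hs x).clm_apply (differentiableAt_const a)).hasFDerivAt
  have e4 : HasFDerivAt (fun y : E d => ⟪y, a⟫) (innerSL ℝ a) x := by
    convert (innerSL ℝ a : E d →L[ℝ] ℝ).hasFDerivAt using 1
    ext y
    simp [real_inner_comm]
  have e5 : HasFDerivAt (fun y => Φ (‖y‖ ^ 2) * fderiv ℝ s y a +
      s y * (2 * deriv Φ (‖y‖ ^ 2) * ⟪y, a⟫)) _ x :=
    (e1.mul e3).add ((hs1 x).hasFDerivAt.mul ((e2.const_mul 2).mul e4))
  rw [e5.fderiv]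
  simp
  ring

lemma rootOp_mul_comp_norm_sq {α : E d} (hα : α ≠ 0) {s : E d → ℝ} {Φ : ℝ → ℝ}
    (hs : ContDiff ℝ 2 s) (hΦ : ContDiff ℝ 2 Φ) (x : E d) :
    rootOp α (fun y => s y * Φ (‖y‖ ^ 2)) x =
      Φ (‖x‖ ^ 2) * rootOp α s x + s x * (2 * deriv Φ (‖x‖ ^ 2)) := by
  have hsΦ := hs.mul (contDiff_comp_norm_sq (d := d) hΦ)
  have hc := continuous_rootOp α hs
  have hc' := hs.continuous
  have hc'' := hΦ.continuous
  have hΦ2 : Continuous (deriv Φ) := hΦ.continuous_deriv (by norm_num)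
  have hr : Continuous fun y => Φ (‖y‖ ^ 2) * rootOp α s y + s y * (2 * deriv Φ (‖y‖ ^ 2)) := by
    fun_prop
  refine congrFun (Continuous.ext_on (dense_inner_ne_zero hα) (continuous_rootOp α hsΦ)
    hr fun y hy => ?_) x
  have hy : ⟪α, y⟫ ≠ 0 := hy
  refine mul_left_cancel₀ (pow_ne_zero 2 hy) ?_
  have s1 := rootOp_spec hα hs y
  rw [← rootOp_spec hα hsΦ, fderiv_mul_comp_norm_sq (differentiable_of_contDiff_two hs)
    (hΦ.differentiable (by norm_num)), norm_dunklReflect, real_inner_comm α y]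
  linear_combination Φ (‖y‖ ^ 2) * s1

lemma regLap_mul_comp_norm_sq {R : Finset (E d)} (hR0 : ∀ α ∈ R, α ≠ 0) (k : E d → ℝ)
    {s : E d → ℝ} {Φ : ℝ → ℝ} (hs : ContDiff ℝ 2 s) (hΦ : ContDiff ℝ 2 Φ) (x : E d) :
    regLap R k (fun y => s y * Φ (‖y‖ ^ 2)) x = Φ (‖x‖ ^ 2) * regLap R k s x +
      4 * deriv Φ (‖x‖ ^ 2) * fderiv ℝ s x x + s x * (4 * ‖x‖ ^ 2 * deriv (deriv Φ) (‖x‖ ^ 2) +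
        2 * (d + ∑ α ∈ R, k α) * deriv Φ (‖x‖ ^ 2)) := by
  have h1 : lap (fun y => s y * Φ (‖y‖ ^ 2)) x = Φ (‖x‖ ^ 2) * lap s x +
      4 * deriv Φ (‖x‖ ^ 2) * fderiv ℝ s x x + s x * (4 * ‖x‖ ^ 2 * deriv (deriv Φ) (‖x‖ ^ 2) +
        2 * d * deriv Φ (‖x‖ ^ 2)) := by
    simp only [lap_eq, hess_mul_comp_norm_sq hs hΦ, Finset.sum_add_distrib, ← Finset.mul_sum]
    have e1 : ∑ i, ⟪x, EuclideanSpace.single i (1 : ℝ)⟫ *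
        fderiv ℝ s x (EuclideanSpace.single i 1) = fderiv ℝ s x x := by
      conv_rhs => arg 2; rw [← sum_coord_smul x]
      simp only [map_sum, map_smul, smul_eq_mul]
      exact Finset.sum_congr rfl fun i _ => by simp [EuclideanSpace.inner_single_right]
    have e2 : ∑ i, ⟪x, EuclideanSpace.single i (1 : ℝ)⟫ ^ 2 = ‖x‖ ^ 2 := by
      rw [EuclideanSpace.norm_sq_eq]
      exact Finset.sum_congr rfl fun i _ => by simp [EuclideanSpace.inner_single_right]
    rw [e1, e2]
    simp only [PiLp.norm_single, norm_one, one_pow, mul_one, Finset.sum_const,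
      Finset.card_univ, Fintype.card_fin, nsmul_eq_mul]
    ring
  have h2 : ∑ α ∈ R, k α * rootOp α (fun y => s y * Φ (‖y‖ ^ 2)) x =
      Φ (‖x‖ ^ 2) * ∑ α ∈ R, k α * rootOp α s x +
        s x * (2 * deriv Φ (‖x‖ ^ 2)) * ∑ α ∈ R, k α := by
    rw [Finset.mul_sum, Finset.mul_sum, ← Finset.sum_add_distrib]
    refine Finset.sum_congr rfl fun α hα => ?_
    rw [rootOp_mul_comp_norm_sq (hR0 α hα) hs hΦ]
    ring
  rw [regLap, regLap, h1, h2]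
  ring

/-! ### A smooth approximation of the positive part -/

/-- The derivative of `ramp ε`. -/
def slope (ε t : ℝ) : ℝ := smoothTransition (t / ε - 1)

/-- A smooth convex function vanishing on `(-∞, ε]` and with slope one on `[2ε, ∞)`. -/
def ramp (ε t : ℝ) : ℝ := ∫ τ in (0 : ℝ)..t, slope ε τ

lemma contDiff_slope (ε : ℝ) {n : ℕ∞} : ContDiff ℝ n (slope ε) := by
  unfold slope
  exact smoothTransition.contDiff.comp (by fun_prop)

lemma slope_nonneg (ε t : ℝ) : 0 ≤ slope ε t := smoothTransition.nonneg _

lemma slope_le_one (ε t : ℝ) : slope ε t ≤ 1 := smoothTransition.le_one _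

lemma slope_eq_zero {ε t : ℝ} (hε : 0 < ε) (ht : t ≤ ε) : slope ε t = 0 :=
  smoothTransition.zero_of_nonpos (by rw [sub_nonpos, div_le_one hε]; exact ht)

lemma slope_eq_one {ε t : ℝ} (hε : 0 < ε) (ht : 2 * ε ≤ t) : slope ε t = 1 :=
  smoothTransition.one_of_one_le (by
    rw [le_sub_iff_add_le, le_div_iff₀ hε]; linarith)

lemma hasDerivAt_ramp (ε t : ℝ) : HasDerivAt (ramp ε) (slope ε t) t :=
  intervalIntegral.integral_hasDerivAt_right
    ((contDiff_slope ε (n := 0)).continuous.intervalIntegrable _ _)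
    (contDiff_slope ε (n := 0)).continuous.aestronglyMeasurable.stronglyMeasurableAtFilter
    (contDiff_slope ε (n := 0)).continuous.continuousAt

lemma deriv_ramp (ε : ℝ) : deriv (ramp ε) = slope ε := funext fun t => (hasDerivAt_ramp ε t).deriv

lemma contDiff_ramp (ε : ℝ) : ContDiff ℝ 2 (ramp ε) := by
  rw [show (2 : WithTop ℕ∞) = 1 + 1 from by norm_num, contDiff_succ_iff_deriv, deriv_ramp]
  exact ⟨fun t => (hasDerivAt_ramp ε t).differentiableAt, by simp, contDiff_slope ε⟩

lemma ramp_eq_zero {ε t : ℝ} (hε : 0 < ε) (ht : t ≤ ε) : ramp ε t = 0 := by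
  refine intervalIntegral.integral_zero_ae (ae_of_all _ fun τ hτ => slope_eq_zero hε ?_)
  rcases Set.mem_uIoc.1 hτ with h | h <;> linarith [h.2]

lemma abs_ramp_sub_le {ε t : ℝ} (hε : 0 < ε) (ht : 0 ≤ t) : |ramp ε t - t| ≤ 2 * ε := by
  have hF : ∀ s, HasDerivAt (fun s => s - ramp ε s) (1 - slope ε s) s := fun s =>
    (hasDerivAt_id s).sub (hasDerivAt_ramp ε s)
  have hmono : Monotone fun s => s - ramp ε s :=
    monotone_of_deriv_nonneg (fun s => (hF s).differentiableAt) fun s => by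
      rw [(hF s).deriv]
      linarith [slope_le_one ε s]
  have h0 : ramp ε 0 = 0 := ramp_eq_zero hε hε.le
  have h1 : 0 ≤ t - ramp ε t := by simpa [h0] using hmono ht
  have hnn : Monotone (ramp ε) :=
    monotone_of_deriv_nonneg (fun s => (hasDerivAt_ramp ε s).differentiableAt) fun s => by
      rw [deriv_ramp]
      exact slope_nonneg ε s
  have h2 : 2 * ε - ramp ε (2 * ε) ≤ 2 * ε := by
    have := hnn (show 0 ≤ 2 * ε by positivity)
    linarith
  have h3 : t - ramp ε t ≤ 2 * ε - ramp ε (2 * ε) := by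
    rcases le_total t (2 * ε) with h | h
    · exact hmono h
    · refine antitoneOn_of_deriv_nonpos (f := fun s => s - ramp ε s) (convex_Ici (2 * ε))
        (fun s _ => (hF s).continuousAt.continuousWithinAt)
        (fun s _ => (hF s).differentiableAt.differentiableWithinAt) (fun s hs => ?_)
        Set.self_mem_Ici h h
      rw [interior_Ici] at hs
      rw [(hF s).deriv, slope_eq_one hε (le_of_lt hs), sub_self]
  rw [abs_sub_comm, abs_of_nonneg h1]
  linarith

lemma deriv_slope_nonneg {ε : ℝ} (hε : 0 < ε) (t : ℝ) : 0 ≤ deriv (slope ε) t := by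
  refine Monotone.deriv_nonneg fun a b hab => smoothTransition.monotone ?_
  gcongr

lemma deriv_slope_eq_zero_of_lt {ε t : ℝ} (hε : 0 < ε) (ht : t < ε) : deriv (slope ε) t = 0 := by
  have : slope ε =ᶠ[𝓝 t] fun _ => 0 := by
    filter_upwards [Iio_mem_nhds ht] with s hs using slope_eq_zero hε hs.le
  rw [this.deriv_eq, deriv_const]

lemma deriv_slope_eq_zero_of_gt {ε t : ℝ} (hε : 0 < ε) (ht : 2 * ε < t) :
    deriv (slope ε) t = 0 := by
  have : slope ε =ᶠ[𝓝 t] fun _ => 1 := by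
    filter_upwards [Ioi_mem_nhds ht] with s hs using slope_eq_one hε hs.le
  rw [this.deriv_eq, deriv_const]

/-! ### Orthogonality and interior estimates for harmonic polynomials -/

/-- The standing assumptions on the root system and the multiplicity function. -/
structure IsRootData (R : Finset (E d)) (k : E d → ℝ) : Prop where
  ne_zero : ∀ α ∈ R, α ≠ 0
  refl : ∀ α ∈ R, ∀ β ∈ R, dunklReflect α β ∈ R
  pos : ∀ α ∈ R, 0 < k α
  inv : ∀ α ∈ R, ∀ β ∈ R, k (dunklReflect α β) = k β

lemma integrable_of_eq_zero {f : E d → ℝ} (hf : Continuous f) {ρ : ℝ}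
    (h : ∀ x, ρ < ‖x‖ → f x = 0) : Integrable f :=
  hf.integrable_of_hasCompactSupport <| HasCompactSupport.intro
    (isCompact_closedBall (0 : E d) ρ) fun x hx => h x (by simpa using hx)

/-- A radial cutoff profile approximating `ρ ^ 2 - s`. -/
def cut (ε ρ s : ℝ) : ℝ := ramp ε (ρ ^ 2 - s)

lemma contDiff_cut (ε ρ : ℝ) : ContDiff ℝ 2 (cut ε ρ) :=
  (contDiff_ramp ε).comp (by fun_prop)

lemma deriv_cut (ε ρ : ℝ) : deriv (cut ε ρ) = fun s => -slope ε (ρ ^ 2 - s) := by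
  funext s
  have h : HasDerivAt (cut ε ρ) _ s :=
    (hasDerivAt_ramp ε (ρ ^ 2 - s)).comp s ((hasDerivAt_id s).const_sub (ρ ^ 2))
  rw [h.deriv, mul_neg_one]

lemma deriv_deriv_cut (ε ρ : ℝ) :
    deriv (deriv (cut ε ρ)) = fun s => deriv (slope ε) (ρ ^ 2 - s) := by
  funext s
  rw [deriv_cut]
  have h := ((contDiff_slope ε (n := 1)).differentiable (by norm_num) (ρ ^ 2 - s)).hasDerivAt
  have h' : HasDerivAt (fun s => -slope ε (ρ ^ 2 - s)) _ s :=
    (h.comp s ((hasDerivAt_id s).const_sub (ρ ^ 2))).neg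
  rw [h'.deriv, mul_neg_one, neg_neg]

lemma continuous_deriv_slope (ε : ℝ) : Continuous (deriv (slope ε)) :=
  (contDiff_slope ε (n := 1)).continuous_deriv (by norm_num)

lemma cut_eq_zero {ε ρ : ℝ} (hε : 0 < ε) {x : E d} (hx : ρ ^ 2 - ε ≤ ‖x‖ ^ 2) :
    cut ε ρ (‖x‖ ^ 2) = 0 := ramp_eq_zero hε (by linarith)

lemma tsupport_mul_cut_subset {ε ρ : ℝ} (hε : 0 < ε) (s : E d → ℝ) :
    tsupport (fun x => s x * cut ε ρ (‖x‖ ^ 2)) ⊆ {x : E d | ‖x‖ ^ 2 ≤ ρ ^ 2 - ε} := by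
  refine closure_minimal (fun x hx => ?_) (isClosed_le (by fun_prop) continuous_const)
  by_contra hcon
  have hcon : ρ ^ 2 - ε < ‖x‖ ^ 2 := not_le.1 hcon
  exact hx (by simp [cut_eq_zero hε hcon.le])

lemma tsupport_mul_cut_subset_ball {ε ρ : ℝ} (hε : 0 < ε) (hρ : 0 ≤ ρ) (s : E d → ℝ) :
    tsupport (fun x => s x * cut ε ρ (‖x‖ ^ 2)) ⊆ Metric.ball 0 ρ := by
  intro x hx
  have h1 : ‖x‖ ^ 2 ≤ ρ ^ 2 - ε := tsupport_mul_cut_subset hε s hx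
  rw [mem_ball_zero_iff]
  exact lt_of_pow_lt_pow_left₀ 2 hρ (by linarith)

lemma hasCompactSupport_mul_cut {ε ρ : ℝ} (hε : 0 < ε) (hρ : 0 ≤ ρ) (s : E d → ℝ) :
    HasCompactSupport fun x => s x * cut ε ρ (‖x‖ ^ 2) :=
  (isCompact_closedBall (0 : E d) ρ).of_isClosed_subset (isClosed_tsupport _)
    ((tsupport_mul_cut_subset_ball hε hρ s).trans Metric.ball_subset_closedBall)

lemma regLap_mul_cut {R : Finset (E d)} {k : E d → ℝ} (H : IsRootData R k) {s : E d → ℝ}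
    (hs : ContDiff ℝ 2 s) (ε ρ : ℝ) (x : E d) :
    regLap R k (fun y => s y * cut ε ρ (‖y‖ ^ 2)) x = cut ε ρ (‖x‖ ^ 2) * regLap R k s x -
      4 * slope ε (ρ ^ 2 - ‖x‖ ^ 2) * fderiv ℝ s x x +
      s x * (4 * ‖x‖ ^ 2 * deriv (slope ε) (ρ ^ 2 - ‖x‖ ^ 2) -
        2 * (d + ∑ α ∈ R, k α) * slope ε (ρ ^ 2 - ‖x‖ ^ 2)) := by
  rw [regLap_mul_comp_norm_sq H.ne_zero k hs (contDiff_cut ε ρ), deriv_deriv_cut, deriv_cut]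
  ring

lemma slope_eq_zero_of_lt_norm {ε ρ : ℝ} (hε : 0 < ε) (hρ : 0 ≤ ρ) {x : E d} (hx : ρ < ‖x‖) :
    slope ε (ρ ^ 2 - ‖x‖ ^ 2) = 0 :=
  slope_eq_zero hε (by nlinarith)

lemma deriv_slope_eq_zero_of_lt_norm {ε ρ : ℝ} (hε : 0 < ε) (hρ : 0 ≤ ρ) {x : E d}
    (hx : ρ < ‖x‖) : deriv (slope ε) (ρ ^ 2 - ‖x‖ ^ 2) = 0 :=
  deriv_slope_eq_zero_of_lt hε (by nlinarith)

lemma continuous_slope_norm (ε ρ : ℝ) : Continuous fun x : E d => slope ε (ρ ^ 2 - ‖x‖ ^ 2) :=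
  (contDiff_slope ε (n := 0)).continuous.comp (by fun_prop)

lemma continuous_deriv_slope_norm (ε ρ : ℝ) :
    Continuous fun x : E d => deriv (slope ε) (ρ ^ 2 - ‖x‖ ^ 2) :=
  (continuous_deriv_slope ε).comp (by fun_prop)

lemma integral_mul_eq_zero_of_ne {R : Finset (E d)} {k : E d → ℝ} (H : IsRootData R k)
    {n m : ℕ} (hnm : n ≠ m) {u v : E d → ℝ} (hu : u ∈ HP d n) (hv : v ∈ HP d m)
    (hu0 : regLap R k u = 0) (hv0 : regLap R k v = 0) {ε ρ : ℝ} (hε : 0 < ε) (hρ : 0 ≤ ρ) :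
    ∫ x, u x * v x * (slope ε (ρ ^ 2 - ‖x‖ ^ 2) * wk R k x) = 0 := by
  have hcu := contDiff_of_mem_HP (m := 2) hu
  have hcv := contDiff_of_mem_HP (m := 2) hv
  have hw := continuous_wk H.pos
  have hsl := continuous_slope_norm (d := d) ε ρ
  have hdsl := continuous_deriv_slope_norm (d := d) ε ρ
  have hu' := hcu.continuous
  have hv' := hcv.continuous
  have key : ∀ {a b : ℕ} {p q : E d → ℝ}, p ∈ HP d a → q ∈ HP d b → regLap R k p = 0 →
      regLap R k q = 0 → ∫ x, p x * (-(4 * slope ε (ρ ^ 2 - ‖x‖ ^ 2) * (b * q x)) +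
      q x * (4 * ‖x‖ ^ 2 * deriv (slope ε) (ρ ^ 2 - ‖x‖ ^ 2) -
        2 * (d + ∑ α ∈ R, k α) * slope ε (ρ ^ 2 - ‖x‖ ^ 2))) * wk R k x = 0 := by
    intro a b p q hp hq hp0 hq0
    have hcp := contDiff_of_mem_HP (m := 2) hp
    have hcq := contDiff_of_mem_HP (m := 2) hq
    have := integral_regLap_symm H.ne_zero H.refl H.pos H.inv hcp
      (hcq.mul (contDiff_comp_norm_sq (contDiff_cut ε ρ))) (hasCompactSupport_mul_cut hε hρ q)
    simpa [regLap_mul_cut H hcq, hp0, hq0, fderiv_self_of_mem_HP hq] using this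
  have k1 := key hu hv hu0 hv0
  have k2 := key hv hu hv0 hu0
  have hInt := integral_sub (μ := volume)
    (integrable_of_eq_zero (ρ := ρ) (f := fun x => u x * (-(4 * slope ε (ρ ^ 2 - ‖x‖ ^ 2) *
      (m * v x)) + v x * (4 * ‖x‖ ^ 2 * deriv (slope ε) (ρ ^ 2 - ‖x‖ ^ 2) -
        2 * (d + ∑ α ∈ R, k α) * slope ε (ρ ^ 2 - ‖x‖ ^ 2))) * wk R k x) (by fun_prop)
      fun x hx => by
        simp [slope_eq_zero_of_lt_norm hε hρ hx, deriv_slope_eq_zero_of_lt_norm hε hρ hx])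
    (integrable_of_eq_zero (ρ := ρ) (f := fun x => v x * (-(4 * slope ε (ρ ^ 2 - ‖x‖ ^ 2) *
      (n * u x)) + u x * (4 * ‖x‖ ^ 2 * deriv (slope ε) (ρ ^ 2 - ‖x‖ ^ 2) -
        2 * (d + ∑ α ∈ R, k α) * slope ε (ρ ^ 2 - ‖x‖ ^ 2))) * wk R k x) (by fun_prop)
      fun x hx => by
        simp [slope_eq_zero_of_lt_norm hε hρ hx, deriv_slope_eq_zero_of_lt_norm hε hρ hx])
  rw [k1, k2, sub_zero] at hInt
  have hc : (4 * ((n : ℝ) - m)) ≠ 0 :=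
    mul_ne_zero (by norm_num) (sub_ne_zero.2 (by exact_mod_cast hnm))
  refine mul_left_cancel₀ hc ?_
  rw [mul_zero, ← hInt, ← integral_const_mul]
  congr 1
  ext x
  ring

lemma regLap_component_eq_zero {R : Finset (E d)} {k : E d → ℝ} (H : IsRootData R k) {N : ℕ}
    {f : ℕ → E d → ℝ} (hf : ∀ n, f n ∈ HP d n)
    (h : regLap R k (∑ n ∈ Finset.range (N + 1), f n) = 0) {n : ℕ} (hn : n < N + 1) :
    regLap R k (f n) = 0 := by
  rw [regLap_sum R k _ fun n => contDiff_of_mem_HP (hf n)] at h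
  ext x
  refine coeff_eq_zero_of_small (N := N + 1) (c := fun n => regLap R k (f n) x) one_pos
    (fun t _ _ => ?_) hn
  have := congrFun h (t • x)
  rw [Finset.sum_apply, Pi.zero_apply] at this
  simp_rw [← sq_mul_regLap_smul H.ne_zero k (hf _) t x]
  rw [← Finset.mul_sum, this, mul_zero]

lemma integral_component_sq_le {R : Finset (E d)} {k : E d → ℝ} (H : IsRootData R k) {N : ℕ}
    {f : ℕ → E d → ℝ} (hf : ∀ n, f n ∈ HP d n)
    (h : regLap R k (∑ n ∈ Finset.range (N + 1), f n) = 0) {n : ℕ} (hn : n < N + 1)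
    {ε ρ : ℝ} (hε : 0 < ε) (hρ : 0 ≤ ρ) :
    ∫ x, f n x ^ 2 * (slope ε (ρ ^ 2 - ‖x‖ ^ 2) * wk R k x) ≤
      ∫ x, (∑ n ∈ Finset.range (N + 1), f n x) ^ 2 *
        (slope ε (ρ ^ 2 - ‖x‖ ^ 2) * wk R k x) := by
  have hw := continuous_wk H.pos
  have hsl := continuous_slope_norm (d := d) ε ρ
  have hfc : ∀ n, Continuous (f n) := fun n => (contDiff_of_mem_HP (m := 0) (hf n)).continuous
  have hInt : ∀ i j, Integrable fun x =>
      f i x * f j x * (slope ε (ρ ^ 2 - ‖x‖ ^ 2) * wk R k x) := fun i j =>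
    integrable_of_eq_zero (ρ := ρ) (((hfc i).mul (hfc j)).mul (hsl.mul hw)) fun x hx => by
      simp [slope_eq_zero_of_lt_norm hε hρ hx]
  have e : ∀ x, (∑ n ∈ Finset.range (N + 1), f n x) ^ 2 *
      (slope ε (ρ ^ 2 - ‖x‖ ^ 2) * wk R k x) =
      ∑ i ∈ Finset.range (N + 1), ∑ j ∈ Finset.range (N + 1),
        f i x * f j x * (slope ε (ρ ^ 2 - ‖x‖ ^ 2) * wk R k x) := by
    intro x
    rw [sq, Finset.sum_mul_sum, Finset.sum_mul]
    exact Finset.sum_congr rfl fun i _ => Finset.sum_mul _ _ _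
  simp_rw [e]
  rw [integral_finsetSum _ fun i _ => integrable_finsetSum _ fun j _ => hInt i j]
  have e2 : ∀ i ∈ Finset.range (N + 1), ∫ x, ∑ j ∈ Finset.range (N + 1),
      f i x * f j x * (slope ε (ρ ^ 2 - ‖x‖ ^ 2) * wk R k x) =
      ∫ x, f i x ^ 2 * (slope ε (ρ ^ 2 - ‖x‖ ^ 2) * wk R k x) := by
    intro i hi
    rw [integral_finsetSum _ fun j _ => hInt i j, Finset.sum_eq_single_of_mem i hi]
    · simp_rw [sq]
    · intro j hj hji
      exact integral_mul_eq_zero_of_ne H hji.symm (hf i) (hf j)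
        (regLap_component_eq_zero H hf h (Finset.mem_range.1 hi))
        (regLap_component_eq_zero H hf h (Finset.mem_range.1 hj)) hε hρ
  rw [Finset.sum_congr rfl e2]
  refine Finset.single_le_sum (f := fun i => ∫ x, f i x ^ 2 *
    (slope ε (ρ ^ 2 - ‖x‖ ^ 2) * wk R k x)) (fun i _ => integral_nonneg fun x => ?_)
    (Finset.mem_range.2 hn)
  exact mul_nonneg (sq_nonneg _) (mul_nonneg (slope_nonneg _ _) (wk_nonneg _ _ _))

lemma setIntegral_component_sq_le {R : Finset (E d)} {k : E d → ℝ} (H : IsRootData R k) {N : ℕ}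
    {f : ℕ → E d → ℝ} (hf : ∀ n, f n ∈ HP d n)
    (h : regLap R k (∑ n ∈ Finset.range (N + 1), f n) = 0) {n : ℕ} (hn : n < N + 1)
    {ρ ρ' M : ℝ} (hρ' : 0 ≤ ρ') (hρ : ρ' < ρ)
    (hM : ∀ x, ‖x‖ ≤ ρ → |∑ n ∈ Finset.range (N + 1), f n x| ≤ M) :
    ∫ x in Metric.closedBall (0 : E d) ρ', f n x ^ 2 * wk R k x ≤
      M ^ 2 * ∫ x in Metric.closedBall (0 : E d) ρ, wk R k x := by
  have hρ0 : 0 ≤ ρ := hρ'.trans hρ.le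
  set ε := (ρ ^ 2 - ρ' ^ 2) / 2 with hεdef
  have hε : 0 < ε := by
    have : ρ' ^ 2 < ρ ^ 2 := pow_lt_pow_left₀ hρ hρ' two_ne_zero
    rw [hεdef]; linarith
  have hw := continuous_wk H.pos
  have hs : Continuous fun x : E d => slope ε (ρ ^ 2 - ‖x‖ ^ 2) := continuous_slope_norm ε ρ
  have hfc : ∀ n, Continuous (f n) := fun n => (contDiff_of_mem_HP (m := 2) (hf n)).continuous
  have hvan : ∀ (g : E d → ℝ) (x : E d), ρ < ‖x‖ →
      g x * (slope ε (ρ ^ 2 - ‖x‖ ^ 2) * wk R k x) = 0 := fun g x hx => by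
    rw [slope_eq_zero_of_lt_norm hε hρ0 hx, zero_mul, mul_zero]
  have hInt1 : Integrable fun x => f n x ^ 2 * (slope ε (ρ ^ 2 - ‖x‖ ^ 2) * wk R k x) :=
    integrable_of_eq_zero (((hfc n).pow 2).mul (hs.mul hw)) (hvan fun x => f n x ^ 2)
  have hPc : Continuous fun x => ∑ n ∈ Finset.range (N + 1), f n x :=
    continuous_finsetSum _ fun n _ => hfc n
  calc ∫ x in Metric.closedBall (0 : E d) ρ', f n x ^ 2 * wk R k x
      = ∫ x in Metric.closedBall (0 : E d) ρ',
          f n x ^ 2 * (slope ε (ρ ^ 2 - ‖x‖ ^ 2) * wk R k x) := by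
        refine setIntegral_congr_fun measurableSet_closedBall fun x hx => ?_
        have hx : ‖x‖ ≤ ρ' := by simpa using hx
        have h2 : ‖x‖ ^ 2 ≤ ρ' ^ 2 := pow_le_pow_left₀ (norm_nonneg _) hx 2
        rw [slope_eq_one hε (by rw [hεdef]; linarith), one_mul]
    _ ≤ ∫ x, f n x ^ 2 * (slope ε (ρ ^ 2 - ‖x‖ ^ 2) * wk R k x) :=
        setIntegral_le_integral hInt1 <| Eventually.of_forall fun x =>
          mul_nonneg (sq_nonneg _) (mul_nonneg (slope_nonneg _ _) (wk_nonneg R k x))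
    _ ≤ ∫ x, (∑ n ∈ Finset.range (N + 1), f n x) ^ 2 *
          (slope ε (ρ ^ 2 - ‖x‖ ^ 2) * wk R k x) := integral_component_sq_le H hf h hn hε hρ0
    _ = ∫ x in Metric.closedBall (0 : E d) ρ, (∑ n ∈ Finset.range (N + 1), f n x) ^ 2 *
          (slope ε (ρ ^ 2 - ‖x‖ ^ 2) * wk R k x) := by
        refine (setIntegral_eq_integral_of_forall_compl_eq_zero fun x hx => ?_).symm
        exact hvan (fun x => (∑ n ∈ Finset.range (N + 1), f n x) ^ 2) x (by simpa using hx)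
    _ ≤ ∫ x in Metric.closedBall (0 : E d) ρ, M ^ 2 * wk R k x := by
        refine setIntegral_mono_on
          (((hPc.pow 2).mul (hs.mul hw)).continuousOn.integrableOn_compact
            (isCompact_closedBall _ _))
          ((continuous_const.mul hw).continuousOn.integrableOn_compact
            (isCompact_closedBall _ _)) measurableSet_closedBall fun x hx => ?_
        have h1 : (∑ n ∈ Finset.range (N + 1), f n x) ^ 2 ≤ M ^ 2 :=
          sq_le_sq' (neg_le_of_abs_le (hM x (by simpa using hx)))
            (le_of_abs_le (hM x (by simpa using hx)))
        refine mul_le_mul h1 ?_ (mul_nonneg (slope_nonneg _ _) (wk_nonneg R k x)) (sq_nonneg _)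
        exact mul_le_of_le_one_left (wk_nonneg R k x) (slope_le_one _ _)
    _ = _ := integral_const_mul _ _

lemma abs_component_le {R : Finset (E d)} {k : E d → ℝ} (H : IsRootData R k) {ρ ρ' : ℝ}
    (hρ' : 0 < ρ') (hρ : ρ' < ρ) :
    ∃ C : ℝ, 0 ≤ C ∧ ∃ A : ℕ, ∀ (N : ℕ) (f : ℕ → E d → ℝ), (∀ n, f n ∈ HP d n) →
      regLap R k (∑ n ∈ Finset.range (N + 1), f n) = 0 → ∀ M,
      (∀ x, ‖x‖ ≤ ρ → |∑ n ∈ Finset.range (N + 1), f n x| ≤ M) → ∀ n < N + 1,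
      ∀ x, ‖x‖ ≤ ρ' → |f n x| ≤ C * (n + 1) ^ A * M := by
  obtain ⟨K, hK, A, hA⟩ := sq_le_setIntegral_of_mem_HP H.ne_zero H.pos hρ'
  set W := ∫ x in Metric.closedBall (0 : E d) ρ, wk R k x with hW
  have hW0 : 0 ≤ W := integral_nonneg fun x => wk_nonneg R k x
  refine ⟨K * W + 1, by positivity, A, fun N f hf h M hM n hn x hx => ?_⟩
  have hM0 : 0 ≤ M := (abs_nonneg _).trans (hM 0 (by simpa using (hρ'.trans hρ).le))
  have h1 := hA n (f n) (hf n) x hx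
  have h2 := setIntegral_component_sq_le H hf h hn hρ'.le hρ hM
  have ha : (1 : ℝ) ≤ ((n : ℝ) + 1) ^ A := one_le_pow₀ (by linarith [n.cast_nonneg (α := ℝ)])
  refine abs_le_of_sq_le_sq ?_ (by positivity)
  set a := ((n : ℝ) + 1) ^ A
  have hKW : 0 ≤ K * W := by positivity
  calc f n x ^ 2 ≤ K * a * (M ^ 2 * W) := h1.trans (by gcongr)
    _ = (K * W) * a * M ^ 2 := by ring
    _ ≤ (K * W + 1) ^ 2 * a ^ 2 * M ^ 2 := by
        gcongr
        · nlinarith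
        · nlinarith
    _ = ((K * W + 1) * a * M) ^ 2 := by ring

lemma abs_le_geometric_of_mem_HP {n : ℕ} {u : E d → ℝ} (hu : u ∈ HP d n) {ρ B q : ℝ}
    (hq : 0 < q) (hB : ∀ x, ‖x‖ ≤ ρ → |u x| ≤ B) {x : E d} (hx : ‖x‖ ≤ q * ρ) :
    |u x| ≤ B * q ^ n := by
  have h1 : u x = q ^ n * u (q⁻¹ • x) := by
    rw [← map_smul_of_mem_HP hu, smul_inv_smul₀ hq.ne']
  rw [h1, abs_mul, abs_of_pos (pow_pos hq n), mul_comm]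
  refine mul_le_mul_of_nonneg_right (hB _ ?_) (pow_pos hq n).le
  rw [norm_smul, norm_inv, Real.norm_of_nonneg hq.le, inv_mul_le_iff₀ hq]
  exact hx

lemma norm_hess_le_of_mem_HP {n : ℕ} {u : E d → ℝ} (hu : u ∈ HP d n) {ρ τ M : ℝ}
    (hM : ∀ x, ‖x‖ ≤ ρ → |u x| ≤ M) (hM0 : 0 ≤ M) (hτ : 0 < τ) {y : E d}
    (hy : ‖y‖ + 4 * τ ≤ ρ) : ‖hess u y‖ ≤ n ^ 4 * M / τ ^ 2 := by
  have hu2 := contDiff_of_mem_HP (m := 2) hu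
  refine ContinuousLinearMap.opNorm_le_bound₂ _ (by positivity) fun a b => ?_
  rcases n with _ | n
  · have h0 : fderiv ℝ u = 0 := funext fun x => fderiv_of_mem_HP_zero hu x
    have : hess u y = 0 := by simp [hess, h0]
    simp [this]
  have h1 : ∀ x, ‖x‖ ≤ ‖y‖ + 2 * τ →
      |fderiv ℝ u x b| ≤ ((n + 1 : ℕ) : ℝ) ^ 2 * M / τ * ‖b‖ := fun x hx =>
    (ContinuousLinearMap.le_opNorm _ _).trans <| mul_le_mul_of_nonneg_right
      (norm_fderiv_le_of_mem_HP hu hM hτ (by linarith)) (norm_nonneg _)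
  have h2 := norm_fderiv_le_of_mem_HP (fderiv_mem_HP b hu) h1 hτ le_rfl
  rw [hess_apply_eq hu2]
  refine ((ContinuousLinearMap.le_opNorm _ _).trans
    (mul_le_mul_of_nonneg_right h2 (norm_nonneg a))).trans ?_
  have hn : (n : ℝ) ^ 2 ≤ ((n + 1 : ℕ) : ℝ) ^ 2 := by push_cast; gcongr; linarith
  calc (n : ℝ) ^ 2 * (((n + 1 : ℕ) : ℝ) ^ 2 * M / τ * ‖b‖) / τ * ‖a‖
      ≤ ((n + 1 : ℕ) : ℝ) ^ 2 * (((n + 1 : ℕ) : ℝ) ^ 2 * M / τ * ‖b‖) / τ * ‖a‖ := by gcongr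
    _ = _ := by field_simp

lemma summable_succ_pow_mul_geometric (A : ℕ) {q : ℝ} (hq : 0 < q) (hq1 : q < 1) :
    Summable fun n : ℕ => ((n : ℝ) + 1) ^ A * q ^ n := by
  have h := summable_pow_mul_geometric_of_norm_lt_one A
    (r := q) (by rwa [Real.norm_of_nonneg hq.le])
  have h' := ((summable_nat_add_iff 1).2 h).mul_left q⁻¹
  refine h'.congr fun n => ?_
  push_cast
  field_simp
  ring

/-- Interior derivative estimates for harmonic polynomials, uniform in the degree. -/
lemma exists_interior_estimate {R : Finset (E d)} {k : E d → ℝ} (H : IsRootData R k) {ρ₁ ρ : ℝ}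
    (hρ₁ : 0 ≤ ρ₁) (hρ : ρ₁ < ρ) :
    ∃ K : ℝ, 0 ≤ K ∧ ∀ (N : ℕ) (P : E d → ℝ), P ∈ Pol d N → regLap R k P = 0 → ∀ M,
      (∀ x, ‖x‖ ≤ ρ → |P x| ≤ M) → ∀ x, ‖x‖ ≤ ρ₁ →
        ‖fderiv ℝ P x‖ ≤ K * M ∧ ‖hess P x‖ ≤ K * M := by
  set ρ₂ := (2 * ρ₁ + ρ) / 3 with h2
  set ρ₃ := (ρ₁ + 2 * ρ) / 3 with h3
  have h12 : ρ₁ < ρ₂ := by rw [h2]; linarith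
  have h23 : ρ₂ < ρ₃ := by rw [h2, h3]; linarith
  have h3ρ : ρ₃ < ρ := by rw [h3]; linarith
  have hρ₂ : 0 < ρ₂ := hρ₁.trans_lt h12
  have hρ₃ : 0 < ρ₃ := hρ₂.trans h23
  obtain ⟨C, hC, A, hA⟩ := abs_component_le H hρ₃ h3ρ
  set q := ρ₂ / ρ₃ with hq
  have hq0 : 0 < q := by positivity
  have hq1 : q < 1 := (div_lt_one hρ₃).2 h23
  have hqρ : q * ρ₃ = ρ₂ := div_mul_cancel₀ _ hρ₃.ne'
  set τ := (ρ₂ - ρ₁) / 4 with hτdef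
  have hτ : 0 < τ := by rw [hτdef]; linarith
  set S := ∑' n : ℕ, ((n : ℝ) + 1) ^ (A + 4) * q ^ n with hS
  have hsum := summable_succ_pow_mul_geometric (A + 4) hq0 hq1
  have hS0 : 0 ≤ S := tsum_nonneg fun n => by positivity
  refine ⟨(1 / τ + 1 / τ ^ 2) * C * S, by positivity, fun N P hP hPh M hM x hx => ?_⟩
  obtain ⟨f, hf, rfl⟩ := exists_sum_of_mem_Pol hP
  simp only [Finset.sum_apply] at hM
  have hM0 : 0 ≤ M := (abs_nonneg _).trans (hM 0 (by simpa using (hρ₃.trans h3ρ).le))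
  have hfc : ∀ n, ContDiff ℝ 2 (f n) := fun n => contDiff_of_mem_HP (hf n)
  have hbd : ∀ n < N + 1, ∀ y, ‖y‖ ≤ ρ₂ → |f n y| ≤ C * (n + 1) ^ A * M * q ^ n :=
    fun n hn y hy => abs_le_geometric_of_mem_HP (hf n) hq0 (hA N f hf hPh M hM n hn)
      (by rwa [hqρ])
  have hpart : ∑ n ∈ Finset.range (N + 1), ((n : ℝ) + 1) ^ (A + 4) * q ^ n ≤ S :=
    hsum.sum_le_tsum _ fun n _ => by positivity
  have hfin : ∀ c, 0 ≤ c → c ≤ 1 / τ + 1 / τ ^ 2 →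
      ∑ n ∈ Finset.range (N + 1), c * C * M * (((n : ℝ) + 1) ^ (A + 4) * q ^ n) ≤
        (1 / τ + 1 / τ ^ 2) * C * S * M := fun c hc0 hc => by
    rw [← Finset.mul_sum]
    calc _ ≤ (1 / τ + 1 / τ ^ 2) * C * M * S := by gcongr
      _ = _ := by ring
  have h1 : fderiv ℝ (∑ n ∈ Finset.range (N + 1), f n) =
      ∑ n ∈ Finset.range (N + 1), fderiv ℝ (f n) := by
    funext y
    rw [fderiv_sum fun n _ => differentiable_of_contDiff_two (hfc n) y, Finset.sum_apply]
  have hpow : ∀ n : ℕ, ∀ j ≤ 4, (n : ℝ) ^ j * ((n : ℝ) + 1) ^ A ≤ ((n : ℝ) + 1) ^ (A + 4) :=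
    fun n j hj => by
      rw [pow_add, mul_comm]
      gcongr
      calc (n : ℝ) ^ j ≤ ((n : ℝ) + 1) ^ j := by gcongr; linarith
        _ ≤ _ := pow_le_pow_right₀ (by linarith [n.cast_nonneg (α := ℝ)]) hj
  constructor
  · rw [h1, Finset.sum_apply]
    refine (norm_sum_le _ _).trans (le_trans (Finset.sum_le_sum fun n hn => ?_)
      (hfin (1 / τ) (by positivity) (by simp; positivity)))
    refine (norm_fderiv_le_of_mem_HP (hf n) (hbd n (Finset.mem_range.1 hn)) hτ
      (by rw [hτdef]; linarith)).trans ?_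
    calc (n : ℝ) ^ 2 * (C * (n + 1) ^ A * M * q ^ n) / τ
        = 1 / τ * C * M * (((n : ℝ) ^ 2 * ((n : ℝ) + 1) ^ A) * q ^ n) := by ring
      _ ≤ _ := by gcongr; exact hpow n 2 (by norm_num)
  · have h4 : hess (∑ n ∈ Finset.range (N + 1), f n) x =
        ∑ n ∈ Finset.range (N + 1), hess (f n) x := by
      rw [hess, h1, fderiv_sum fun n _ => differentiable_fderiv (hfc n) x]
    rw [h4]
    refine (norm_sum_le (Finset.range (N + 1)) fun n => hess (f n) x).trans
      (le_trans (Finset.sum_le_sum fun n hn => ?_)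
      (hfin (1 / τ ^ 2) (by positivity) (by simp; positivity)))
    refine (norm_hess_le_of_mem_HP (hf n) (hbd n (Finset.mem_range.1 hn)) (by positivity) hτ
      (by rw [hτdef]; linarith)).trans ?_
    calc (n : ℝ) ^ 4 * (C * (n + 1) ^ A * M * q ^ n) / τ ^ 2
        = 1 / τ ^ 2 * C * M * (((n : ℝ) ^ 4 * ((n : ℝ) + 1) ^ A) * q ^ n) := by ring
      _ ≤ _ := by gcongr; exact hpow n 4 le_rfl

/-! ### Maximum principle and the polynomial Dirichlet problem -/

lemma hess_nonpos_of_isLocalMax {u : E d → ℝ} (hu : ContDiff ℝ 2 u) {x : E d}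
    (hx : IsLocalMax u x) (a : E d) : hess u x a a ≤ 0 := by
  by_contra! hpos
  have h1 : deriv (fun t : ℝ => u (x + t • a)) = fun t => fderiv ℝ u (x + t • a) a :=
    funext fun t => (hasDerivAt_line (differentiable_of_contDiff_two hu) x a t).deriv
  have h2 : deriv (deriv fun t : ℝ => u (x + t • a)) 0 = hess u x a a := by
    rw [h1, (hasDerivAt_line_fderiv hu x a a 0).deriv, zero_smul, add_zero]
  have hc : ContinuousAt (fun t : ℝ => u (x + t • a)) 0 :=
    (hasDerivAt_line (differentiable_of_contDiff_two hu) x a 0).continuousAt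
  have hmax : IsLocalMax (fun t : ℝ => u (x + t • a)) 0 := by
    have ht : Tendsto (fun t : ℝ => x + t • a) (𝓝 0) (𝓝 x) := by
      have : Continuous fun t : ℝ => x + t • a := by fun_prop
      simpa using this.tendsto 0
    have := ht.eventually hx
    simpa [IsLocalMax, IsMaxFilter] using this
  have hmin := isLocalMin_of_deriv_deriv_pos (by rwa [h2]) hmax.deriv_eq_zero hc
  have heq : (fun t : ℝ => u (x + t • a)) =ᶠ[𝓝 0] fun _ => u (x + (0 : ℝ) • a) := by
    filter_upwards [hmax, hmin] with t h3 h4 using le_antisymm h3 h4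
  have h5 : deriv (deriv fun t : ℝ => u (x + t • a)) 0 = 0 := by
    rw [heq.deriv.deriv_eq]; simp
  linarith

lemma rootOp_nonpos_of_isMax {α : E d} (hα : α ≠ 0) {u : E d → ℝ} (hu : ContDiff ℝ 2 u)
    {ρ : ℝ} {x : E d} (hx : ‖x‖ < ρ) (hmax : ∀ y, ‖y‖ < ρ → u y ≤ u x) : rootOp α u x ≤ 0 := by
  have hloc : IsLocalMax u x := by
    filter_upwards [Metric.isOpen_ball.mem_nhds (mem_ball_zero_iff.2 hx)] with y hy
    exact hmax y (mem_ball_zero_iff.1 hy)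
  by_cases h0 : ⟪α, x⟫ = 0
  · have hess_le := hess_nonpos_of_isLocalMax hu hloc α
    unfold rootOp
    refine mul_nonpos_of_nonneg_of_nonpos (by positivity) ?_
    simp only [h0, mul_zero, zero_div, zero_smul, sub_zero]
    rw [intervalIntegral.integral_mul_const]
    refine mul_nonpos_of_nonneg_of_nonpos ?_ hess_le
    exact intervalIntegral.integral_nonneg (by norm_num) fun t ht => by linarith [ht.2]
  · have h := rootOp_spec hα hu x
    rw [hloc.fderiv_eq_zero] at h
    have h1 := hmax (dunklReflect α x) (by rwa [norm_dunklReflect])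
    have h2 : 0 < ⟪α, x⟫ ^ 2 := by positivity
    have h3 : ⟪α, x⟫ ^ 2 * rootOp α u x ≤ 0 := by
      rw [← h]
      have : 0 ≤ ‖α‖ ^ 2 / 2 * (u x - u (dunklReflect α x)) :=
        mul_nonneg (by positivity) (by linarith)
      simpa using this
    by_contra! hcon
    exact absurd h3 (not_le.2 (mul_pos h2 hcon))

lemma regLap_nonpos_of_isMax {R : Finset (E d)} {k : E d → ℝ} (H : IsRootData R k)
    {u : E d → ℝ} (hu : ContDiff ℝ 2 u) {ρ : ℝ} {x : E d} (hx : ‖x‖ < ρ)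
    (hmax : ∀ y, ‖y‖ < ρ → u y ≤ u x) : regLap R k u x ≤ 0 := by
  have hloc : IsLocalMax u x := by
    filter_upwards [Metric.isOpen_ball.mem_nhds (mem_ball_zero_iff.2 hx)] with y hy
    exact hmax y (mem_ball_zero_iff.1 hy)
  refine add_nonpos ?_ (Finset.sum_nonpos fun α hα => mul_nonpos_of_nonneg_of_nonpos
    (H.pos α hα).le (rootOp_nonpos_of_isMax (H.ne_zero α hα) hu hx hmax))
  rw [lap_eq]
  exact Finset.sum_nonpos fun i _ => hess_nonpos_of_isLocalMax hu hloc _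

lemma regLap_norm_sq {R : Finset (E d)} {k : E d → ℝ} (H : IsRootData R k) (x : E d) :
    regLap R k (fun y => ‖y‖ ^ 2) x = 2 * (d + ∑ α ∈ R, k α) := by
  have h := regLap_mul_comp_norm_sq H.ne_zero k (s := fun _ => 1) contDiff_const
    (Φ := fun t => t) contDiff_id x
  have h0 : regLap R k (fun _ => (1 : ℝ)) x = 0 := by
    rw [regLap_eq_zero_of_mem_HP H.ne_zero k (n := 0) (by norm_num) (const_mem_HP 1)]; rfl
  have hd1 : deriv (fun t : ℝ => t) = fun _ => 1 := funext fun t => deriv_id t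
  simpa [h0, hd1] using h

lemma le_of_le_on_sphere {R : Finset (E d)} {k : E d → ℝ} (H : IsRootData R k) (hd : 1 ≤ d)
    {u : E d → ℝ} (hu : ContDiff ℝ 2 u) (h0 : regLap R k u = 0) {ρ M : ℝ}
    (hM : ∀ x, ‖x‖ = ρ → u x ≤ M) {x : E d} (hx : ‖x‖ ≤ ρ) : u x ≤ M := by
  by_contra! hcon
  have hρ : 0 ≤ ρ := (norm_nonneg x).trans hx
  set ε := (u x - M) / (2 * (ρ ^ 2 + 1)) with hε
  have hε0 : 0 < ε := div_pos (by linarith) (by positivity)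
  have hερ : ε * ρ ^ 2 < u x - M := by
    have : ε * (2 * (ρ ^ 2 + 1)) = u x - M := div_mul_cancel₀ _ (by positivity)
    nlinarith [mul_nonneg hε0.le (sq_nonneg ρ)]
  have hn : ContDiff ℝ 2 fun y : E d => ‖y‖ ^ 2 := contDiff_norm_sq ℝ
  have hf : ContDiff ℝ 2 (u + ε • fun y : E d => ‖y‖ ^ 2) := hu.add (hn.const_smul ε)
  obtain ⟨z, hz, hzmax⟩ := (isCompact_closedBall (0 : E d) ρ).exists_isMaxOn
    ⟨x, by simpa using hx⟩ hf.continuous.continuousOn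
  have hzmax : ∀ y, ‖y‖ ≤ ρ → u y + ε * ‖y‖ ^ 2 ≤ u z + ε * ‖z‖ ^ 2 := fun y hy => by
    simpa using hzmax (show y ∈ Metric.closedBall (0 : E d) ρ by simpa using hy)
  have hz : ‖z‖ ≤ ρ := by simpa using hz
  rcases hz.lt_or_eq with hlt | heq
  · have h1 := regLap_nonpos_of_isMax H hf hlt fun y hy => by simpa using hzmax y hy.le
    rw [regLap_add (v := ε • fun y : E d => ‖y‖ ^ 2) R k hu (hn.const_smul ε),
      regLap_const_smul R k hn, h0] at h1
    simp only [Pi.add_apply, Pi.zero_apply, Pi.smul_apply, regLap_norm_sq H, smul_eq_mul,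
      zero_add] at h1
    have h2 : (0 : ℝ) < d + ∑ α ∈ R, k α :=
      add_pos_of_pos_of_nonneg (by exact_mod_cast hd) (Finset.sum_nonneg fun α hα =>
        (H.pos α hα).le)
    exact absurd h1 (not_le.2 (by positivity))
  · have h1 := hzmax x hx
    have h2 := hM z heq
    rw [heq] at h1
    have h3 : 0 ≤ ε * ‖x‖ ^ 2 := by positivity
    linarith

lemma abs_le_of_abs_le_on_sphere {R : Finset (E d)} {k : E d → ℝ} (H : IsRootData R k)
    (hd : 1 ≤ d) {u : E d → ℝ} (hu : ContDiff ℝ 2 u) (h0 : regLap R k u = 0) {ρ M : ℝ}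
    (hM : ∀ x, ‖x‖ = ρ → |u x| ≤ M) {x : E d} (hx : ‖x‖ ≤ ρ) : |u x| ≤ M := by
  refine abs_le'.2 ⟨le_of_le_on_sphere H hd hu h0 (fun y hy => le_of_abs_le (hM y hy)) hx, ?_⟩
  have h1 : regLap R k ((-1 : ℝ) • u) = 0 := by rw [regLap_const_smul R k hu, h0, smul_zero]
  have := le_of_le_on_sphere H hd (hu.const_smul (-1 : ℝ)) h1 (M := M) (fun y hy => by
    simpa using (neg_le_abs _).trans (hM y hy)) hx
  simpa using this

lemma eq_zero_of_mem_Pol {N : ℕ} {u : E d → ℝ} (hu : u ∈ Pol d N) {ρ : ℝ} (hρ : 0 < ρ)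
    (h : ∀ x, ‖x‖ < ρ → u x = 0) : u = 0 := by
  obtain ⟨f, hf, rfl⟩ := exists_sum_of_mem_Pol hu
  refine Finset.sum_eq_zero fun n hn => funext fun x => ?_
  refine coeff_eq_zero_of_small (N := N + 1) (c := fun n => f n x) (δ := ρ / (‖x‖ + 1))
    (by positivity) (fun t ht htρ => ?_) (Finset.mem_range.1 hn)
  have h1 := h (t • x) (by
    rw [norm_smul, Real.norm_of_nonneg ht.le]
    have h2 : t * (‖x‖ + 1) < ρ := (lt_div_iff₀ (by positivity)).1 htρ
    nlinarith)
  rw [Finset.sum_apply] at h1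
  rw [← h1]
  exact Finset.sum_congr rfl fun n _ => (map_smul_of_mem_HP (hf n) t x).symm

lemma regLap_mem_Pol {R : Finset (E d)} {k : E d → ℝ} (H : IsRootData R k) {N : ℕ}
    {u : E d → ℝ} (hu : u ∈ Pol d (N + 2)) : regLap R k u ∈ Pol d N := by
  obtain ⟨f, hf, rfl⟩ := exists_sum_of_mem_Pol hu
  rw [regLap_sum R k _ fun n => contDiff_of_mem_HP (hf n)]
  refine Submodule.sum_mem _ fun n hn => ?_
  rcases lt_or_ge n 2 with h2 | h2
  · rw [regLap_eq_zero_of_mem_HP H.ne_zero k h2 (hf n)]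
    exact Submodule.zero_mem _
  · obtain ⟨m, rfl⟩ := Nat.exists_eq_add_of_le' h2
    exact HP_le_Pol (by have := Finset.mem_range.1 hn; omega)
      (regLap_mem_HP H.ne_zero k (hf (m + 2)))

lemma mul_sub_norm_sq_mem_Pol {N : ℕ} {s : E d → ℝ} (hs : s ∈ Pol d N) (ρ : ℝ) :
    (fun x => s x * (ρ ^ 2 - ‖x‖ ^ 2)) ∈ Pol d (N + 2) := by
  obtain ⟨f, hf, rfl⟩ := exists_sum_of_mem_Pol hs
  have h : (fun x => (∑ n ∈ Finset.range (N + 1), f n) x * (ρ ^ 2 - ‖x‖ ^ 2)) =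
      ∑ n ∈ Finset.range (N + 1), ((ρ ^ 2) • f n - fun x => f n x * ‖x‖ ^ 2) := by
    ext x
    simp only [Finset.sum_apply, Finset.sum_mul, Pi.sub_apply, Pi.smul_apply, smul_eq_mul]
    exact Finset.sum_congr rfl fun n _ => by ring
  rw [h]
  refine Submodule.sum_mem _ fun n hn => ?_
  have hn := Finset.mem_range.1 hn
  exact Submodule.sub_mem _ (Submodule.smul_mem _ _ (HP_le_Pol (by omega) (hf n)))
    (HP_le_Pol (by omega) (mul_mem_HP (hf n) norm_sq_mem_HP))

/-- The operator `s ↦ Δ_k ((ρ ^ 2 - ‖·‖ ^ 2) s)` on polynomials of degree at most `N`. -/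
def dirichletOp {R : Finset (E d)} {k : E d → ℝ} (H : IsRootData R k) (N : ℕ) (ρ : ℝ) :
    Pol d N →ₗ[ℝ] Pol d N where
  toFun s := ⟨regLap R k fun x => s.1 x * (ρ ^ 2 - ‖x‖ ^ 2),
    regLap_mem_Pol H (mul_sub_norm_sq_mem_Pol s.2 ρ)⟩
  map_add' s t := by
    refine Subtype.ext (Eq.trans ?_ (regLap_add R k
      (contDiff_of_mem_Pol (mul_sub_norm_sq_mem_Pol s.2 ρ))
      (contDiff_of_mem_Pol (mul_sub_norm_sq_mem_Pol t.2 ρ))))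
    change regLap R k _ = _
    congr 1
    ext x
    simp [add_mul]
  map_smul' c s := by
    refine Subtype.ext (Eq.trans ?_ (regLap_const_smul R k
      (contDiff_of_mem_Pol (mul_sub_norm_sq_mem_Pol s.2 ρ)) c))
    change regLap R k _ = _
    congr 1
    ext x
    simp [mul_assoc]

lemma exists_regLap_mul_eq {R : Finset (E d)} {k : E d → ℝ} (H : IsRootData R k) (hd : 1 ≤ d)
    {N : ℕ} {ρ : ℝ} (hρ : 0 < ρ) {q : E d → ℝ} (hq : q ∈ Pol d N) :
    ∃ s ∈ Pol d N, regLap R k (fun x => s x * (ρ ^ 2 - ‖x‖ ^ 2)) = q := by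
  have hinj : Function.Injective (dirichletOp H N ρ) := by
    rw [← LinearMap.ker_eq_bot, LinearMap.ker_eq_bot']
    intro s hs
    have h0 : regLap R k (fun x => s.1 x * (ρ ^ 2 - ‖x‖ ^ 2)) = 0 := congrArg Subtype.val hs
    have hc : ContDiff ℝ 2 fun x => s.1 x * (ρ ^ 2 - ‖x‖ ^ 2) :=
      contDiff_of_mem_Pol (mul_sub_norm_sq_mem_Pol s.2 ρ)
    refine Subtype.ext (eq_zero_of_mem_Pol s.2 hρ fun x hx => ?_)
    have h1 := abs_le_of_abs_le_on_sphere H hd hc h0 (ρ := ρ) (M := 0)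
      (fun y hy => by simp [hy]) hx.le
    have h2 : s.1 x * (ρ ^ 2 - ‖x‖ ^ 2) = 0 := abs_nonpos_iff.1 h1
    refine (mul_eq_zero.1 h2).resolve_right (ne_of_gt ?_)
    have := pow_lt_pow_left₀ hx (norm_nonneg x) two_ne_zero
    linarith
  obtain ⟨s, hs⟩ := LinearMap.injective_iff_surjective.1 hinj ⟨q, hq⟩
  exact ⟨s.1, s.2, congrArg Subtype.val hs⟩

lemma Pol_mono {N N' : ℕ} (h : N ≤ N') : Pol d N ≤ Pol d N' :=
  iSup₂_le fun n hn => HP_le_Pol (by have := Finset.mem_range.1 hn; omega)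

lemma exists_harmonic_extension {R : Finset (E d)} {k : E d → ℝ} (H : IsRootData R k)
    (hd : 1 ≤ d) {N : ℕ} {ρ : ℝ} (hρ : 0 < ρ) {p : E d → ℝ} (hp : p ∈ Pol d N) :
    ∃ u ∈ Pol d (N + 2), regLap R k u = 0 ∧ ∀ x, ‖x‖ = ρ → u x = p x := by
  have hp' := Pol_mono (Nat.le_add_right N 2) hp
  obtain ⟨s, hs, hsq⟩ := exists_regLap_mul_eq H hd hρ (regLap_mem_Pol H hp')
  have hg := mul_sub_norm_sq_mem_Pol hs ρ
  refine ⟨p - fun x => s x * (ρ ^ 2 - ‖x‖ ^ 2), Submodule.sub_mem _ hp' hg, ?_, fun x hx => ?_⟩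
  · rw [regLap_sub R k (contDiff_of_mem_Pol hp') (contDiff_of_mem_Pol hg), hsq, sub_self]
  · simp [hx]

/-! ### Polynomial approximation and the continuous Dirichlet problem -/

lemma mul_mem_Pol {N M : ℕ} {u v : E d → ℝ} (hu : u ∈ Pol d N) (hv : v ∈ Pol d M) :
    (fun x => u x * v x) ∈ Pol d (N + M) := by
  obtain ⟨f, hf, rfl⟩ := exists_sum_of_mem_Pol hu
  obtain ⟨g, hg, rfl⟩ := exists_sum_of_mem_Pol hv
  have h : (fun x => (∑ n ∈ Finset.range (N + 1), f n) x * (∑ m ∈ Finset.range (M + 1), g m) x) =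
      ∑ n ∈ Finset.range (N + 1), ∑ m ∈ Finset.range (M + 1), fun x => f n x * g m x := by
    ext x
    simp only [Finset.sum_apply, Finset.sum_mul_sum]
  rw [h]
  refine Submodule.sum_mem _ fun n hn => Submodule.sum_mem _ fun m hm => ?_
  have hn := Finset.mem_range.1 hn
  have hm := Finset.mem_range.1 hm
  exact HP_le_Pol (by omega) (mul_mem_HP (hf n) (hg m))

/-- The algebra of polynomial functions on a subset. -/
def polAlgebra (K : Set (E d)) : Subalgebra ℝ C(K, ℝ) where
  carrier := {f | ∃ N, ∃ p ∈ Pol d N, ∀ x : K, f x = p x}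
  mul_mem' := by
    rintro f g ⟨N, p, hp, hf⟩ ⟨M, q, hq, hg⟩
    exact ⟨N + M, _, mul_mem_Pol hp hq, fun x => by simp [hf x, hg x]⟩
  add_mem' := by
    rintro f g ⟨N, p, hp, hf⟩ ⟨M, q, hq, hg⟩
    exact ⟨N + M, p + q, Submodule.add_mem _ (Pol_mono (Nat.le_add_right N M) hp)
      (Pol_mono (Nat.le_add_left M N) hq), fun x => by simp [hf x, hg x]⟩
  algebraMap_mem' c := ⟨0, fun _ => c, HP_le_Pol le_rfl (const_mem_HP c), fun _ => rfl⟩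

lemma exists_polynomial_near {K : Set (E d)} (hK : IsCompact K) {h : E d → ℝ}
    (hh : ContinuousOn h K) {η : ℝ} (hη : 0 < η) :
    ∃ N, ∃ p ∈ Pol d N, ∀ x ∈ K, |p x - h x| < η := by
  have : CompactSpace K := isCompact_iff_compactSpace.1 hK
  have hsep : (polAlgebra K).SeparatesPoints := by
    intro x y hxy
    have hne : (x : E d) ≠ y := fun h => hxy (Subtype.ext h)
    obtain ⟨i, hi⟩ : ∃ i, (x : E d) i ≠ (y : E d) i := by
      by_contra! hcon
      exact hne (PiLp.ext hcon)
    exact ⟨_, ⟨⟨fun z : K => (z : E d) i, by fun_prop⟩,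
      ⟨1, _, HP_le_Pol le_rfl (coord_mem_HP i), fun _ => rfl⟩, rfl⟩, hi⟩
  obtain ⟨⟨g, N, p, hp, hg⟩, hgh⟩ :=
    ContinuousMap.exists_mem_subalgebra_near_continuous_of_separatesPoints (polAlgebra K) hsep
      (fun x : K => h x) hh.domRestrict η hη
  refine ⟨N, p, hp, fun x hx => ?_⟩
  have := hgh ⟨x, hx⟩
  rwa [Real.norm_eq_abs, hg] at this

lemma uniformCauchySeqOn_of_le {F : Type*} [NormedAddCommGroup F] {f : ℕ → E d → F}
    {s : Set (E d)} {K : ℝ} (hK : 0 ≤ K)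
    (h : ∀ i j, ∀ x ∈ s, ‖f i x - f j x‖ ≤ K * (1 / ((i : ℝ) + 1) + 1 / ((j : ℝ) + 1))) :
    UniformCauchySeqOn f atTop s := by
  refine Metric.uniformCauchySeqOn_iff.2 fun ε hε => ?_
  obtain ⟨n, hn⟩ := exists_nat_one_div_lt (show 0 < ε / (2 * (K + 1)) by positivity)
  refine ⟨n, fun i hi j hj x hx => ?_⟩
  rw [dist_eq_norm]
  refine (h i j x hx).trans_lt ?_
  have h1 := (Nat.one_div_le_one_div (α := ℝ) hi).trans_lt hn
  have h2 := (Nat.one_div_le_one_div (α := ℝ) hj).trans_lt hn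
  have h3 : (0 : ℝ) < 1 / ((i : ℝ) + 1) + 1 / ((j : ℝ) + 1) := by positivity
  calc K * (1 / ((i : ℝ) + 1) + 1 / ((j : ℝ) + 1))
      < (K + 1) * (1 / ((i : ℝ) + 1) + 1 / ((j : ℝ) + 1)) := by nlinarith
    _ ≤ (K + 1) * (ε / (2 * (K + 1)) + ε / (2 * (K + 1))) := by gcongr
    _ = ε := by field_simp; norm_num

lemma exists_tendstoLocallyUniformlyOn {F : Type*} [NormedAddCommGroup F] [CompleteSpace F]
    {f : ℕ → E d → F} {ρ : ℝ}
    (h : ∀ ρ₁, 0 ≤ ρ₁ → ρ₁ < ρ → UniformCauchySeqOn f atTop (Metric.closedBall 0 ρ₁)) :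
    ∃ g, TendstoLocallyUniformlyOn f g atTop (Metric.ball 0 ρ) := by
  have hlim : ∀ x, ‖x‖ < ρ → ∃ y, Tendsto (fun n => f n x) atTop (𝓝 y) := fun x hx =>
    cauchySeq_tendsto_of_complete ((h ‖x‖ (norm_nonneg x) hx).cauchySeq (by simp))
  classical
  choose! g hg using hlim
  refine ⟨g, fun u hu x hx => ?_⟩
  have hx := mem_ball_zero_iff.1 hx
  obtain ⟨ρ₁, h1, h2⟩ := exists_between hx
  refine ⟨Metric.closedBall 0 ρ₁, mem_nhdsWithin_of_mem_nhds ?_, ?_⟩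
  · exact mem_of_superset (Metric.isOpen_ball.mem_nhds (mem_ball_zero_iff.2 h1))
      Metric.ball_subset_closedBall
  · exact (h ρ₁ ((norm_nonneg x).trans h1.le) h2).tendstoUniformlyOn_of_tendsto
      (fun y hy => hg y ((mem_closedBall_zero_iff.1 hy).trans_lt h2)) u hu

lemma contDiffOn_of_uniformCauchySeqOn {u : ℕ → E d → ℝ} (hu : ∀ n, ContDiff ℝ 2 (u n))
    {U : E d → ℝ} {ρ : ℝ} (hU : ∀ x, ‖x‖ < ρ → Tendsto (fun n => u n x) atTop (𝓝 (U x)))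
    (h1 : ∀ ρ₁, 0 ≤ ρ₁ → ρ₁ < ρ →
      UniformCauchySeqOn (fun n => fderiv ℝ (u n)) atTop (Metric.closedBall 0 ρ₁))
    (h2 : ∀ ρ₁, 0 ≤ ρ₁ → ρ₁ < ρ →
      UniformCauchySeqOn (fun n => hess (u n)) atTop (Metric.closedBall 0 ρ₁)) :
    ContDiffOn ℝ 2 U (Metric.ball 0 ρ) := by
  obtain ⟨G₁, hG₁⟩ := exists_tendstoLocallyUniformlyOn h1
  obtain ⟨G₂, hG₂⟩ :=
    exists_tendstoLocallyUniformlyOn (d := d) (F := E d →L[ℝ] E d →L[ℝ] ℝ) (ρ := ρ) h2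
  have ho : IsOpen (Metric.ball (0 : E d) ρ) := Metric.isOpen_ball
  have hd1 : ∀ x ∈ Metric.ball (0 : E d) ρ, HasFDerivAt U (G₁ x) x := fun x hx =>
    hasFDerivAt_of_tendstoLocallyUniformlyOn ho hG₁
      (fun n x _ => (differentiable_of_contDiff_two (hu n) x).hasFDerivAt)
      (fun y hy => hU y (mem_ball_zero_iff.1 hy)) hx
  have hd2 : ∀ x ∈ Metric.ball (0 : E d) ρ, HasFDerivAt G₁ (G₂ x) x := fun x hx =>
    hasFDerivAt_of_tendstoLocallyUniformlyOn ho hG₂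
      (fun n x _ => (differentiable_fderiv (hu n) x).hasFDerivAt)
      (fun y hy => hG₁.tendsto_at hy) hx
  have hc : ContinuousOn G₂ (Metric.ball 0 ρ) :=
    hG₂.continuousOn (Frequently.of_forall fun n => (continuous_hess (hu n)).continuousOn)
  have hG₁c : ContDiffOn ℝ 1 G₁ (Metric.ball 0 ρ) := by
    rw [← zero_add (1 : WithTop ℕ∞), contDiffOn_succ_iff_hasFDerivWithinAt_of_uniqueDiffOn
      ho.uniqueDiffOn]
    exact ⟨by simp, G₂, contDiffOn_zero.2 hc, fun x hx => (hd2 x hx).hasFDerivWithinAt⟩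
  rw [← one_add_one_eq_two (R := WithTop ℕ∞), contDiffOn_succ_iff_hasFDerivWithinAt_of_uniqueDiffOn
    ho.uniqueDiffOn]
  exact ⟨by simp, G₁, hG₁c, fun x hx => (hd1 x hx).hasFDerivWithinAt⟩

/-- Solution of the Dirichlet problem in a ball as a uniform limit of harmonic polynomials. -/
lemma exists_dirichlet_solution {R : Finset (E d)} {k : E d → ℝ} (H : IsRootData R k)
    (hd : 1 ≤ d) {ρ : ℝ} (hρ : 0 < ρ) {h : E d → ℝ}
    (hh : ContinuousOn h (Metric.closedBall 0 ρ)) :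
    ∃ (u : ℕ → E d → ℝ) (U : E d → ℝ), (∀ n, ContDiff ℝ 2 (u n)) ∧
      (∀ n, regLap R k (u n) = 0) ∧ TendstoUniformlyOn u U atTop (Metric.closedBall 0 ρ) ∧
      (∀ x, ‖x‖ = ρ → U x = h x) ∧ ContDiffOn ℝ 2 U (Metric.ball 0 ρ) := by
  have hp : ∀ n : ℕ, ∃ N, ∃ p ∈ Pol d N, ∀ x ∈ Metric.closedBall (0 : E d) ρ,
      |p x - h x| < 1 / ((n : ℝ) + 1) := fun n =>
    exists_polynomial_near (isCompact_closedBall 0 ρ) hh (by positivity)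
  choose N p hpN hph using hp
  choose u huN hu0 hup using fun n => exists_harmonic_extension H hd hρ (hpN n)
  have hu2 : ∀ n, ContDiff ℝ 2 (u n) := fun n => contDiff_of_mem_Pol (huN n)
  have hsub : ∀ i j, u i - u j ∈ Pol d (N i + 2 + (N j + 2)) := fun i j =>
    Submodule.sub_mem _ (Pol_mono (Nat.le_add_right _ _) (huN i))
      (Pol_mono (Nat.le_add_left _ _) (huN j))
  have hsub0 : ∀ i j, regLap R k (u i - u j) = 0 := fun i j => by
    rw [regLap_sub R k (hu2 i) (hu2 j), hu0, hu0, sub_zero]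
  have hbd : ∀ i j, ∀ x : E d, ‖x‖ ≤ ρ →
      |(u i - u j) x| ≤ 1 / ((i : ℝ) + 1) + 1 / ((j : ℝ) + 1) := fun i j x hx => by
    refine abs_le_of_abs_le_on_sphere H hd ((hu2 i).sub (hu2 j)) (hsub0 i j) (fun y hy => ?_) hx
    change |u i y - u j y| ≤ _
    rw [hup i y hy, hup j y hy, ← sub_sub_sub_cancel_right _ _ (h y)]
    refine (abs_sub _ _).trans (add_le_add (hph i y ?_).le (hph j y ?_).le) <;> simp [hy]
  have hC0 : UniformCauchySeqOn u atTop (Metric.closedBall 0 ρ) :=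
    uniformCauchySeqOn_of_le zero_le_one fun i j x hx => by
      simpa using hbd i j x (by simpa using hx)
  have hCd : ∀ ρ₁, 0 ≤ ρ₁ → ρ₁ < ρ →
      UniformCauchySeqOn (fun n => fderiv ℝ (u n)) atTop (Metric.closedBall 0 ρ₁) ∧
      UniformCauchySeqOn (fun n => hess (u n)) atTop (Metric.closedBall 0 ρ₁) := by
    intro ρ₁ h0 h1
    obtain ⟨K, hK, hest⟩ := exists_interior_estimate H h0 h1
    have hf : ∀ i j, fderiv ℝ (u i - u j) = fderiv ℝ (u i) - fderiv ℝ (u j) := fun i j =>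
      funext fun x => fderiv_sub (differentiable_of_contDiff_two (hu2 i) x)
        (differentiable_of_contDiff_two (hu2 j) x)
    have hf2 : ∀ i j x, hess (u i - u j) x = hess (u i) x - hess (u j) x := fun i j x => by
      rw [hess, hf, fderiv_sub (differentiable_fderiv (hu2 i) x)
        (differentiable_fderiv (hu2 j) x)]
    refine ⟨uniformCauchySeqOn_of_le hK fun i j x hx => ?_,
      uniformCauchySeqOn_of_le (F := E d →L[ℝ] E d →L[ℝ] ℝ) (f := fun n => hess (u n)) hK
        fun i j x hx => ?_⟩
    · have := (hest _ _ (hsub i j) (hsub0 i j) _ (hbd i j) x (by simpa using hx)).1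
      rwa [hf] at this
    · have := (hest _ _ (hsub i j) (hsub0 i j) _ (hbd i j) x (by simpa using hx)).2
      rwa [hf2] at this
  have hlim : ∀ x ∈ Metric.closedBall (0 : E d) ρ, ∃ y, Tendsto (fun n => u n x) atTop (𝓝 y) :=
    fun x hx => cauchySeq_tendsto_of_complete (hC0.cauchySeq hx)
  choose! U hU using hlim
  refine ⟨u, U, hu2, hu0, hC0.tendstoUniformlyOn_of_tendsto hU, fun x hx => ?_,
    contDiffOn_of_uniformCauchySeqOn hu2 (fun x hx => hU x (by simpa using hx.le))
      (fun ρ₁ h0 h1 => (hCd ρ₁ h0 h1).1) fun ρ₁ h0 h1 => (hCd ρ₁ h0 h1).2⟩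
  have hxc : x ∈ Metric.closedBall (0 : E d) ρ := by simp [hx]
  refine tendsto_nhds_unique (hU x hxc) ?_
  rw [tendsto_iff_norm_sub_tendsto_zero]
  refine squeeze_zero (fun n => norm_nonneg _) (fun n => ?_)
    (tendsto_one_div_add_atTop_nhds_zero_nat (𝕜 := ℝ))
  rw [hup n x hx]
  exact (hph n x hxc).le

lemma setIntegral_limit_mul_regLap {R : Finset (E d)} {k : E d → ℝ} (H : IsRootData R k)
    {ρ : ℝ} {u : ℕ → E d → ℝ} {U : E d → ℝ} (hu : ∀ n, ContDiff ℝ 2 (u n))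
    (hu0 : ∀ n, regLap R k (u n) = 0)
    (hU : TendstoUniformlyOn u U atTop (Metric.closedBall 0 ρ)) {ψ : E d → ℝ}
    (hψ : ContDiff ℝ 2 ψ) (hψs : tsupport ψ ⊆ Metric.closedBall 0 ρ) :
    ∫ x in Metric.closedBall 0 ρ, U x * regLap R k ψ x * wk R k x = 0 := by
  have hcs : HasCompactSupport ψ :=
    (isCompact_closedBall (0 : E d) ρ).of_isClosed_subset (isClosed_tsupport _) hψs
  have hw := continuous_wk H.pos
  have hL := continuous_regLap R k hψ
  have hcK := isCompact_closedBall (0 : E d) ρ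
  have hUc : ContinuousOn U (Metric.closedBall 0 ρ) :=
    hU.continuousOn (Frequently.of_forall fun n => (hu n).continuous.continuousOn)
  have hn : ∀ n, ∫ x in Metric.closedBall 0 ρ, u n x * regLap R k ψ x * wk R k x = 0 := by
    intro n
    rw [setIntegral_eq_integral_of_forall_compl_eq_zero fun x hx => by
        rw [regLap_eq_zero_of_lt_norm H.ne_zero k hψs hψ (by simpa using hx), mul_zero, zero_mul],
      integral_regLap_symm H.ne_zero H.refl H.pos H.inv (hu n) hψ hcs, hu0]
    simp
  have hInt : ∀ {g : E d → ℝ}, ContinuousOn g (Metric.closedBall 0 ρ) →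
      IntegrableOn (fun x => g x * regLap R k ψ x * wk R k x) (Metric.closedBall 0 ρ) :=
    fun hg => ((hg.mul hL.continuousOn).mul hw.continuousOn).integrableOn_compact hcK
  set A := ∫ x in Metric.closedBall (0 : E d) ρ, |regLap R k ψ x| * wk R k x
  have hA : 0 ≤ A := integral_nonneg fun x => mul_nonneg (abs_nonneg _) (wk_nonneg R k x)
  rw [← abs_nonpos_iff]
  refine le_of_forall_pos_le_add fun η hη => ?_
  obtain ⟨n, hnη⟩ := ((Metric.tendstoUniformlyOn_iff.1 hU (η / (A + 1)) (by positivity))).exists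
  have h1 : ∫ x in Metric.closedBall 0 ρ, U x * regLap R k ψ x * wk R k x =
      ∫ x in Metric.closedBall 0 ρ, (U x - u n x) * regLap R k ψ x * wk R k x := by
    simp only [sub_mul]
    rw [integral_sub (hInt hUc) (hInt (hu n).continuous.continuousOn), hn n, sub_zero]
  rw [h1, zero_add]
  calc |∫ x in Metric.closedBall 0 ρ, (U x - u n x) * regLap R k ψ x * wk R k x|
      ≤ ∫ x in Metric.closedBall 0 ρ, |(U x - u n x) * regLap R k ψ x * wk R k x| :=
        abs_integral_le_integral_abs
    _ ≤ ∫ x in Metric.closedBall 0 ρ, η / (A + 1) * (|regLap R k ψ x| * wk R k x) := by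
        refine setIntegral_mono_on (hInt (hUc.sub (hu n).continuous.continuousOn)).abs
          ((continuous_const.mul (hL.abs.mul hw)).continuousOn.integrableOn_compact hcK)
          measurableSet_closedBall fun x hx => ?_
        rw [abs_mul, abs_mul, abs_of_nonneg (wk_nonneg R k x), mul_assoc]
        exact mul_le_mul_of_nonneg_right (hnη x hx).le
          (mul_nonneg (abs_nonneg _) (wk_nonneg R k x))
    _ = η / (A + 1) * A := integral_const_mul _ _
    _ ≤ η := by rw [div_mul_eq_mul_div, div_le_iff₀ (by positivity)]; nlinarith

/-! ### Uniqueness for the distributional Dirichlet problem -/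

lemma contDiff_infty_ramp (ε : ℝ) : ContDiff ℝ (⊤ : ℕ∞) (ramp ε) :=
  contDiff_infty_iff_deriv.2 ⟨fun t => (hasDerivAt_ramp ε t).differentiableAt, by
    rw [deriv_ramp]; exact contDiff_slope ε⟩

lemma contDiff_infty_cut (ε ρ : ℝ) : ContDiff ℝ (⊤ : ℕ∞) (cut ε ρ) :=
  (contDiff_infty_ramp ε).comp (contDiff_const.sub contDiff_id)

lemma exists_shell_le {ρ : ℝ} {v : E d → ℝ} (hv : ContinuousOn v (Metric.closedBall 0 ρ))
    (hv0 : ∀ x, ‖x‖ = ρ → v x = 0) {η : ℝ} (hη : 0 < η) :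
    ∃ ε, 0 < ε ∧ ε ≤ η ∧ ∀ x, ‖x‖ ≤ ρ → ρ ^ 2 - ‖x‖ ^ 2 ≤ 2 * ε → |v x| ≤ η := by
  set K := Metric.closedBall (0 : E d) ρ ∩ (fun x => |v x|) ⁻¹' Set.Ici η with hKdef
  have hK : IsCompact K := (isCompact_closedBall 0 ρ).of_isClosed_subset
    (hv.abs.preimage_isClosed_of_isClosed Metric.isClosed_closedBall isClosed_Ici)
    Set.inter_subset_left
  rcases K.eq_empty_or_nonempty with he | hne
  · refine ⟨η, hη, le_rfl, fun x hx _ => ?_⟩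
    by_contra! hcon
    have : x ∈ K := ⟨by simpa using hx, hcon.le⟩
    rw [he] at this
    exact this
  · obtain ⟨z, hz, hzmin⟩ := hK.exists_isMinOn hne
      (f := fun x => ρ ^ 2 - ‖x‖ ^ 2) (by fun_prop)
    have hzρ : ‖z‖ ≤ ρ := by simpa using hz.1
    have hzη : η ≤ |v z| := hz.2
    have hlt : ‖z‖ < ρ := hzρ.lt_of_ne fun h => by
      rw [hv0 z h, abs_zero] at hzη
      linarith
    have hc : 0 < ρ ^ 2 - ‖z‖ ^ 2 := by
      have := pow_lt_pow_left₀ hlt (norm_nonneg z) two_ne_zero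
      linarith
    refine ⟨min η ((ρ ^ 2 - ‖z‖ ^ 2) / 3), lt_min hη (by linarith), min_le_left _ _,
      fun x hx hxε => ?_⟩
    by_contra! hcon
    have h1 : ρ ^ 2 - ‖z‖ ^ 2 ≤ ρ ^ 2 - ‖x‖ ^ 2 := hzmin ⟨by simpa using hx, hcon.le⟩
    have h2 := min_le_right η ((ρ ^ 2 - ‖z‖ ^ 2) / 3)
    linarith

lemma regLap_const {R : Finset (E d)} {k : E d → ℝ} (H : IsRootData R k) (c : ℝ) :
    regLap R k (fun _ => c) = 0 :=
  regLap_eq_zero_of_mem_HP H.ne_zero k (n := 0) (by norm_num) (const_mem_HP c)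

lemma setIntegral_deriv_slope_le {R : Finset (E d)} {k : E d → ℝ} (H : IsRootData R k)
    {ε ρ : ℝ} (hε : 0 < ε) (hρ : 0 ≤ ρ) :
    ∫ x in Metric.closedBall (0 : E d) ρ,
        4 * ‖x‖ ^ 2 * deriv (slope ε) (ρ ^ 2 - ‖x‖ ^ 2) * wk R k x ≤
      2 * (d + ∑ α ∈ R, k α) * ∫ x in Metric.closedBall (0 : E d) ρ, wk R k x := by
  set m : ℝ := d + ∑ α ∈ R, k α with hm
  have hm0 : 0 ≤ m := add_nonneg d.cast_nonneg (Finset.sum_nonneg fun α hα => (H.pos α hα).le)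
  have hw := continuous_wk H.pos
  have hcK := isCompact_closedBall (0 : E d) ρ
  have hs : Continuous fun x : E d => slope ε (ρ ^ 2 - ‖x‖ ^ 2) := continuous_slope_norm ε ρ
  have hds : Continuous fun x : E d => deriv (slope ε) (ρ ^ 2 - ‖x‖ ^ 2) :=
    continuous_deriv_slope_norm ε ρ
  have hψ : ContDiff ℝ 2 fun x : E d => (1 : ℝ) * cut ε ρ (‖x‖ ^ 2) :=
    contDiff_const.mul (contDiff_comp_norm_sq (contDiff_cut ε ρ))
  have h1 := integral_regLap_symm H.ne_zero H.refl H.pos H.inv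
    (contDiff_const (c := (1 : ℝ))) hψ (hasCompactSupport_mul_cut hε hρ fun _ => 1)
  have hexp : ∀ x : E d, (1 : ℝ) * regLap R k (fun x => (1 : ℝ) * cut ε ρ (‖x‖ ^ 2)) x *
      wk R k x = 4 * ‖x‖ ^ 2 * deriv (slope ε) (ρ ^ 2 - ‖x‖ ^ 2) * wk R k x -
        2 * m * (slope ε (ρ ^ 2 - ‖x‖ ^ 2) * wk R k x) := fun x => by
    rw [regLap_mul_cut H contDiff_const ε ρ x, regLap_const H]
    simp only [fderiv_fun_const, Pi.zero_apply, _root_.zero_apply]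
    ring
  simp only [hexp, regLap_const H, Pi.zero_apply, mul_zero, zero_mul, integral_zero] at h1
  rw [← setIntegral_eq_integral_of_forall_compl_eq_zero (s := Metric.closedBall (0 : E d) ρ)
    fun x hx => by
      have hx : ρ < ‖x‖ := by simpa using hx
      rw [slope_eq_zero_of_lt_norm hε hρ hx, deriv_slope_eq_zero_of_lt_norm hε hρ hx]
      ring,
    integral_sub (Continuous.continuousOn (by fun_prop) |>.integrableOn_compact hcK)
      (Continuous.continuousOn (by fun_prop) |>.integrableOn_compact hcK),
    integral_const_mul, sub_eq_zero] at h1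
  rw [h1]
  refine mul_le_mul_of_nonneg_left (setIntegral_mono_on
    ((hs.mul hw).continuousOn.integrableOn_compact hcK)
    (hw.continuousOn.integrableOn_compact hcK) measurableSet_closedBall fun x _ => ?_)
    (by positivity)
  exact mul_le_of_le_one_left (wk_nonneg R k x) (slope_le_one _ _)

lemma regLap_mul_sub_norm_sq {R : Finset (E d)} {k : E d → ℝ} (H : IsRootData R k) {s : E d → ℝ}
    (hs : ContDiff ℝ 2 s) (ρ : ℝ) (x : E d) :
    regLap R k (fun y => s y * (ρ ^ 2 - ‖y‖ ^ 2)) x = (ρ ^ 2 - ‖x‖ ^ 2) * regLap R k s x -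
      4 * fderiv ℝ s x x - 2 * (d + ∑ α ∈ R, k α) * s x := by
  have hd1 : deriv (fun t : ℝ => ρ ^ 2 - t) = fun _ => -1 := by
    funext t
    simp
  rw [regLap_mul_comp_norm_sq H.ne_zero k hs (Φ := fun t => ρ ^ 2 - t)
    (contDiff_const.sub contDiff_id), hd1]
  simp only [deriv_const]
  ring

lemma abs_mul_sub_regLap_cut_le {R : Finset (E d)} {k : E d → ℝ} (H : IsRootData R k)
    {s : E d → ℝ} (hs : ContDiff ℝ 2 s) {ε ρ η B : ℝ} (hε : 0 < ε) (hεη : ε ≤ η) {v : E d → ℝ}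
    {x : E d} (hx : ‖x‖ ≤ ρ) (hv : |v x| ≤ B) (hs0 : |s x| ≤ B) (hs1 : |fderiv ℝ s x x| ≤ B)
    (hs2 : |regLap R k s x| ≤ B) (hvη : ρ ^ 2 - ‖x‖ ^ 2 ≤ 2 * ε → |v x| ≤ η) :
    |v x * (regLap R k (fun y => s y * (ρ ^ 2 - ‖y‖ ^ 2)) x -
        regLap R k (fun y => s y * cut ε ρ (‖y‖ ^ 2)) x)| ≤
      η * (2 * B ^ 2 + (4 + 2 * (d + ∑ α ∈ R, k α)) * B) +
        η * B * (4 * ‖x‖ ^ 2 * deriv (slope ε) (ρ ^ 2 - ‖x‖ ^ 2)) := by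
  set m : ℝ := d + ∑ α ∈ R, k α with hm
  have hm0 : 0 ≤ m := add_nonneg d.cast_nonneg (Finset.sum_nonneg fun α hα => (H.pos α hα).le)
  have hB : 0 ≤ B := (abs_nonneg _).trans hv
  have hη : 0 < η := hε.trans_le hεη
  set g := ρ ^ 2 - ‖x‖ ^ 2 with hg
  have hg0 : 0 ≤ g := by
    have := pow_le_pow_left₀ (norm_nonneg x) hx 2
    linarith
  have hds0 := deriv_slope_nonneg hε g
  have hsl1 := slope_le_one ε g
  have heq : v x * (regLap R k (fun y => s y * (ρ ^ 2 - ‖y‖ ^ 2)) x -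
        regLap R k (fun y => s y * cut ε ρ (‖y‖ ^ 2)) x) =
      v x * (g - ramp ε g) * regLap R k s x +
        (v x * (1 - slope ε g)) * (-(4 * fderiv ℝ s x x + 2 * m * s x)) +
        (v x * deriv (slope ε) g) * (-(4 * ‖x‖ ^ 2 * s x)) := by
    rw [regLap_mul_sub_norm_sq H hs, regLap_mul_cut H hs]
    simp only [cut, ← hg, ← hm]
    ring
  have h1 : |v x * (g - ramp ε g) * regLap R k s x| ≤ B * (2 * η) * B := by
    rw [abs_mul, abs_mul]
    have := abs_ramp_sub_le hε hg0
    rw [abs_sub_comm] at this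
    gcongr
    linarith
  have h2 : |v x * (1 - slope ε g)| ≤ η := by
    rcases le_or_gt g (2 * ε) with hle | hgt
    · rw [abs_mul, abs_of_nonneg (by linarith : 0 ≤ 1 - slope ε g)]
      calc |v x| * (1 - slope ε g) ≤ η * 1 :=
            mul_le_mul (hvη hle) (by linarith [slope_nonneg ε g]) (by linarith) hη.le
        _ = η := mul_one η
    · rw [slope_eq_one hε hgt.le]
      simpa using hη.le
  have h3 : |v x * deriv (slope ε) g| ≤ η * deriv (slope ε) g := by
    rw [abs_mul, abs_of_nonneg hds0]
    rcases le_or_gt g (2 * ε) with hle | hgt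
    · gcongr
      exact hvη hle
    · rw [deriv_slope_eq_zero_of_gt hε hgt, mul_zero, mul_zero]
  have h4 : |-(4 * fderiv ℝ s x x + 2 * m * s x)| ≤ 4 * B + 2 * m * B := by
    rw [abs_neg]
    refine (abs_add_le _ _).trans ?_
    rw [abs_mul, abs_mul (2 * m), abs_of_nonneg (by positivity : 0 ≤ 2 * m),
      abs_of_pos (by norm_num : (0 : ℝ) < 4)]
    gcongr
  have h5 : |-(4 * ‖x‖ ^ 2 * s x)| ≤ 4 * ‖x‖ ^ 2 * B := by
    rw [abs_neg, abs_mul, abs_of_nonneg (by positivity : 0 ≤ 4 * ‖x‖ ^ 2)]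
    gcongr
  rw [heq]
  refine (abs_add_le _ _).trans ((add_le_add_left (abs_add_le _ _) _).trans ?_)
  rw [abs_mul (v x * (1 - slope ε g)), abs_mul (v x * deriv (slope ε) g)]
  have h6 := mul_le_mul h2 h4 (abs_nonneg _) hη.le
  have h7 := mul_le_mul h3 h5 (abs_nonneg _) (mul_nonneg hη.le hds0)
  linarith

lemma two_le_infty : (2 : WithTop ℕ∞) ≤ ((⊤ : ℕ∞) : WithTop ℕ∞) :=
  WithTop.coe_le_coe.2 (le_top : (2 : ℕ∞) ≤ ⊤)

lemma setIntegral_mul_polynomial_eq_zero {R : Finset (E d)} {k : E d → ℝ} (H : IsRootData R k)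
    {ρ : ℝ} (hρ : 0 < ρ) {v : E d → ℝ} (hv : ContinuousOn v (Metric.closedBall 0 ρ))
    (hv0 : ∀ x, ‖x‖ = ρ → v x = 0)
    (hvψ : ∀ ψ : E d → ℝ, ContDiff ℝ (⊤ : ℕ∞) ψ → tsupport ψ ⊆ Metric.ball 0 ρ →
      ∫ x in Metric.closedBall 0 ρ, v x * regLap R k ψ x * wk R k x = 0)
    {s : E d → ℝ} (hs : ContDiff ℝ (⊤ : ℕ∞) s) :
    ∫ x in Metric.closedBall 0 ρ,
      v x * regLap R k (fun y => s y * (ρ ^ 2 - ‖y‖ ^ 2)) x * wk R k x = 0 := by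
  set m : ℝ := d + ∑ α ∈ R, k α with hm
  have hm0 : 0 ≤ m := add_nonneg d.cast_nonneg (Finset.sum_nonneg fun α hα => (H.pos α hα).le)
  have hw := continuous_wk H.pos
  have hcK := isCompact_closedBall (0 : E d) ρ
  have hs2 : ContDiff ℝ 2 s := hs.of_le two_le_infty
  have hq : ContDiff ℝ 2 fun y : E d => s y * (ρ ^ 2 - ‖y‖ ^ 2) :=
    hs2.mul (contDiff_const.sub (contDiff_norm_sq ℝ))
  have hLs := continuous_regLap R k hs2
  have hDs : Continuous fun x => fderiv ℝ s x x :=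
    (contDiff_fderiv hs2).continuous.clm_apply continuous_id
  obtain ⟨B, hB⟩ : ∃ B, ∀ x ∈ Metric.closedBall (0 : E d) ρ,
      |v x| + |s x| + |fderiv ℝ s x x| + |regLap R k s x| ≤ B := by
    obtain ⟨B, hB⟩ := hcK.bddAbove_image (f := fun x =>
      |v x| + |s x| + |fderiv ℝ s x x| + |regLap R k s x|)
      (((hv.abs.add hs2.continuous.abs.continuousOn).add hDs.abs.continuousOn).add
        hLs.abs.continuousOn)
    exact ⟨B, fun x hx => hB ⟨x, hx, rfl⟩⟩
  have hB0 : 0 ≤ B := le_trans (by positivity) (hB 0 (by simpa using hρ.le))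
  set W := ∫ x in Metric.closedBall (0 : E d) ρ, wk R k x with hW
  have hW0 : 0 ≤ W := integral_nonneg fun x => wk_nonneg R k x
  set A := (2 * B ^ 2 + (4 + 2 * m) * B) * W + B * (2 * m * W) with hA
  have hA0 : 0 ≤ A := by positivity
  rw [← abs_nonpos_iff]
  refine le_of_forall_pos_le_add fun δ hδ => ?_
  set η := δ / (A + 1) with hηdef
  have hη : 0 < η := by positivity
  obtain ⟨ε, hε, hεη, hshell⟩ := exists_shell_le hv hv0 hη
  have hcut : ContDiff ℝ (⊤ : ℕ∞) fun y : E d => s y * cut ε ρ (‖y‖ ^ 2) :=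
    hs.mul (contDiff_comp_norm_sq (contDiff_infty_cut ε ρ))
  have hcut2 : ContDiff ℝ 2 fun y : E d => s y * cut ε ρ (‖y‖ ^ 2) :=
    hcut.of_le two_le_infty
  have hLq := continuous_regLap R k hq
  have hLc := continuous_regLap R k hcut2
  have hds : Continuous fun x : E d => deriv (slope ε) (ρ ^ 2 - ‖x‖ ^ 2) :=
    continuous_deriv_slope_norm ε ρ
  have hInt : ∀ {f : E d → ℝ}, Continuous f →
      IntegrableOn (fun x => v x * f x * wk R k x) (Metric.closedBall 0 ρ) := fun hf =>
    ((hv.mul hf.continuousOn).mul hw.continuousOn).integrableOn_compact hcK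
  have hInt' : ∀ {f : E d → ℝ}, Continuous f → IntegrableOn f (Metric.closedBall 0 ρ) :=
    fun hf => hf.continuousOn.integrableOn_compact hcK
  have h0 := hvψ _ hcut (tsupport_mul_cut_subset_ball hε hρ.le s)
  set F := regLap R k fun y => s y * (ρ ^ 2 - ‖y‖ ^ 2)
  set G := regLap R k fun y => s y * cut ε ρ (‖y‖ ^ 2)
  have h1 : ∫ x in Metric.closedBall 0 ρ, v x * F x * wk R k x =
      ∫ x in Metric.closedBall 0 ρ, v x * (F x - G x) * wk R k x := by
    simp only [mul_sub, sub_mul]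
    rw [integral_sub (hInt hLq) (hInt hLc), h0, sub_zero]
  rw [h1, zero_add]
  have hpt : ∀ x ∈ Metric.closedBall (0 : E d) ρ, |v x * (F x - G x) * wk R k x| ≤
      η * (2 * B ^ 2 + (4 + 2 * m) * B) * wk R k x +
        η * B * (4 * ‖x‖ ^ 2 * deriv (slope ε) (ρ ^ 2 - ‖x‖ ^ 2) * wk R k x) := by
    intro x hx
    have hxρ : ‖x‖ ≤ ρ := by simpa using hx
    have hBx := hB x hx
    have a1 := abs_nonneg (v x)
    have a2 := abs_nonneg (s x)
    have a3 := abs_nonneg (fderiv ℝ s x x)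
    have a4 := abs_nonneg (regLap R k s x)
    have h := abs_mul_sub_regLap_cut_le H hs2 hε hεη (v := v) hxρ (B := B) (by linarith)
      (by linarith) (by linarith) (by linarith) (hshell x hxρ)
    rw [abs_mul, abs_of_nonneg (wk_nonneg R k x)]
    refine (mul_le_mul_of_nonneg_right h (wk_nonneg R k x)).trans_eq ?_
    ring
  calc |∫ x in Metric.closedBall 0 ρ, v x * (F x - G x) * wk R k x|
      ≤ ∫ x in Metric.closedBall 0 ρ, |v x * (F x - G x) * wk R k x| :=
        abs_integral_le_integral_abs
    _ ≤ ∫ x in Metric.closedBall (0 : E d) ρ, (η * (2 * B ^ 2 + (4 + 2 * m) * B) * wk R k x +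
          η * B * (4 * ‖x‖ ^ 2 * deriv (slope ε) (ρ ^ 2 - ‖x‖ ^ 2) * wk R k x)) :=
        setIntegral_mono_on (hInt (hLq.sub hLc)).abs (hInt' (by fun_prop))
          measurableSet_closedBall hpt
    _ = η * (2 * B ^ 2 + (4 + 2 * m) * B) * W + η * B * ∫ x in Metric.closedBall (0 : E d) ρ,
          4 * ‖x‖ ^ 2 * deriv (slope ε) (ρ ^ 2 - ‖x‖ ^ 2) * wk R k x := by
        rw [integral_add (hInt' (by fun_prop)) (hInt' (by fun_prop)), integral_const_mul,
          integral_const_mul]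
    _ ≤ η * (2 * B ^ 2 + (4 + 2 * m) * B) * W + η * B * (2 * m * W) := by
        gcongr
        exact setIntegral_deriv_slope_le H hε hρ.le
    _ = δ / (A + 1) * A := by rw [hA, ← hηdef]; ring
    _ ≤ δ := by rw [div_mul_eq_mul_div, div_le_iff₀ (by positivity)]; nlinarith

lemma eq_zero_of_setIntegral_regLap_eq_zero {R : Finset (E d)} {k : E d → ℝ}
    (H : IsRootData R k) (hd : 1 ≤ d) {ρ : ℝ} (hρ : 0 < ρ) {v : E d → ℝ}
    (hv : ContinuousOn v (Metric.closedBall 0 ρ)) (hv0 : ∀ x, ‖x‖ = ρ → v x = 0)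
    (hvψ : ∀ ψ : E d → ℝ, ContDiff ℝ (⊤ : ℕ∞) ψ → tsupport ψ ⊆ Metric.ball 0 ρ →
      ∫ x in Metric.closedBall 0 ρ, v x * regLap R k ψ x * wk R k x = 0) :
    Set.EqOn v 0 (Metric.ball 0 ρ) := by
  have hw := continuous_wk H.pos
  have hcK := isCompact_closedBall (0 : E d) ρ
  have hpol : ∀ N, ∀ q ∈ Pol d N, ∫ x in Metric.closedBall 0 ρ, v x * q x * wk R k x = 0 := by
    intro N q hq
    obtain ⟨s, hs, rfl⟩ := exists_regLap_mul_eq H hd hρ hq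
    exact setIntegral_mul_polynomial_eq_zero H hρ hv hv0 hvψ (contDiff_of_mem_Pol hs)
  have hInt : ∀ {f : E d → ℝ}, ContinuousOn f (Metric.closedBall 0 ρ) →
      IntegrableOn (fun x => v x * f x * wk R k x) (Metric.closedBall 0 ρ) := fun hf =>
    ((hv.mul hf).mul hw.continuousOn).integrableOn_compact hcK
  have hnn : ∀ x, 0 ≤ v x * v x * wk R k x := fun x =>
    mul_nonneg (mul_self_nonneg _) (wk_nonneg R k x)
  set A := ∫ x in Metric.closedBall (0 : E d) ρ, |v x| * wk R k x
  have hA : 0 ≤ A := integral_nonneg fun x => mul_nonneg (abs_nonneg _) (wk_nonneg R k x)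
  have hsq : ∫ x in Metric.closedBall 0 ρ, v x * v x * wk R k x = 0 := by
    refine le_antisymm (le_of_forall_pos_le_add fun η hη => ?_) (integral_nonneg hnn)
    obtain ⟨N, q, hq, hqv⟩ := exists_polynomial_near hcK hv
      (show 0 < η / (A + 1) by positivity)
    have hqc : ContinuousOn q (Metric.closedBall 0 ρ) :=
      (contDiff_of_mem_Pol (m := 2) hq).continuous.continuousOn
    have h1 : ∫ x in Metric.closedBall 0 ρ, v x * v x * wk R k x =
        ∫ x in Metric.closedBall 0 ρ, v x * (v x - q x) * wk R k x := by
      simp only [mul_sub, sub_mul]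
      rw [integral_sub (hInt hv) (hInt hqc), hpol N q hq, sub_zero]
    rw [h1, zero_add]
    calc ∫ x in Metric.closedBall 0 ρ, v x * (v x - q x) * wk R k x
        ≤ ∫ x in Metric.closedBall 0 ρ, η / (A + 1) * (|v x| * wk R k x) := by
          refine setIntegral_mono_on (hInt (hv.sub hqc))
            ((continuousOn_const.mul (hv.abs.mul hw.continuousOn)).integrableOn_compact hcK)
            measurableSet_closedBall fun x hx => ?_
          rw [← mul_assoc]
          refine mul_le_mul_of_nonneg_right ?_ (wk_nonneg R k x)
          refine (le_abs_self _).trans ?_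
          rw [abs_mul, mul_comm, abs_sub_comm]
          exact mul_le_mul_of_nonneg_right (hqv x hx).le (abs_nonneg _)
      _ = η / (A + 1) * A := integral_const_mul _ _
      _ ≤ η := by rw [div_mul_eq_mul_div, div_le_iff₀ (by positivity)]; nlinarith
  have hae := (setIntegral_eq_zero_iff_of_nonneg_ae
    (ae_of_all _ hnn) (hInt hv)).1 hsq
  have hae' : (fun x => v x * v x * wk R k x) =ᵐ[volume.restrict (Metric.ball 0 ρ)] 0 :=
    ae_mono (Measure.restrict_mono Metric.ball_subset_closedBall le_rfl) hae
  have hvb := hv.mono (Metric.ball_subset_closedBall (x := (0 : E d)) (ε := ρ))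
  have heq := Measure.eqOn_open_of_ae_eq hae' Metric.isOpen_ball
    ((hvb.mul hvb).mul hw.continuousOn) continuousOn_const
  refine Set.EqOn.of_subset_closure (s := Metric.ball 0 ρ ∩ {x | ∀ α ∈ R, ⟪α, x⟫ ≠ 0})
    (fun x hx => ?_) hvb continuousOn_const Set.inter_subset_left
    ((dense_regular H.ne_zero).open_subset_closure_inter Metric.isOpen_ball)
  have h1 : v x * v x * wk R k x = 0 := heq hx.1
  exact mul_self_eq_zero.1 ((mul_eq_zero.1 h1).resolve_right (wk_pos hx.2).ne')

lemma setIntegral_mul_regLap_eq {R : Finset (E d)} {k : E d → ℝ} (H : IsRootData R k)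
    (h : E d → ℝ) {ψ : E d → ℝ} (hψ : ContDiff ℝ 2 ψ) {ρ : ℝ}
    (hψs : tsupport ψ ⊆ Metric.closedBall 0 ρ) {s : Set (E d)}
    (hs : Metric.closedBall 0 ρ ⊆ s) :
    ∫ x in s, h x * dunklLap R k ψ x * wk R k x =
      ∫ x, h x * regLap R k ψ x * wk R k x := by
  simp only [mul_assoc, dunklLap_mul_wk H.pos hψ]
  refine setIntegral_eq_integral_of_forall_compl_eq_zero fun x hx => ?_
  have : ρ < ‖x‖ := by
    by_contra hcon
    exact hx (hs (mem_closedBall_zero_iff.2 (not_lt.1 hcon)))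
  simp [regLap_eq_zero_of_lt_norm H.ne_zero k hψs hψ this]

lemma contDiffOn_of_isDunklHarmonic {R : Finset (E d)} {k : E d → ℝ} (H : IsRootData R k)
    (hd : 1 ≤ d) {r : ℝ} {h : E d → ℝ} (hh : ContinuousOn h (Metric.ball 0 r))
    (hharm : IsDunklHarmonic R k (Metric.ball 0 r) h) :
    ContDiffOn ℝ 2 h (Metric.ball 0 r) := by
  intro x hx
  rw [mem_ball_zero_iff] at hx
  obtain ⟨ρ, hxρ, hρr⟩ := exists_between hx
  have hρ : 0 < ρ := (norm_nonneg x).trans_lt hxρ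
  have hsub : Metric.closedBall (0 : E d) ρ ⊆ Metric.ball 0 r :=
    Metric.closedBall_subset_ball hρr
  have hhρ := hh.mono hsub
  obtain ⟨u, U, hu, hu0, hU, hUh, hUC⟩ := exists_dirichlet_solution H hd hρ hhρ
  have hUc : ContinuousOn U (Metric.closedBall 0 ρ) :=
    hU.continuousOn (Frequently.of_forall fun n => (hu n).continuous.continuousOn)
  have key : Set.EqOn (fun y => h y - U y) 0 (Metric.ball 0 ρ) := by
    refine eq_zero_of_setIntegral_regLap_eq_zero H hd hρ (hhρ.sub hUc)
      (fun y hy => by rw [hUh y hy, sub_self]) fun ψ hψ hψs => ?_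
    have hψ2 : ContDiff ℝ 2 ψ := hψ.of_le two_le_infty
    have hψc : tsupport ψ ⊆ Metric.closedBall 0 ρ := hψs.trans Metric.ball_subset_closedBall
    have hK := isCompact_closedBall (0 : E d) ρ
    have hInt : ∀ {f : E d → ℝ}, ContinuousOn f (Metric.closedBall 0 ρ) →
        IntegrableOn (fun x => f x * regLap R k ψ x * wk R k x) (Metric.closedBall 0 ρ) :=
      fun hf => ((hf.mul (continuous_regLap R k hψ2).continuousOn).mul
        (continuous_wk H.pos).continuousOn).integrableOn_compact hK
    have h1 : ∫ y in Metric.closedBall 0 ρ, h y * regLap R k ψ y * wk R k y = 0 := by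
      have h2 := hharm ψ hψ (hK.of_isClosed_subset (isClosed_tsupport _) hψc) (hψc.trans hsub)
      rw [setIntegral_mul_regLap_eq H h hψ2 hψc hsub,
        ← setIntegral_mul_regLap_eq H h hψ2 hψc subset_rfl] at h2
      simpa only [mul_assoc, dunklLap_mul_wk H.pos hψ2] using h2
    have h2 := setIntegral_limit_mul_regLap H hu hu0 hU hψ2 hψc
    simp only [sub_mul]
    rw [integral_sub (hInt hhρ) (hInt hUc), h1, h2, sub_zero]
  have hxb : Metric.ball (0 : E d) ρ ∈ 𝓝 x :=
    Metric.isOpen_ball.mem_nhds (mem_ball_zero_iff.2 hxρ)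
  refine ContDiffAt.contDiffWithinAt ?_
  refine (hUC.contDiffAt hxb).congr_of_eventuallyEq ?_
  filter_upwards [hxb] with y hy
  exact sub_eq_zero.1 (key hy)

lemma exists_contDiff_eqOn {r ρ : ℝ} (hρ : 0 ≤ ρ) (hρr : ρ < r) {h : E d → ℝ}
    (hh : ContDiffOn ℝ 2 h (Metric.ball 0 r)) :
    ∃ u : E d → ℝ, ContDiff ℝ 2 u ∧ Set.EqOn u h (Metric.closedBall 0 ρ) := by
  obtain ⟨τ, hρτ, hτr⟩ := exists_between hρr
  have hε : 0 < (τ ^ 2 - ρ ^ 2) / 2 := by nlinarith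
  refine ⟨fun x => h x * slope ((τ ^ 2 - ρ ^ 2) / 2) (τ ^ 2 - ‖x‖ ^ 2), ?_, fun x hx => ?_⟩
  · refine contDiff_iff_contDiffAt.2 fun x => ?_
    by_cases hx : ‖x‖ < r
    · refine (hh.contDiffAt (Metric.isOpen_ball.mem_nhds (mem_ball_zero_iff.2 hx))).mul ?_
      exact ((contDiff_slope _ (n := 2)).comp
        (contDiff_const.sub (contDiff_norm_sq ℝ))).contDiffAt
    · refine (contDiffAt_const (c := (0 : ℝ))).congr_of_eventuallyEq ?_
      filter_upwards [(isOpen_lt continuous_const continuous_norm).mem_nhds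
        (show τ < ‖x‖ from hτr.trans_le (not_lt.1 hx))] with y hy
      rw [slope_eq_zero_of_lt_norm hε (hρ.trans hρτ.le) hy, mul_zero]
  · rw [mem_closedBall_zero_iff] at hx
    have := pow_le_pow_left₀ (norm_nonneg x) hx 2
    simp only
    rw [slope_eq_one hε (by linarith), mul_one]

lemma dunklLap_congr {R : Finset (E d)} (k : E d → ℝ)
    {u h : E d → ℝ} {ρ : ℝ} (huh : Set.EqOn u h (Metric.closedBall 0 ρ)) {x : E d}
    (hx : ‖x‖ < ρ) : dunklLap R k u x = dunklLap R k h x := by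
  have hev : u =ᶠ[𝓝 x] h := by
    filter_upwards [Metric.isOpen_ball.mem_nhds (mem_ball_zero_iff.2 hx)] with y hy
    exact huh (Metric.ball_subset_closedBall hy)
  have h1 : iteratedFDeriv ℝ 2 u x = iteratedFDeriv ℝ 2 h x :=
    (hev.iteratedFDeriv ℝ 2).eq_of_nhds
  unfold dunklLap lap
  rw [h1, hev.gradient_eq, hev.eq_of_nhds]
  congr 1
  refine Finset.sum_congr rfl fun α hα => ?_
  rw [huh (x := dunklReflect α x)
    (mem_closedBall_zero_iff.2 (by rw [norm_dunklReflect]; exact hx.le))]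

/-- Green formula for a function of class `C²` on a ball. -/
lemma setIntegral_mul_dunklLap_eq {R : Finset (E d)} {k : E d → ℝ} (H : IsRootData R k)
    {u h : E d → ℝ} (hu : ContDiff ℝ 2 u) {ρ r : ℝ} (hρr : ρ < r)
    (huh : Set.EqOn u h (Metric.closedBall 0 ρ)) {ψ : E d → ℝ} (hψ : ContDiff ℝ 2 ψ)
    (hψs : tsupport ψ ⊆ Metric.closedBall 0 ρ) :
    ∫ x in Metric.ball 0 r, h x * dunklLap R k ψ x * wk R k x =
      ∫ x, ψ x * (regLap R k u x * wk R k x) := by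
  have hc : HasCompactSupport ψ :=
    (isCompact_closedBall (0 : E d) ρ).of_isClosed_subset (isClosed_tsupport _) hψs
  have h1 := integral_regLap_symm H.ne_zero H.refl H.pos H.inv hu hψ hc
  simp only [← mul_assoc]
  rw [setIntegral_mul_regLap_eq H h hψ hψs (Metric.closedBall_subset_ball hρr), ← h1]
  refine integral_congr_ae (ae_of_all _ fun x => ?_)
  by_cases hx : ‖x‖ ≤ ρ
  · simp only [huh (mem_closedBall_zero_iff.2 hx)]
  · simp [regLap_eq_zero_of_lt_norm H.ne_zero k hψs hψ (not_le.1 hx)]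

lemma dunklLap_eq_zero_of_isDunklHarmonic {R : Finset (E d)} {k : E d → ℝ}
    (H : IsRootData R k) {r : ℝ} {h : E d → ℝ} (hh : ContDiffOn ℝ 2 h (Metric.ball 0 r))
    (hharm : IsDunklHarmonic R k (Metric.ball 0 r) h) {x : E d} (hx : x ∈ Metric.ball 0 r)
    (hreg : ∀ α ∈ R, ⟪α, x⟫ ≠ 0) : dunklLap R k h x = 0 := by
  rw [mem_ball_zero_iff] at hx
  obtain ⟨ρ, hxρ, hρr⟩ := exists_between hx
  have hρ : 0 < ρ := (norm_nonneg x).trans_lt hxρ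
  obtain ⟨u, hu, huh⟩ := exists_contDiff_eqOn hρ.le hρr hh
  have hcont : Continuous fun y => regLap R k u y * wk R k y :=
    (continuous_regLap R k hu).mul (continuous_wk H.pos)
  have hae : ∀ᵐ y, y ∈ Metric.ball (0 : E d) ρ → regLap R k u y * wk R k y = 0 := by
    refine Metric.isOpen_ball.ae_eq_zero_of_integral_contDiff_smul_eq_zero
      (hcont.locallyIntegrable.locallyIntegrableOn _) fun ψ hψ hc hψs => ?_
    have hψc : tsupport ψ ⊆ Metric.closedBall 0 ρ := hψs.trans Metric.ball_subset_closedBall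
    simp only [smul_eq_mul]
    rw [← setIntegral_mul_dunklLap_eq H hu hρr huh (hψ.of_le two_le_infty) hψc]
    exact hharm ψ hψ hc (hψc.trans (Metric.closedBall_subset_ball hρr))
  have heq : Set.EqOn (fun y => regLap R k u y * wk R k y) (fun _ => 0) (Metric.ball 0 ρ) :=
    Measure.eqOn_open_of_ae_eq
      ((ae_restrict_iff' Metric.isOpen_ball.measurableSet).2 hae) Metric.isOpen_ball
      hcont.continuousOn continuousOn_const
  have h0 := heq (mem_ball_zero_iff.2 hxρ)
  rw [← dunklLap_congr k huh hxρ, dunklLap_eq_regLap hu hreg]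
  exact (mul_eq_zero.1 h0).resolve_right (wk_pos hreg).ne'

lemma isDunklHarmonic_of_dunklLap_eq_zero {R : Finset (E d)} {k : E d → ℝ}
    (H : IsRootData R k) {r : ℝ} (hr : 0 < r) {h : E d → ℝ}
    (hh : ContDiffOn ℝ 2 h (Metric.ball 0 r))
    (h0 : ∀ x ∈ Metric.ball (0 : E d) r, (∀ α ∈ R, ⟪α, x⟫ ≠ 0) → dunklLap R k h x = 0) :
    IsDunklHarmonic R k (Metric.ball 0 r) h := by
  intro ψ hψ hc hψs
  obtain ⟨ρ₁, hρ₁, hψ₁⟩ : ∃ ρ₁ ∈ Set.Ioo 0 r, tsupport ψ ⊆ Metric.ball 0 ρ₁ :=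
    exists_pos_lt_subset_ball hr (isClosed_tsupport ψ) hψs
  obtain ⟨ρ, hρ, hρr⟩ := exists_between hρ₁.2
  have hρ0 : 0 < ρ := hρ₁.1.trans hρ
  obtain ⟨u, hu, huh⟩ := exists_contDiff_eqOn hρ0.le hρr hh
  rw [setIntegral_mul_dunklLap_eq H hu hρr huh (hψ.of_le two_le_infty)
    (hψ₁.trans ((Metric.ball_subset_ball hρ.le).trans Metric.ball_subset_closedBall))]
  refine integral_eq_zero_of_ae (ae_of_all _ fun x => ?_)
  by_cases hx : ‖x‖ < ρ
  · by_cases hreg : ∀ α ∈ R, ⟪α, x⟫ ≠ 0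
    · have := h0 x (mem_ball_zero_iff.2 (hx.trans hρr)) hreg
      simp only [← dunklLap_eq_regLap hu hreg, dunklLap_congr k huh hx, this, zero_mul,
        mul_zero, Pi.zero_apply]
    · push Not at hreg
      obtain ⟨α, hα, hαx⟩ := hreg
      simp [wk_eq_zero H.pos hα hαx]
  · have : x ∉ tsupport ψ := fun hmem =>
      hx ((mem_ball_zero_iff.1 (hψ₁ hmem)).trans hρ)
    simp [image_eq_zero_of_notMem_tsupport this]

end Dunkl

/-- a continuous function on the ball `B` is Δ_k-harmonic in the distributional
sense iff it is C² on `B` and Δ_k h vanishes at every regular point of `B`. -/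
theorem dunkl_harmonic_iff
    (d : ℕ) (hd : 1 ≤ d)
    (R : Finset (E d)) (hR0 : ∀ α ∈ R, α ≠ 0)
    (hRline : ∀ α ∈ R, (R : Set (E d)) ∩ {x | ∃ c : ℝ, x = c • α} = {α, -α})
    (hRrefl : ∀ α ∈ R, ∀ β ∈ R, dunklReflect α β ∈ R)
    (k : E d → ℝ) (hkpos : ∀ α ∈ R, 0 < k α)
    (hkinv : ∀ α ∈ R, ∀ β ∈ R, k (dunklReflect α β) = k β)
    (hm : 2 < (d : ℝ) + ∑ α ∈ R, k α)
    (r : ℝ) (hr : 0 < r)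
    (h : E d → ℝ) (hh : ContinuousOn h (Metric.ball 0 r)) :
    IsDunklHarmonic R k (Metric.ball 0 r) h ↔
      (ContDiffOn ℝ 2 h (Metric.ball 0 r) ∧
        ∀ x ∈ Metric.ball (0 : E d) r, (∀ α ∈ R, ⟪α, x⟫ ≠ 0) → dunklLap R k h x = 0) := by
  have H : Dunkl.IsRootData R k := ⟨hR0, hRrefl, hkpos, hkinv⟩
  constructor
  · intro hharm
    have hC := Dunkl.contDiffOn_of_isDunklHarmonic H hd hh hharm
    exact ⟨hC, fun x hx hreg => Dunkl.dunklLap_eq_zero_of_isDunklHarmonic H hC hharm hx hreg⟩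
  · rintro ⟨hC, h0⟩
    exact Dunkl.isDunklHarmonic_of_dunklLap_eq_zero H hr hC h0
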